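/- arXiv:1202.2949 — 7 statements merged into one kernel-verified Lean document; each statement's English description precedes it below -/
import Mathlib

section
/- Let k be a field of characteristic zero and let f_1, …, f_n ∈ k(x_1, …, x_n) (the fraction field of k[x_1, …, x_n]) be algebraically dependent over k, i.e., suppose there is a nonzero polynomial h ∈ k[Y_1, …, Y_n] with h(f_1, …, f_n) = 0. Then the Jacobian determinant det((∂f_i/∂x_j)_{1 ≤ i,j ≤ n}) is zero in k(x_1, …, x_n), where ∂/∂x_j denotes the unique extension to k(x_1, …, x_n) of the j-th partial derivative on k[x_1, …, x_n]. -/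
theorem aux_chain {n : ℕ} {k L : Type*} [Field k] [Field L] [Algebra k L]
    (f : Fin n → L) (D : Derivation k L L) (h : MvPolynomial (Fin n) k) :
    D (MvPolynomial.aeval f h) =
      ∑ i, MvPolynomial.aeval f (MvPolynomial.pderiv i h) * D (f i) := by
  classical
  induction h using MvPolynomial.induction_on with
  | C a => simp
  | add p q hp hq => simp only [map_add, hp, hq, add_mul, Finset.sum_add_distrib]
  | mul_X p j hp =>
    simp only [map_mul, MvPolynomial.aeval_X, Derivation.leibniz, hp, MvPolynomial.pderiv_X,
      smul_eq_mul, map_add, add_mul, Finset.sum_add_distrib, Finset.mul_sum]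
    congr 1
    · rw [Finset.sum_eq_single j]
      · simp
      · intro b _ hb
        simp [Pi.single_apply, hb.symm]
      · simp
    · exact Finset.sum_congr rfl fun i _ => by ring

theorem aux_deg {n : ℕ} {k : Type*} [Field k] (d : ℕ) (h : MvPolynomial (Fin n) k)
    (hd : h.totalDegree ≤ d + 1) (i : Fin n) : (MvPolynomial.pderiv i h).totalDegree ≤ d := by
  rw [MvPolynomial.totalDegree_eq]
  refine Finset.sup_le fun m hm => ?_
  rw [MvPolynomial.mem_support_iff, MvPolynomial.coeff_pderiv] at hm
  have h1 := MvPolynomial.le_totalDegree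
    (MvPolynomial.mem_support_iff.mpr (left_ne_zero_of_mul hm))
  have h2 : ((m + Finsupp.single i 1).sum fun _ e => e) = (m.sum fun _ e => e) + 1 := by
    rw [Finsupp.sum_add_index'] <;> simp
  have h3 : m.toMultiset.card = m.sum fun _ e => e := Finsupp.card_toMultiset m
  omega

theorem aux_const {n : ℕ} {k : Type*} [Field k] [CharZero k] (h : MvPolynomial (Fin n) k)
    (hd : ∀ i, MvPolynomial.pderiv i h = 0) : h = MvPolynomial.C (MvPolynomial.coeff 0 h) := by
  classical
  ext m
  rw [MvPolynomial.coeff_C]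
  split_ifs with hm
  · rw [hm]
  · obtain ⟨i, hi⟩ : ∃ i, m i ≠ 0 := by
      by_contra! hc
      exact hm (Finsupp.ext fun i => (hc i).symm)
    have h1 := MvPolynomial.coeff_pderiv (i := i) h (m - Finsupp.single i 1)
    have h2 : m - Finsupp.single i 1 + Finsupp.single i 1 = m :=
      tsub_add_cancel_of_le (by
        rw [Finsupp.single_le_iff]
        omega)
    rw [hd i, h2, MvPolynomial.coeff_zero] at h1
    rcases mul_eq_zero.mp h1.symm with h3 | h3
    · exact h3
    · exact absurd h3 (Nat.cast_add_one_ne_zero _)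

theorem aux_main {n : ℕ} {k L : Type*} [Field k] [CharZero k] [Field L] [Algebra k L]
    (f : Fin n → L) (D : Fin n → Derivation k L L)
    (hJ : Matrix.det (Matrix.of fun i j => D j (f i)) ≠ 0) (d : ℕ) :
    ∀ h : MvPolynomial (Fin n) k, h.totalDegree ≤ d → MvPolynomial.aeval f h = 0 → h = 0 := by
  have key : ∀ h : MvPolynomial (Fin n) k, MvPolynomial.aeval f h = 0 →
      (∀ i, MvPolynomial.pderiv i h = 0) → h = 0 := by
    intro h h0 hd
    have hc := aux_const h hd
    rw [hc, MvPolynomial.aeval_C, map_eq_zero] at h0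
    rw [hc, h0, map_zero]
  induction d with
  | zero =>
    intro h hd h0
    refine key h h0 fun i => ?_
    rw [MvPolynomial.totalDegree_eq_zero_iff_eq_C.mp (Nat.le_zero.mp hd), MvPolynomial.pderiv_C]
  | succ d ih =>
    intro h hd h0
    refine key h h0 fun i => ih _ (aux_deg d h hd i) ?_
    have hv := Matrix.eq_zero_of_vecMul_eq_zero hJ
      (v := fun i => MvPolynomial.aeval f (MvPolynomial.pderiv i h)) (by
        ext j
        have := aux_chain f (D j) h
        rw [h0, map_zero] at this
        simpa [Matrix.vecMul, dotProduct] using this.symm)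
    exact congrFun hv i

/-- If `f₁, …, fₙ ∈ k(x₁, …, xₙ)` are algebraically dependent over a field `k`
of characteristic zero, then their Jacobian determinant (taken with respect to the unique
extensions of the partial derivatives `∂/∂xⱼ` to the fraction field) is zero. -/
theorem jacobian_det_eq_zero_of_algebraicDependent
    (n : ℕ) (k : Type*) [Field k] [CharZero k]
    (f : Fin n → FractionRing (MvPolynomial (Fin n) k))
    (D : Fin n → Derivation k (FractionRing (MvPolynomial (Fin n) k))
      (FractionRing (MvPolynomial (Fin n) k)))
    (hD : ∀ (j : Fin n) (p : MvPolynomial (Fin n) k),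
      D j (algebraMap (MvPolynomial (Fin n) k) (FractionRing (MvPolynomial (Fin n) k)) p) =
        algebraMap (MvPolynomial (Fin n) k) (FractionRing (MvPolynomial (Fin n) k))
          (MvPolynomial.pderiv j p))
    (h : MvPolynomial (Fin n) k) (hh : h ≠ 0)
    (hdep : MvPolynomial.aeval f h = 0) :
    Matrix.det (Matrix.of fun i j => D j (f i)) = 0 := by
  by_contra hJ
  exact hh (aux_main f D hJ _ h le_rfl hdep)
end

section
/- Let k ⊆ K be an algebraic field extension and let p, q ∈ k[x_1, …, x_n] be relatively prime, i.e., have no common nonunit divisor in k[x_1, …, x_n]. Then the images of p and q in K[x_1, …, x_n] are relatively prime in K[x_1, …, x_n]. -/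
attribute [local instance] MvPolynomial.algebraMvPolynomial in
theorem exists_basis_aux (n : ℕ) (k K : Type*) [Field k] [Field K] [Algebra k K] :
    Module.Free (MvPolynomial (Fin n) k) (MvPolynomial (Fin n) K) := by
  have h : Algebra.IsPushout k (MvPolynomial (Fin n) k) K (MvPolynomial (Fin n) K) := inferInstance
  exact Module.Free.of_equiv h.1.equiv

/-- If `k ⊆ K` is an algebraic field extension and `p, q ∈ k[x₁, …, xₙ]` are
relatively prime, then their images in `K[x₁, …, xₙ]` are relatively prime. -/
theorem isRelPrime_map_of_isAlgebraic
    (n : ℕ) (k K : Type*) [Field k] [Field K] [Algebra k K] [Algebra.IsAlgebraic k K]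
    (p q : MvPolynomial (Fin n) k)
    (h : ∀ d : MvPolynomial (Fin n) k, d ∣ p → d ∣ q → IsUnit d) :
    ∀ d : MvPolynomial (Fin n) K,
      d ∣ MvPolynomial.map (algebraMap k K) p →
      d ∣ MvPolynomial.map (algebraMap k K) q → IsUnit d := by
  intro d hp hq
  by_cases hp0 : p = 0
  · have hu : IsUnit q := h q (hp0 ▸ dvd_zero q) dvd_rfl
    exact isUnit_of_dvd_unit hq (hu.map _)
  letI : Algebra (MvPolynomial (Fin n) k) (MvPolynomial (Fin n) K) :=
    MvPolynomial.algebraMvPolynomial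
  haveI := exists_basis_aux n k K
  have hm : ∀ (r : MvPolynomial (Fin n) k) (s : MvPolynomial (Fin n) K),
      MvPolynomial.map (algebraMap k K) r * s = r • s := fun r s => (Algebra.smul_def r s).symm
  let b := Module.Free.chooseBasis (MvPolynomial (Fin n) k) (MvPolynomial (Fin n) K)
  obtain ⟨u, hu⟩ := hp
  obtain ⟨v, hv⟩ := hq
  have e : q • u = p • v := by
    rw [← hm, ← hm, hu, hv]; ring
  have hd : ∀ i, p ∣ b.repr u i := by
    intro i
    have e' := congrArg (fun x => b.repr x i) e
    simp only [map_smul, Finsupp.smul_apply, smul_eq_mul] at e'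
    have hr : IsRelPrime p q := fun x hx hy => h x hx hy
    exact hr.dvd_of_dvd_mul_left ⟨_, e'⟩
  have hw : ∃ w, u = p • w := by
    choose c hc using hd
    refine ⟨∑ i ∈ (b.repr u).support, c i • b i, ?_⟩
    conv_lhs => rw [← b.linearCombination_repr u]
    rw [Finsupp.linearCombination_apply, Finsupp.sum, Finset.smul_sum]
    refine Finset.sum_congr rfl fun i _ => ?_
    rw [smul_smul, ← hc]
  obtain ⟨w, hw⟩ := hw
  have hp1 : MvPolynomial.map (algebraMap k K) p ≠ 0 := fun h0 =>
    hp0 (MvPolynomial.map_injective _ (algebraMap k K).injective (by rw [h0, map_zero]))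
  rw [← hm] at hw
  refine IsUnit.of_mul_eq_one w (mul_left_cancel₀ hp1 ?_)
  rw [mul_one]
  conv_rhs => rw [hu, hw]
  ring
end

section
/- Let k ⊆ K be an arbitrary field extension and let p, q ∈ k[x_1, …, x_n] be relatively prime, i.e., have no common nonunit divisor in k[x_1, …, x_n]. Then the images of p and q in K[x_1, …, x_n] are relatively prime in K[x_1, …, x_n]. (Equivalently: a reduced fraction p/q of polynomials over k remains reduced over any extension field K.) -/
open MvPolynomial in
theorem aux_exists_push {n : ℕ} {k K : Type*} [Field k] [Field K] [Algebra k K]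
    (f : K →ₗ[k] k) (A : MvPolynomial (Fin n) K) :
    ∃ a : MvPolynomial (Fin n) k, ∀ m, coeff m a = f (coeff m A) := by
  classical
  refine ⟨∑ m ∈ A.support, monomial m (f (coeff m A)), fun m => ?_⟩
  rw [coeff_sum]
  simp only [coeff_monomial]
  rw [Finset.sum_ite_eq']
  split_ifs with h
  · rfl
  · rw [notMem_support_iff.mp h, map_zero]

open MvPolynomial in
theorem aux_push_mul {n : ℕ} {k K : Type*} [Field k] [Field K] [Algebra k K]
    (f : K →ₗ[k] k) (A : MvPolynomial (Fin n) K) (a q : MvPolynomial (Fin n) k)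
    (ha : ∀ m, coeff m a = f (coeff m A)) (m : Fin n →₀ ℕ) :
    coeff m (a * q) = f (coeff m (A * map (algebraMap k K) q)) := by
  classical
  rw [coeff_mul, coeff_mul, map_sum]
  refine Finset.sum_congr rfl fun x _ => ?_
  rw [coeff_map, ha, mul_comm (coeff x.1 A), ← Algebra.smul_def, map_smul, smul_eq_mul, mul_comm]

/-- If `k ⊆ K` is an arbitrary field extension and `p, q ∈ k[x₁, …, xₙ]` are
relatively prime, then their images in `K[x₁, …, xₙ]` are relatively prime; that is, a
reduced fraction of polynomials over `k` remains reduced over any extension field. -/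
theorem isRelPrime_map_of_fieldExtension
    (n : ℕ) (k K : Type*) [Field k] [Field K] [Algebra k K]
    (p q : MvPolynomial (Fin n) k)
    (h : ∀ d : MvPolynomial (Fin n) k, d ∣ p → d ∣ q → IsUnit d) :
    ∀ d : MvPolynomial (Fin n) K,
      d ∣ MvPolynomial.map (algebraMap k K) p →
      d ∣ MvPolynomial.map (algebraMap k K) q → IsUnit d := by
  intro d hp hq
  by_cases hp0 : p = 0
  · have hu : IsUnit q := h q (hp0 ▸ dvd_zero q) dvd_rfl
    exact isUnit_of_dvd_unit hq (hu.map (MvPolynomial.map (algebraMap k K)))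
  obtain ⟨A, hA⟩ := hp
  obtain ⟨B, hB⟩ := hq
  have hinj := MvPolynomial.map_injective (σ := Fin n) (algebraMap k K) (algebraMap k K).injective
  have hP0 : MvPolynomial.map (algebraMap k K) p ≠ 0 := by
    intro h0
    exact hp0 (hinj (by rw [h0, map_zero]))
  have hd0 : d ≠ 0 := by rintro rfl; exact hP0 (by rw [hA, zero_mul])
  have hA0 : A ≠ 0 := by rintro rfl; exact hP0 (by rw [hA, mul_zero])
  obtain ⟨m, hm⟩ := MvPolynomial.ne_zero_iff.mp hA0
  obtain ⟨f, hf⟩ : ∃ f : K →ₗ[k] k, f (MvPolynomial.coeff m A) ≠ 0 := by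
    by_contra! hc
    exact hm ((Module.forall_dual_apply_eq_zero_iff k _).mp hc)
  obtain ⟨a, ha⟩ := aux_exists_push f A
  obtain ⟨b, hb⟩ := aux_exists_push f B
  have hab : a * q = b * p := by
    ext m
    rw [aux_push_mul f A a q ha, aux_push_mul f B b p hb, hA, hB]
    congr 2
    ring
  have hrel : IsRelPrime p q := fun d h1 h2 => h d h1 h2
  have hpa : p ∣ a := hrel.dvd_of_dvd_mul_right (hab ▸ dvd_mul_left p b)
  have ha0 : a ≠ 0 := MvPolynomial.ne_zero_iff.mpr ⟨m, by rw [ha]; exact hf⟩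
  have h1 : p.totalDegree ≤ a.totalDegree := by
    obtain ⟨c, rfl⟩ := hpa
    rw [MvPolynomial.totalDegree_mul_of_isDomain hp0 (right_ne_zero_of_mul ha0)]
    omega
  have h2 : a.totalDegree ≤ A.totalDegree := by
    refine Finset.sup_mono fun s hs => ?_
    rw [MvPolynomial.mem_support_iff] at hs ⊢
    intro h0
    exact hs (by rw [ha, h0, map_zero])
  have h3 : (MvPolynomial.map (algebraMap k K) p).totalDegree ≤ p.totalDegree :=
    Finset.sup_mono (MvPolynomial.support_map_subset _ _)
  rw [hA, MvPolynomial.totalDegree_mul_of_isDomain hd0 hA0] at h3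
  have h4 : d.totalDegree = 0 := by omega
  rw [MvPolynomial.totalDegree_eq_zero_iff_eq_C] at h4
  rw [h4]
  refine IsUnit.map _ (isUnit_iff_ne_zero.mpr fun h0 => hd0 ?_)
  rw [h4, h0, map_zero]
end

section
/- Let p, q ∈ ℝ[x_1, …, x_n] be relatively prime real polynomials with q not the zero polynomial, let U = {x ∈ ℝ^n : q(x) ≠ 0}, and let f : U → ℝ be the real analytic function f(x) = p(x)/q(x). If x₀ ∈ ℝ^n satisfies q(x₀) = 0, then x₀ is a boundary point of U, and there is no real analytic function g defined on an open neighborhood V of x₀ such that g = f on U ∩ V; that is, f cannot be analytically extended to x₀. -/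
open MvPolynomial Filter Topology Asymptotics in
lemma aux_poly_dvd (k : ℕ) : ∀ (L : Polynomial ℝ), 
    (fun t : ℝ => L.eval t) =O[𝓝 0] (fun t : ℝ => t ^ k) → Polynomial.X ^ k ∣ L := by
  induction k with
  | zero => intro L _; simp
  | succ k ih =>
    intro L hL
    have h1 : (fun t : ℝ => L.eval t) =O[𝓝 0] (fun t : ℝ => t ^ k) := by
      refine hL.trans ?_
      have : (fun t : ℝ => t ^ k * t) =O[𝓝 0] (fun t : ℝ => t ^ k * 1) := by
        refine (isBigO_refl _ _).mul ?_
        exact (continuous_id.tendsto (0:ℝ)).isBigO_one ℝ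
      simpa [pow_succ] using this
    obtain ⟨M, rfl⟩ := ih L h1
    have h2 : (fun t : ℝ => M.eval t) =O[𝓝[≠] 0] (fun t : ℝ => t) := by
      obtain ⟨c, hc⟩ := hL.bound
      refine IsBigO.of_bound c ?_
      filter_upwards [nhdsWithin_le_nhds hc, self_mem_nhdsWithin] with t ht ht0
      have ht0 : t ≠ 0 := ht0
      have hp : 0 < ‖t ^ k‖ := norm_pos_iff.2 (pow_ne_zero _ ht0)
      simp only [Polynomial.eval_mul, Polynomial.eval_pow, Polynomial.eval_X, pow_succ, norm_mul] at ht
      refine le_of_mul_le_mul_left (ht.trans_eq ?_) hp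
      ring
    have h3 : Tendsto (fun t : ℝ => M.eval t) (𝓝[≠] 0) (𝓝 0) :=
      h2.trans_tendsto (tendsto_id.mono_left nhdsWithin_le_nhds)
    have h4 : Tendsto (fun t : ℝ => M.eval t) (𝓝[≠] 0) (𝓝 (M.eval 0)) :=
      (M.continuous.tendsto 0).mono_left nhdsWithin_le_nhds
    have h5 := tendsto_nhds_unique h4 h3
    have h6 : Polynomial.X ∣ M := by
      rw [Polynomial.X_dvd_iff, Polynomial.coeff_zero_eq_eval_zero, h5]
    rw [pow_succ]
    exact mul_dvd_mul_left _ h6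

open MvPolynomial in
lemma aux_coeff_line {n : ℕ} (P : MvPolynomial (Fin n) ℝ) (v : Fin n → ℝ) (j : ℕ) :
    (aeval (fun i => Polynomial.C (v i) * Polynomial.X) P : Polynomial ℝ).coeff j
      = eval v (homogeneousComponent j P) := by
  induction P using MvPolynomial.induction_on' with
  | monomial u a =>
    have h : (aeval (fun i => Polynomial.C (v i) * Polynomial.X) (monomial u a) : Polynomial ℝ)
        = Polynomial.C (eval v (monomial u a)) * Polynomial.X ^ u.degree := by
      rw [aeval_monomial, eval_monomial, Finsupp.prod_fintype _ _ (by simp),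
        Finsupp.prod_fintype _ _ (by simp), Finsupp.degree_eq_sum]
      simp only [mul_pow, Finset.prod_mul_distrib, Finset.prod_pow_eq_pow_sum, map_mul, map_prod, map_pow]
      simp [mul_assoc, Polynomial.algebraMap_eq]
    rw [h, Polynomial.coeff_C_mul_X_pow,
      homogeneousComponent_of_mem (isHomogeneous_monomial a rfl)]
    split_ifs <;> simp
  | add p q hp hq => simp [hp, hq]

open MvPolynomial in
lemma aux_eval_line {n : ℕ} (P : MvPolynomial (Fin n) ℝ) (v : Fin n → ℝ) (t : ℝ) :
    (aeval (fun i => Polynomial.C (v i) * Polynomial.X) P : Polynomial ℝ).eval t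
      = eval (t • v) P := by
  induction P using MvPolynomial.induction_on with
  | C a => simp
  | add p q hp hq => simp [hp, hq]
  | mul_X p i hp =>
    rw [map_mul, Polynomial.eval_mul, hp, map_mul, aeval_X, eval_X]
    simp only [Polynomial.eval_mul, Polynomial.eval_C, Polynomial.eval_X, Pi.smul_apply,
      smul_eq_mul, mul_comm]

open MvPolynomial Filter Topology Asymptotics in
lemma aux_mem_pow {n : ℕ} (k : ℕ) (P : MvPolynomial (Fin n) ℝ)
    (h : (fun y : Fin n → ℝ => eval y P) =O[𝓝 0] (fun y => ‖y‖ ^ k)) :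
    P ∈ idealOfVars (Fin n) ℝ ^ k := by
  rw [mem_pow_idealOfVars_iff']
  have key : ∀ j < k, homogeneousComponent j P = 0 := by
    intro j hj
    apply MvPolynomial.funext
    intro v
    rw [map_zero, ← aux_coeff_line]
    have hd : Polynomial.X ^ k ∣
        (aeval (fun i => Polynomial.C (v i) * Polynomial.X) P : Polynomial ℝ) := by
      apply aux_poly_dvd
      simp only [aux_eval_line]
      have ht : Tendsto (fun t : ℝ => t • v) (𝓝 0) (𝓝 0) := by
        have : Continuous (fun t : ℝ => t • v) := by fun_prop
        simpa using this.tendsto 0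
      refine (h.comp_tendsto ht).trans ?_
      refine IsBigO.of_bound (‖v‖ ^ k) (Eventually.of_forall fun t => ?_)
      simp [norm_smul, mul_pow, mul_comm]
    exact Polynomial.X_pow_dvd_iff.1 hd j hj
  intro x hx
  have := congrArg (coeff x) (key x.degree (by simpa using hx))
  simpa [coeff_homogeneousComponent] using this

open MvPolynomial Filter Topology Asymptotics in
lemma aux_partialSum {n : ℕ} (F : FormalMultilinearSeries ℝ (Fin n → ℝ) ℝ) (k : ℕ) :
    ∃ G : MvPolynomial (Fin n) ℝ, ∀ y, eval y G = F.partialSum k y := by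
  classical
  refine ⟨∑ m ∈ Finset.range k, ∑ r : Fin m → Fin n,
    (∏ i, X (r i)) * C (F m fun i => Pi.single (r i) 1), fun y => ?_⟩
  simp only [FormalMultilinearSeries.partialSum, map_sum, map_mul, map_prod, eval_X, eval_C]
  refine Finset.sum_congr rfl fun m _ => ?_
  have hy : (fun _ : Fin m => y) = fun _ => ∑ j, y j • (Pi.single j 1 : Fin n → ℝ) := by
    funext i
    ext l
    simp [Pi.single_apply]
  rw [hy, ContinuousMultilinearMap.map_sum]
  refine Finset.sum_congr rfl fun r _ => ?_
  rw [ContinuousMultilinearMap.map_smul_univ, smul_eq_mul]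

open MvPolynomial Filter Topology Asymptotics in
lemma aux_dense {n : ℕ} (q : MvPolynomial (Fin n) ℝ) (hq : q ≠ 0) :
    Dense {x | eval x q ≠ 0} := by
  intro x
  rw [mem_closure_iff_nhds]
  intro t ht
  by_contra hne
  obtain ⟨ε, hε, hb⟩ := Metric.mem_nhds_iff.1 ht
  apply hq
  refine funext_set (fun i => Metric.ball (x i) ε) (fun i => ?_) fun y hy => ?_
  · rw [Real.ball_eq_Ioo]
    exact Set.Ioo_infinite (by linarith)
  · rw [map_zero]
    by_contra hy0
    refine hne ⟨y, hb ?_, hy0⟩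
    rw [← ball_pi x hε] at *
    exact hy

open MvPolynomial Filter Topology Asymptotics in
lemma aux_main_s3 {n : ℕ} (p q : MvPolynomial (Fin n) ℝ) (hpq : IsRelPrime q p)
    (h0 : eval 0 q = 0) (g : (Fin n → ℝ) → ℝ) (hg : AnalyticAt ℝ g 0)
    (heq : ∀ᶠ y in 𝓝 0, eval y p = eval y q * g y) : False := by
  obtain ⟨F, hF⟩ := hg
  let I := idealOfVars (Fin n) ℝ
  have hmem : ∀ k, ∃ G, p - q * G ∈ I ^ k := by
    intro k
    obtain ⟨G, hG⟩ := aux_partialSum F k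
    refine ⟨G, aux_mem_pow k _ ?_⟩
    have h1 := hF.isBigO_sub_partialSum_pow k
    have h2 : (fun y => eval y q) =O[𝓝 0] (fun _ => (1:ℝ)) :=
      ((MvPolynomial.continuous_eval q).tendsto 0).isBigO_one ℝ
    have h3 := h2.mul h1
    simp only [one_mul] at h3
    refine h3.congr' ?_ EventuallyEq.rfl
    filter_upwards [heq] with y hy
    simp [hy, hG, mul_sub]
  have hK : Ideal.Quotient.mk (Ideal.span {q}) p ∈
      (⨅ i : ℕ, I ^ i • ⊤ : Submodule (MvPolynomial (Fin n) ℝ)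
        (MvPolynomial (Fin n) ℝ ⧸ Ideal.span {q})) := by
    rw [Submodule.mem_iInf]
    intro k
    obtain ⟨G, hG⟩ := hmem k
    have : Ideal.Quotient.mk (Ideal.span {q}) p
        = (p - q * G) • (1 : MvPolynomial (Fin n) ℝ ⧸ Ideal.span {q}) := by
      change _ = Ideal.Quotient.mk (Ideal.span {q}) ((p - q * G) * 1)
      rw [mul_one, Ideal.Quotient.eq]
      rw [Ideal.mem_span_singleton]
      exact ⟨G, by ring⟩
    rw [this]
    exact Submodule.smul_mem_smul hG trivial
  obtain ⟨⟨r, hr⟩, hrp⟩ := (Ideal.mem_iInf_smul_pow_eq_bot_iff I _).1 hK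
  have hd : q ∣ (r - 1) * p := by
    rw [← Ideal.mem_span_singleton, sub_mul, one_mul, ← Ideal.Quotient.eq]
    exact hrp
  obtain ⟨s, hs⟩ := hpq.dvd_of_dvd_mul_right hd
  have hr0 : eval 0 r = 0 := by
    have hle : I ≤ RingHom.ker (eval (0 : Fin n → ℝ)) := by
      refine Ideal.span_le.2 ?_
      rintro _ ⟨i, rfl⟩
      simp [RingHom.mem_ker]
    exact hle hr
  have := congrArg (eval 0) hs
  rw [map_sub, map_mul, hr0, h0, map_one] at this
  norm_num at this



/-- Let `p, q` be relatively prime real polynomials, `q ≠ 0`,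
`U = {x | q(x) ≠ 0}` and `f = p/q` on `U`. If `q(x₀) = 0` then `x₀` is a boundary point
of `U` and `f` cannot be extended analytically to `x₀`. -/
theorem no_analytic_extension_of_rational_function
    (n : ℕ) (p q : MvPolynomial (Fin n) ℝ)
    (hrelprime : ∀ d : MvPolynomial (Fin n) ℝ, d ∣ p → d ∣ q → IsUnit d)
    (hq : q ≠ 0)
    (U : Set (Fin n → ℝ)) (hU : U = {x | MvPolynomial.eval x q ≠ 0})
    (f : (Fin n → ℝ) → ℝ)
    (hf : ∀ x ∈ U, f x = MvPolynomial.eval x p / MvPolynomial.eval x q)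
    (x₀ : Fin n → ℝ) (hx₀ : MvPolynomial.eval x₀ q = 0) :
    x₀ ∈ frontier U ∧
      ¬ ∃ (V : Set (Fin n → ℝ)) (g : (Fin n → ℝ) → ℝ),
          IsOpen V ∧ x₀ ∈ V ∧ AnalyticOnNhd ℝ g V ∧ ∀ x ∈ U ∩ V, g x = f x := by
  subst hU
  have hdense := aux_dense q hq
  refine ⟨⟨hdense x₀, fun h => interior_subset h hx₀⟩, ?_⟩
  rintro ⟨V, g, hVo, hxV, hg, hgf⟩
  let T : (Fin n → ℝ) → MvPolynomial (Fin n) ℝ →ₐ[ℝ] MvPolynomial (Fin n) ℝ :=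
    fun a => MvPolynomial.aeval (fun i => MvPolynomial.X i + MvPolynomial.C (a i))
  have hT : ∀ a b P, a + b = 0 → T a (T b P) = P := by
    intro a b P hab
    have : (T a).comp (T b) = AlgHom.id ℝ _ := by
      apply MvPolynomial.algHom_ext
      intro i
      have h := congrFun hab i
      simp only [Pi.add_apply, Pi.zero_apply] at h
      simp [T, add_assoc, ← MvPolynomial.C_add, h, MvPolynomial.algebraMap_eq]
    exact DFunLike.congr_fun this P
  have hTe : ∀ a y P, MvPolynomial.eval y (T a P) = MvPolynomial.eval (y + a) P := by
    intro a y P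
    induction P using MvPolynomial.induction_on with
    | C a => simp [T]
    | add p q hp hq => simp [hp, hq]
    | mul_X p i hp =>
      rw [map_mul, map_mul, hp, map_mul]
      simp [T]
  have hpV : ∀ x ∈ V, MvPolynomial.eval x p = MvPolynomial.eval x q * g x := by
    have hcl : V ⊆ closure (V ∩ {x | MvPolynomial.eval x q ≠ 0}) :=
      hdense.open_subset_closure_inter hVo
    have hEq : Set.EqOn (fun x => MvPolynomial.eval x p)
        (fun x => MvPolynomial.eval x q * g x) (V ∩ {x | MvPolynomial.eval x q ≠ 0}) := by
      rintro x ⟨hx, hxq⟩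
      have hxq' : MvPolynomial.eval x q ≠ 0 := hxq
      simp only
      rw [hgf x ⟨hxq, hx⟩, hf x hxq]
      field_simp
    exact hEq.of_subset_closure (MvPolynomial.continuous_eval p).continuousOn
      ((MvPolynomial.continuous_eval q).continuousOn.mul hg.continuousOn)
      Set.inter_subset_left hcl
  refine aux_main_s3 (T x₀ p) (T x₀ q) ?_ (by rw [hTe, zero_add, hx₀]) (fun y => g (y + x₀)) ?_ ?_
  · intro d hdq hdp
    have hu : IsUnit (T (-x₀) d) := by
      apply hrelprime
      · simpa [hT (-x₀) x₀ p (by simp)] using map_dvd (T (-x₀)) hdp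
      · simpa [hT (-x₀) x₀ q (by simp)] using map_dvd (T (-x₀)) hdq
    simpa [hT x₀ (-x₀) d (by simp)] using hu.map (T x₀)
  · have h1 : AnalyticAt ℝ g ((fun y => y + x₀) 0) := by simpa using hg x₀ hxV
    exact h1.comp (f := fun y => y + x₀) (by fun_prop)
  · have ht : Filter.Tendsto (fun y => y + x₀) (nhds 0) (nhds x₀) := by
      have : Continuous (fun y => y + x₀) := by fun_prop
      simpa using this.tendsto 0
    filter_upwards [ht (hVo.mem_nhds hxV)] with y hy
    rw [hTe, hTe]
    exact hpV _ hy
end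

section
/- Let K be a field, k ⊆ K a subfield, and f_1, …, f_n ∈ k(x_1, …, x_n), regarded also as elements of K(x_1, …, x_n) via the natural embedding of fraction fields induced by k[x_1, …, x_n] ⊆ K[x_1, …, x_n]. Then the subfield of k(x_1, …, x_n) generated over k by f_1, …, f_n equals all of k(x_1, …, x_n) if and only if the subfield of K(x_1, …, x_n) generated over K by f_1, …, f_n equals all of K(x_1, …, x_n). -/
theorem aux_li (n : ℕ) (k K : Type*) [Field k] [Field K] [Algebra k K]
    (emb : FractionRing (MvPolynomial (Fin n) k) →+* FractionRing (MvPolynomial (Fin n) K))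
    (hemb : ∀ r : MvPolynomial (Fin n) k,
      emb (algebraMap (MvPolynomial (Fin n) k) (FractionRing (MvPolynomial (Fin n) k)) r) =
        algebraMap (MvPolynomial (Fin n) K) (FractionRing (MvPolynomial (Fin n) K))
          (MvPolynomial.map (algebraMap k K) r))
    {ι : Type*} (b : ι → K) (hb : LinearIndependent k b) (s : Finset ι)
    (c : ι → FractionRing (MvPolynomial (Fin n) k))
    (h : ∑ j ∈ s, b j • emb (c j) = 0) : ∀ j ∈ s, c j = 0 := by
  obtain ⟨d, hd⟩ := IsLocalization.exist_integer_multiples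
    (nonZeroDivisors (MvPolynomial (Fin n) k)) s c
  have hd' : ∀ j, ∃ g : MvPolynomial (Fin n) k, j ∈ s →
      algebraMap _ (FractionRing (MvPolynomial (Fin n) k)) g = algebraMap _ _ d.1 * c j := by
    intro j
    by_cases hj : j ∈ s
    · obtain ⟨g, hg⟩ := hd j hj
      exact ⟨g, fun _ => by rw [hg, Algebra.smul_def]⟩
    · exact ⟨0, fun h => absurd h hj⟩
  choose g hg using hd'
  have h1 : ∑ j ∈ s, MvPolynomial.C (b j) * MvPolynomial.map (algebraMap k K) (g j) = 0 := by
    apply IsFractionRing.injective (MvPolynomial (Fin n) K) (FractionRing (MvPolynomial (Fin n) K))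
    rw [map_zero, map_sum]
    have : ∑ j ∈ s, emb (algebraMap _ _ d.1) * (b j • emb (c j)) = 0 := by
      rw [← Finset.mul_sum, h, mul_zero]
    rw [← this]
    refine Finset.sum_congr rfl fun j hj => ?_
    rw [map_mul, ← hemb, hg j hj, map_mul, Algebra.smul_def,
      IsScalarTower.algebraMap_apply K (MvPolynomial (Fin n) K), MvPolynomial.algebraMap_eq]
    ring
  intro j hj
  have hgj : g j = 0 := by
    ext m
    rw [MvPolynomial.coeff_zero]
    have h2 := congrArg (MvPolynomial.coeff m) h1
    rw [MvPolynomial.coeff_sum] at h2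
    refine linearIndependent_iff'.1 hb s (fun j => MvPolynomial.coeff m (g j)) ?_ j hj
    simp only [MvPolynomial.coeff_C_mul, MvPolynomial.coeff_map, MvPolynomial.coeff_zero] at h2
    rw [← h2]
    exact Finset.sum_congr rfl fun j _ => by rw [Algebra.smul_def, mul_comm]
  have h3 := hg j hj
  rw [hgj, map_zero] at h3
  refine (mul_eq_zero.1 h3.symm).resolve_left ?_
  exact IsFractionRing.to_map_ne_zero_of_mem_nonZeroDivisors d.2


/-- For a subfield `k ⊆ K` and `f₁, …, fₙ ∈ k(x₁, …, xₙ)`, the `fᵢ` generate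
`k(x₁, …, xₙ)` over `k` if and only if their images under the natural embedding generate
`K(x₁, …, xₙ)` over `K`.  Here `emb` is the natural embedding of fraction fields induced by
`k[x₁, …, xₙ] ⊆ K[x₁, …, xₙ]`, characterized by its values on polynomials. -/
theorem adjoin_eq_top_iff_adjoin_map_eq_top
    (n : ℕ) (k K : Type*) [Field k] [Field K] [Algebra k K]
    (f : Fin n → FractionRing (MvPolynomial (Fin n) k))
    (emb : FractionRing (MvPolynomial (Fin n) k) →+* FractionRing (MvPolynomial (Fin n) K))
    (hemb : ∀ r : MvPolynomial (Fin n) k,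
      emb (algebraMap (MvPolynomial (Fin n) k) (FractionRing (MvPolynomial (Fin n) k)) r) =
        algebraMap (MvPolynomial (Fin n) K) (FractionRing (MvPolynomial (Fin n) K))
          (MvPolynomial.map (algebraMap k K) r)) :
    IntermediateField.adjoin k (Set.range f) = ⊤ ↔
      IntermediateField.adjoin K (Set.range (emb ∘ f)) = ⊤ := by
  have hk : ∀ a : k, emb (algebraMap k _ a) = algebraMap k _ a := by
    intro a
    rw [IsScalarTower.algebraMap_apply k (MvPolynomial (Fin n) k), hemb,
      MvPolynomial.algebraMap_eq, MvPolynomial.map_C,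
      IsScalarTower.algebraMap_apply k K (FractionRing (MvPolynomial (Fin n) K)),
      IsScalarTower.algebraMap_apply K (MvPolynomial (Fin n) K)
        (FractionRing (MvPolynomial (Fin n) K)), MvPolynomial.algebraMap_eq]
  let E : FractionRing (MvPolynomial (Fin n) k) →ₐ[k] FractionRing (MvPolynomial (Fin n) K) :=
    { emb with commutes' := hk }
  have hE : ∀ a, E a = emb a := fun _ => rfl
  constructor
  · intro h
    have h1 : ∀ a, emb a ∈ IntermediateField.adjoin K (Set.range (emb ∘ f)) := by
      intro a
      have ha : a ∈ IntermediateField.adjoin k (Set.range f) := h ▸ IntermediateField.mem_top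
      induction ha using IntermediateField.adjoin_induction with
      | mem x hx =>
        obtain ⟨i, rfl⟩ := hx
        exact IntermediateField.subset_adjoin _ _ ⟨i, rfl⟩
      | algebraMap x =>
        rw [hk, IsScalarTower.algebraMap_apply k K]
        exact IntermediateField.algebraMap_mem _ _
      | add x y _ _ hx hy => rw [map_add]; exact add_mem hx hy
      | inv x _ hx => rw [map_inv₀]; exact inv_mem hx
      | mul x y _ _ hx hy => rw [map_mul]; exact mul_mem hx hy
    have h2 : ∀ p : MvPolynomial (Fin n) K, algebraMap _ (FractionRing (MvPolynomial (Fin n) K)) p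
        ∈ IntermediateField.adjoin K (Set.range (emb ∘ f)) := by
      intro p
      induction p using MvPolynomial.induction_on with
      | C a =>
        rw [← MvPolynomial.algebraMap_eq, ← IsScalarTower.algebraMap_apply K]
        exact IntermediateField.algebraMap_mem _ _
      | add p q hp hq => rw [map_add]; exact add_mem hp hq
      | mul_X p i hp =>
        rw [map_mul]
        refine mul_mem hp ?_
        have := h1 (algebraMap (MvPolynomial (Fin n) k) _ (MvPolynomial.X i))
        rwa [hemb, MvPolynomial.map_X] at this
    rw [eq_top_iff]
    intro x _
    obtain ⟨p, q, _, rfl⟩ := IsFractionRing.div_surjective (A := MvPolynomial (Fin n) K) x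
    exact div_mem (h2 p) (h2 q)
  · intro h
    set F := IntermediateField.adjoin k (Set.range f) with hF
    classical
    let b := Module.Basis.ofVectorSpace k K
    let Ψ : TensorProduct k K F →ₐ[K] FractionRing (MvPolynomial (Fin n) K) :=
      Algebra.TensorProduct.lift (Algebra.ofId K _) (E.comp F.val) (fun _ _ => Commute.all _ _)
    have hΨ : Algebra.adjoin K (Set.range (emb ∘ f)) ≤ Ψ.range := by
      rw [Algebra.adjoin_le_iff]
      rintro _ ⟨i, rfl⟩
      refine ⟨1 ⊗ₜ ⟨f i, IntermediateField.subset_adjoin _ _ ⟨i, rfl⟩⟩, ?_⟩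
      simp [Ψ, hE]
    have key : ∀ t ∈ Algebra.adjoin K (Set.range (emb ∘ f)), ∃ c : _ →₀ F,
        t = c.sum fun j a => b j • emb a := by
      intro t ht
      obtain ⟨z, rfl⟩ := hΨ ht
      obtain ⟨c, rfl⟩ := (TensorProduct.equivFinsuppOfBasisLeft (N := F) b).symm.surjective z
      refine ⟨c, ?_⟩
      rw [TensorProduct.equivFinsuppOfBasisLeft_symm_apply, Finsupp.sum, map_sum, Finsupp.sum]
      refine Finset.sum_congr rfl fun j _ => ?_
      simp [Ψ, hE, Algebra.smul_def, Algebra.ofId_apply]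
    rw [eq_top_iff]
    intro x _
    have hx : emb x ∈ IntermediateField.adjoin K (Set.range (emb ∘ f)) :=
      h ▸ IntermediateField.mem_top
    rw [IntermediateField.mem_adjoin_iff_div] at hx
    obtain ⟨p, hp, q, hq, hpq⟩ := hx
    by_cases hq0 : q = 0
    · rw [hq0, div_zero] at hpq
      rw [(map_eq_zero emb).1 hpq]
      exact zero_mem _
    obtain ⟨z, rfl⟩ := key p hp
    obtain ⟨w, rfl⟩ := key q hq
    have hw : ∃ j, w j ≠ 0 := by
      by_contra! hw
      have : w = 0 := Finsupp.ext hw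
      exact hq0 (by rw [this, Finsupp.sum_zero_index])
    obtain ⟨j, hj⟩ := hw
    rw [eq_div_iff hq0] at hpq

    rw [Finsupp.sum_of_support_subset w (Finset.subset_union_left (s₂ := z.support)) _ (by simp),
      Finsupp.sum_of_support_subset z (Finset.subset_union_right (s₁ := w.support)) _ (by simp),
      Finset.mul_sum, ← sub_eq_zero, ← Finset.sum_sub_distrib] at hpq
    have := aux_li n k K emb hemb b b.linearIndependent (w.support ∪ z.support)
      (fun j => x * w j - z j) (by
        rw [← hpq]
        refine Finset.sum_congr rfl fun j _ => ?_
        rw [map_sub, map_mul, smul_sub, mul_smul_comm]) j (by simp [hj])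
    have hwj : (w j : FractionRing (MvPolynomial (Fin n) k)) ≠ 0 := by simpa using hj
    rw [sub_eq_zero, ← eq_div_iff hwj] at this
    rw [this]
    exact div_mem (z j).2 (w j).2
end

section
/- Let F : ℝ^n → ℝ^n be an everywhere defined real rational map. If F is birational (ℝ(F) = ℝ(x_1, …, x_n)) and F is an open map, then F is injective on all of ℝ^n. -/
/-- `F : ℝⁿ → ℝⁿ` is an everywhere defined real rational map with components corresponding
to the rational functions `f i ∈ ℝ(x₁, …, xₙ)`: each component is `pᵢ/qᵢ` with `qᵢ`
vanishing nowhere on `ℝⁿ`. -/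
def IsEverywhereDefRatMap (n : ℕ) (F : (Fin n → ℝ) → (Fin n → ℝ))
    (f : Fin n → FractionRing (MvPolynomial (Fin n) ℝ)) : Prop :=
  ∀ i : Fin n, ∃ p q : MvPolynomial (Fin n) ℝ,
    (∀ x : Fin n → ℝ, MvPolynomial.eval x q ≠ 0) ∧
    f i = algebraMap (MvPolynomial (Fin n) ℝ) (FractionRing (MvPolynomial (Fin n) ℝ)) p /
      algebraMap (MvPolynomial (Fin n) ℝ) (FractionRing (MvPolynomial (Fin n) ℝ)) q ∧
    ∀ x : Fin n → ℝ, F x i = MvPolynomial.eval x p / MvPolynomial.eval x q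

theorem aux_eval (n : ℕ) (F : (Fin n → ℝ) → (Fin n → ℝ))
    (f : Fin n → FractionRing (MvPolynomial (Fin n) ℝ))
    (hF : IsEverywhereDefRatMap n F f) (P : MvPolynomial (Fin n) ℝ) :
    ∃ p q : MvPolynomial (Fin n) ℝ,
    (∀ x : Fin n → ℝ, MvPolynomial.eval x q ≠ 0) ∧
    MvPolynomial.aeval f P =
      algebraMap (MvPolynomial (Fin n) ℝ) (FractionRing (MvPolynomial (Fin n) ℝ)) p /
      algebraMap (MvPolynomial (Fin n) ℝ) (FractionRing (MvPolynomial (Fin n) ℝ)) q ∧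
    ∀ x : Fin n → ℝ, MvPolynomial.eval (F x) P
      = MvPolynomial.eval x p / MvPolynomial.eval x q := by
  have key : ∀ q : MvPolynomial (Fin n) ℝ, (∀ x : Fin n → ℝ, MvPolynomial.eval x q ≠ 0) →
      algebraMap (MvPolynomial (Fin n) ℝ) (FractionRing (MvPolynomial (Fin n) ℝ)) q ≠ 0 := by
    intro q hq h
    rw [IsFractionRing.to_map_eq_zero_iff] at h
    exact hq 0 (by simp [h])
  induction P using MvPolynomial.induction_on with
  | C a =>
    refine ⟨MvPolynomial.C a, 1, by simp, ?_, by simp⟩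
    rw [MvPolynomial.aeval_C, map_one, div_one, ← MvPolynomial.algebraMap_eq,
      ← IsScalarTower.algebraMap_apply]
  | add P Q hP hQ =>
    obtain ⟨p, q, h1, h2, h3⟩ := hP
    obtain ⟨p', q', h1', h2', h3'⟩ := hQ
    refine ⟨p * q' + q * p', q * q', fun x => ?_, ?_, fun x => ?_⟩
    · simpa using ⟨h1 x, h1' x⟩
    · rw [map_add, h2, h2', div_add_div _ _ (key _ h1) (key _ h1')]; simp
    · rw [map_add, h3, h3', div_add_div _ _ (h1 x) (h1' x)]; simp
  | mul_X P i hP =>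
    obtain ⟨p, q, h1, h2, h3⟩ := hP
    obtain ⟨p', q', h1', h2', h3'⟩ := hF i
    refine ⟨p * p', q * q', fun x => ?_, ?_, fun x => ?_⟩
    · simpa using ⟨h1 x, h1' x⟩
    · rw [map_mul, h2, MvPolynomial.aeval_X, h2', div_mul_div_comm]; simp
    · rw [map_mul, h3, MvPolynomial.eval_X, h3', div_mul_div_comm]; simp

theorem aux_open (n : ℕ) (W : Set (Fin n → ℝ)) (hW : IsOpen W) (c : Fin n → ℝ) (hc : c ∈ W)
    (B : MvPolynomial (Fin n) ℝ) (hB : B ≠ 0) : ∃ y ∈ W, MvPolynomial.eval y B ≠ 0 := by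
  by_contra! h
  obtain ⟨u, hu, hs⟩ := isOpen_pi_iff'.1 hW c hc
  apply hB
  refine MvPolynomial.funext_set u (fun i => ?_) (fun x hx => ?_)
  · exact infinite_of_mem_nhds (c i) ((hu i).1.mem_nhds (hu i).2)
  · rw [h x (hs hx), map_zero]

/-- An everywhere defined real rational map `F : ℝⁿ → ℝⁿ` which is birational
(`ℝ(F) = ℝ(x₁, …, xₙ)`) and an open map is injective on all of `ℝⁿ`. -/
theorem injective_of_birational_of_isOpenMap
    (n : ℕ) (F : (Fin n → ℝ) → (Fin n → ℝ))
    (f : Fin n → FractionRing (MvPolynomial (Fin n) ℝ))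
    (hF : IsEverywhereDefRatMap n F f)
    (hbir : IntermediateField.adjoin ℝ (Set.range f) = ⊤)
    (hopen : IsOpenMap F) :
    Function.Injective F := by
  classical
  have h : ∀ j : Fin n, ∃ A B : MvPolynomial (Fin n) ℝ, B ≠ 0 ∧
      ∀ x : Fin n → ℝ, x j * MvPolynomial.eval (F x) B = MvPolynomial.eval (F x) A := by
    intro j
    have hm : algebraMap (MvPolynomial (Fin n) ℝ) (FractionRing (MvPolynomial (Fin n) ℝ))
        (MvPolynomial.X j) ∈ IntermediateField.adjoin ℝ (Set.range f) := by
      rw [hbir]; trivial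
    obtain ⟨A, B, hAB⟩ := (IntermediateField.mem_adjoin_range_iff _ _ _).1 hm
    have hX : algebraMap (MvPolynomial (Fin n) ℝ) (FractionRing (MvPolynomial (Fin n) ℝ))
        (MvPolynomial.X j) ≠ 0 := by
      rw [Ne, IsFractionRing.to_map_eq_zero_iff]
      exact MvPolynomial.X_ne_zero j
    have hB : MvPolynomial.aeval f B ≠ 0 := by
      intro h0
      rw [h0, div_zero] at hAB
      exact hX hAB
    refine ⟨A, B, fun h0 => hB (by rw [h0, map_zero]), fun x => ?_⟩
    rw [eq_div_iff hB] at hAB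
    obtain ⟨p, q, h1, h2, h3⟩ := aux_eval n F f hF A
    obtain ⟨p', q', h1', h2', h3'⟩ := aux_eval n F f hF B
    have key : ∀ q : MvPolynomial (Fin n) ℝ, (∀ x : Fin n → ℝ, MvPolynomial.eval x q ≠ 0) →
        algebraMap (MvPolynomial (Fin n) ℝ) (FractionRing (MvPolynomial (Fin n) ℝ)) q ≠ 0 := by
      intro q hq h
      rw [IsFractionRing.to_map_eq_zero_iff] at h
      exact hq 0 (by simp [h])
    rw [h2, h2', ← mul_div_assoc, div_eq_div_iff (key _ h1') (key _ h1), ← map_mul, ← map_mul,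
      ← map_mul] at hAB
    have hpoly := IsFractionRing.injective (MvPolynomial (Fin n) ℝ)
      (FractionRing (MvPolynomial (Fin n) ℝ)) hAB
    have he := congrArg (MvPolynomial.eval x) hpoly
    simp only [map_mul, MvPolynomial.eval_X] at he
    rw [h3, h3', ← mul_div_assoc, div_eq_div_iff (h1' x) (h1 x)]
    exact he
  choose A B hB hAB using h
  intro a b hab
  by_contra hne
  obtain ⟨U, V, hU, hV, haU, hbV, hd⟩ := t2_separation hne
  obtain ⟨y, ⟨⟨u, hu, huy⟩, ⟨v, hv, hvy⟩⟩, hy⟩ := aux_open n (F '' U ∩ F '' V)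
    ((hopen U hU).inter (hopen V hV)) (F a) ⟨⟨a, haU, rfl⟩, ⟨b, hbV, hab.symm⟩⟩
    (∏ j, B j) (Finset.prod_ne_zero_iff.2 fun j _ => hB j)
  rw [map_prod, Finset.prod_ne_zero_iff] at hy
  have huv : u = v := by
    funext j
    have e1 := hAB j u
    have e2 := hAB j v
    rw [huy] at e1
    rw [hvy] at e2
    exact mul_right_cancel₀ (hy j (Finset.mem_univ j)) (e1.trans e2.symm)
  exact Set.disjoint_left.1 hd hu (huv ▸ hv)
end

section
/- Let F : ℝ^n → ℝ^n be an everywhere defined real rational map whose Jacobian determinant vanishes nowhere on ℝ^n. If F is birational (ℝ(F) = ℝ(x_1, …, x_n)), then F is a bijection of ℝ^n onto ℝ^n and its inverse is again an everywhere defined real rational map. Moreover, if every component of F lies in k(x_1, …, x_n) for a subfield k ⊆ ℝ, then F restricts to a bijection of k^n onto k^n, and the components of the inverse map also lie in k(x_1, …, x_n), so the inverse likewise restricts to a bijection of k^n onto k^n. -/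
/-- A rational function `r ∈ ℝ(x₁, …, xₙ)` lies in `k(x₁, …, xₙ)` for the subfield `k ⊆ ℝ`:
it can be written as a fraction of polynomials all of whose coefficients lie in `k`. -/
def MemSubfieldFuncField (n : ℕ) (k : Subfield ℝ)
    (r : FractionRing (MvPolynomial (Fin n) ℝ)) : Prop :=
  ∃ p q : MvPolynomial (Fin n) ℝ,
    (∀ m, MvPolynomial.coeff m p ∈ k) ∧ (∀ m, MvPolynomial.coeff m q ∈ k) ∧ q ≠ 0 ∧
    r = algebraMap (MvPolynomial (Fin n) ℝ) (FractionRing (MvPolynomial (Fin n) ℝ)) p /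
      algebraMap (MvPolynomial (Fin n) ℝ) (FractionRing (MvPolynomial (Fin n) ℝ)) q




namespace RRJC
open MvPolynomial Topology Filter

/-- polynomial vanishing on a nonempty open set is zero -/
theorem vanish_open {n : ℕ} (p : MvPolynomial (Fin n) ℝ) (U : Set (Fin n → ℝ)) (hU : IsOpen U)
    (hne : U.Nonempty) (h : ∀ x ∈ U, eval x p = 0) : p = 0 := by
  obtain ⟨x, hx⟩ := hne
  obtain ⟨ε, hε, hb⟩ := Metric.isOpen_iff.1 hU x hx
  apply MvPolynomial.funext_set (fun i => Metric.ball (x i) ε)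
  · intro i
    rw [Real.ball_eq_Ioo]
    exact Set.Ioo_infinite (by linarith)
  · intro y hy
    rw [map_zero]
    apply h y (hb _)
    rw [ball_pi _ hε]
    exact hy

theorem local_inv {E F : Type*} [NormedAddCommGroup E] [NormedSpace ℝ E] [CompleteSpace E]
    [NormedAddCommGroup F] [NormedSpace ℝ F] [CompleteSpace F]
    (f : E → F) (x0 : E) (hf : AnalyticAt ℝ f x0) (e : E ≃L[ℝ] F)
    (he : HasFDerivAt f (e : E →L[ℝ] F) x0) :
    ∃ g : F → E, AnalyticAt ℝ g (f x0) ∧ g (f x0) = x0 ∧ (∀ᶠ y in 𝓝 (f x0), f (g y) = y) ∧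
      ∀ᶠ x in 𝓝 x0, g (f x) = x := by
  have hs : HasStrictFDerivAt f (e : E →L[ℝ] F) x0 := by
    have := hf.hasStrictFDerivAt
    rwa [he.fderiv] at this
  refine ⟨(hs.toOpenPartialHomeomorph f).symm, ?_, ?_, ?_, ?_⟩
  · exact (hs.toOpenPartialHomeomorph f).analyticAt_symm' (i := e)
      hs.mem_toOpenPartialHomeomorph_source hf he.fderiv
  · exact (hs.toOpenPartialHomeomorph f).left_inv hs.mem_toOpenPartialHomeomorph_source
  · exact (hs.toOpenPartialHomeomorph f).eventually_right_inverse'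
      hs.mem_toOpenPartialHomeomorph_source
  · exact (hs.toOpenPartialHomeomorph f).eventually_left_inverse
      hs.mem_toOpenPartialHomeomorph_source

theorem analyticAt_eval {n : ℕ} (p : MvPolynomial (Fin n) ℝ) (x : Fin n → ℝ) :
    AnalyticAt ℝ (fun x => eval x p) x :=
  AnalyticOnNhd.eval_mvPolynomial p x (Set.mem_univ _)

theorem continuous_eval' {n : ℕ} (p : MvPolynomial (Fin n) ℝ) :
    Continuous (fun x : Fin n → ℝ => eval x p) := MvPolynomial.continuous_eval p

theorem hasFDerivAt_eval {n : ℕ} (p : MvPolynomial (Fin n) ℝ) (x : Fin n → ℝ) :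
    HasFDerivAt (fun x => eval x p)
      (∑ i, eval x (pderiv i p) • ContinuousLinearMap.proj (R := ℝ) (φ := fun _ : Fin n => ℝ) i)
      x := by
  induction p using MvPolynomial.induction_on with
  | C a => simpa using hasFDerivAt_const a x
  | add p q hp hq =>
    simp only [map_add, add_smul, Finset.sum_add_distrib]
    exact hp.add hq
  | mul_X p j hp =>
    simp only [map_mul, eval_X]
    convert! hp.mul (hasFDerivAt_apply j x) using 1
    ext v
    simp [Derivation.leibniz, pderiv_X, Pi.single_apply, add_mul, Finset.sum_add_distrib,
      Finset.mul_sum, mul_assoc, apply_ite]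

end RRJC


namespace RRJC
open Polynomial in
theorem even_of_no_roots (q : ℝ[X]) (h0 : q ≠ 0) (h : ∀ x, ¬ q.IsRoot x) : Even q.natDegree := by
  induction q using WfDvdMonoid.induction_on_irreducible with
  | zero => exact absurd rfl h0
  | unit u hu => simp [natDegree_eq_zero_of_isUnit hu]
  | mul a i ha hi ih =>
    have hi0 := hi.ne_zero
    rw [natDegree_mul hi0 ha]
    have h1 : Even a.natDegree := ih ha (fun x hx => h x (by simp_all [IsRoot]))
    have h2 : i.natDegree = 2 := by
      have := hi.natDegree_le_two
      have := hi.natDegree_pos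
      have : i.natDegree ≠ 1 := by
        intro h1
        obtain ⟨x, hx⟩ := exists_root_of_degree_eq_one (p := i)
          (by rw [degree_eq_natDegree hi0, h1]; rfl)
        exact h x (by simp_all [IsRoot])
      omega
    rw [h2]
    exact even_two.add h1

open Polynomial in
theorem card_roots_parity (p : ℝ[X]) (hp : p.Separable) :
    {t : ℝ | p.IsRoot t}.ncard % 2 = p.natDegree % 2 := by
  obtain ⟨q, hq, hc, hr⟩ := p.exists_prod_multiset_X_sub_C_mul
  have hp0 : p ≠ 0 := hp.ne_zero
  have hq0 : q ≠ 0 := by rintro rfl; simp at hq; exact hp0 hq.symm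
  have he : Even q.natDegree := even_of_no_roots q hq0 (fun x hx => by
    have := (mem_roots hq0).2 hx
    simp [hr] at this)
  have hs : {t : ℝ | p.IsRoot t} = (p.roots.toFinset : Set ℝ) := by
    ext t; simp [hp0]
  rw [hs, Set.ncard_coe_finset, Multiset.toFinset_card_of_nodup (nodup_roots hp)]
  obtain ⟨k, hk⟩ := he
  omega

open MvPolynomial

theorem homog {σ A0 S : Type} [CommRing A0] [CommRing S] [Algebra A0 S] (f : S) (R : σ → S)
    (G : MvPolynomial σ A0) : ∃ (N : ℕ) (H : S), ∀ (C : Type) [CommRing C] (χ : S →+* C)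
      (v : σ → C), (∀ i, χ f * v i = χ (R i)) →
      χ f ^ N * eval₂ (χ.comp (algebraMap A0 S)) v G = χ H := by
  induction G using MvPolynomial.induction_on with
  | C a => exact ⟨0, algebraMap A0 S a, fun C _ χ v h => by simp⟩
  | add p q hp hq =>
    obtain ⟨N, H, h1⟩ := hp
    obtain ⟨N', H', h2⟩ := hq
    refine ⟨N + N', f ^ N' * H + f ^ N * H', fun C _ χ v h => ?_⟩
    simp only [eval₂_add, map_add, map_mul, map_pow, ← h1 C χ v h, ← h2 C χ v h]
    ring
  | mul_X p i hp =>
    obtain ⟨N, H, h1⟩ := hp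
    refine ⟨N + 1, H * R i, fun C _ χ v h => ?_⟩
    simp only [eval₂_mul, eval₂_X, map_mul, ← h1 C χ v h, ← h i]
    ring

theorem deriv_chain {d : ℕ} {A L M : Type*} [CommRing A] [CommRing L] [Algebra A L]
    [AddCommGroup M] [Module A M] [Module L M] [IsScalarTower A L M]
    (D : Derivation A L M) (w : Fin d → L) (p : MvPolynomial (Fin d) A) :
    D (aeval w p) = ∑ j, aeval w (pderiv j p) • D (w j) := by
  induction p using MvPolynomial.induction_on with
  | C a => simp
  | add p q hp hq => simp [hp, hq, add_smul, Finset.sum_add_distrib]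
  | mul_X p i hp =>
    simp only [map_mul, aeval_X, Derivation.leibniz, hp, map_add, smul_eq_mul, add_smul,
      Finset.sum_add_distrib, pderiv_X]
    congr 1
    · rw [Finset.sum_eq_single i] <;> simp +contextual
    · simp [Finset.smul_sum, smul_smul]

theorem fin_sep {d : ℕ} {A B K L : Type} [CommRing A] [CommRing B] [Algebra A B]
    [Field K] [Field L] [Algebra A K] [IsFractionRing A K] [Algebra B L] [IsFractionRing B L]
    [Algebra A L] [IsScalarTower A B L] [Algebra K L] [IsScalarTower A K L]
    (w : Fin d → B) (hw : Algebra.adjoin A (Set.range w) = ⊤)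
    (E : Fin d → MvPolynomial (Fin d) A) (hE : ∀ i, aeval w (E i) = 0)
    (hdet : (Matrix.of fun i j => aeval w (pderiv j (E i))).det ≠ 0) :
    Module.Finite K L ∧ Algebra.IsSeparable K L := by
  have hft : Algebra.FiniteType A B := ⟨⟨(Set.finite_range w).toFinset, by simpa using hw⟩⟩
  have : Algebra.EssFiniteType B L := .of_isLocalization L (nonZeroDivisors B)
  have : Algebra.EssFiniteType A L := .comp A B L
  have : Algebra.EssFiniteType K L := .of_comp A K L
  have hinj : Function.Injective (algebraMap B L) := IsFractionRing.injective B L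
  have : Algebra.FormallyUnramified K L := by
    constructor
    let D := KaehlerDifferential.D K L
    have hDw : ∀ j, D (algebraMap B L (w j)) = 0 := by
      let D' : Derivation A L (Ω[L⁄K]) := D.restrictScalars A
      let v : Fin d → Ω[L⁄K] := fun j => D (algebraMap B L (w j))
      let W : Matrix (Fin d) (Fin d) L := (Matrix.of fun i j => aeval w (pderiv j (E i))).map
        (algebraMap B L)
      have hW : W.det ≠ 0 := by
        intro h
        apply hdet
        apply hinj
        rw [RingHom.map_det, map_zero]
        exact h
      have h1 : ∀ i, ∑ j, W i j • v j = 0 := by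
        intro i
        have := deriv_chain D' (fun j => algebraMap B L (w j)) (E i)
        have h2 : ∀ p : MvPolynomial (Fin d) A,
            aeval (fun j => algebraMap B L (w j)) p = algebraMap B L (aeval w p) := by
          intro p
          have := MvPolynomial.aeval_algebraMap_apply (A := B) L w p
          exact this
        simp only [h2] at this
        rw [hE i, map_zero, map_zero] at this
        exact this.symm
      intro k
      have h3 : W.det • v k = 0 := by
        have : ∑ i, W.adjugate k i • ∑ j, W i j • v j = W.det • v k := by
          simp only [Finset.smul_sum, smul_smul]
          rw [Finset.sum_comm]
          simp only [← Finset.sum_smul]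
          have : ∀ j, ∑ i, W.adjugate k i * W i j = if k = j then W.det else 0 := by
            intro j
            rw [← Matrix.mul_apply, Matrix.adjugate_mul]
            simp [Matrix.one_apply]
          simp [this]
        rw [← this]
        simp [h1]
      exact (smul_eq_zero.1 h3).resolve_left hW
    have hDB : ∀ b : B, D (algebraMap B L b) = 0 := by
      intro b
      have hb : b ∈ Algebra.adjoin A (Set.range w) := hw ▸ trivial
      induction hb using Algebra.adjoin_induction with
      | mem x hx => obtain ⟨j, rfl⟩ := hx; exact hDw j
      | algebraMap r =>
        rw [← IsScalarTower.algebraMap_apply, IsScalarTower.algebraMap_apply A K L]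
        exact D.map_algebraMap _
      | add x y _ _ hx hy => rw [map_add, map_add, hx, hy, add_zero]
      | mul x y _ _ hx hy => rw [map_mul, Derivation.leibniz, hx, hy]; simp
    have hD : ∀ l : L, D l = 0 := by
      intro l
      obtain ⟨x, y, hy, rfl⟩ := IsFractionRing.div_surjective B (K := L) l
      rw [Derivation.leibniz_div, hDB, hDB]; simp
    rw [← Submodule.subsingleton_iff L]
    apply subsingleton_of_bot_eq_top
    rw [← KaehlerDifferential.span_range_derivation K L, eq_comm, Submodule.span_eq_bot]
    rintro _ ⟨l, rfl⟩
    exact hD l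
  exact ⟨Algebra.FormallyUnramified.finite_of_free (R := K) (S := L),
    Algebra.FormallyUnramified.isSeparable K L⟩
end RRJC


namespace RRJC
open MvPolynomial

theorem clear_denom {A B K L : Type} [CommRing A] [IsDomain A] [CommRing B] [Algebra A B]
    [Field K] [Field L] [Algebra A K] [IsFractionRing A K] [Algebra B L] [IsFractionRing B L]
    [Algebra A L] [IsScalarTower A B L] [Algebra K L] [IsScalarTower A K L]
    [Algebra.IsAlgebraic K L] (l : L) :
    ∃ c : A, c ≠ 0 ∧ ∃ b : B, algebraMap B L b = algebraMap A L c * l := by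
  have hf : ∀ a b : A, algebraMap A L a * algebraMap A L b = algebraMap A L (a * b) := by simp
  have htop : (Algebra.adjoin K (Set.range (algebraMap B L))) = ⊤ := by
    have h1 : (IntermediateField.adjoin K (Set.range (algebraMap B L))) = ⊤ := by
      rw [eq_top_iff]
      intro x _
      obtain ⟨x, y, hy, rfl⟩ := IsFractionRing.div_surjective B (K := L) x
      exact div_mem (IntermediateField.subset_adjoin _ _ ⟨x, rfl⟩)
        (IntermediateField.subset_adjoin _ _ ⟨y, rfl⟩)
    have h2 := IntermediateField.adjoin_toSubalgebra_of_isAlgebraic (F := K)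
      (S := Set.range (algebraMap B L)) (fun x _ => Algebra.IsAlgebraic.isAlgebraic x)
    rw [← h2, h1]; rfl
  have hl : l ∈ Algebra.adjoin K (Set.range (algebraMap B L)) := htop ▸ trivial
  induction hl using Algebra.adjoin_induction with
  | mem x hx => obtain ⟨b, rfl⟩ := hx; exact ⟨1, one_ne_zero, b, by simp⟩
  | algebraMap r =>
    obtain ⟨x, y, hy, rfl⟩ := IsFractionRing.div_surjective A (K := K) r
    have hy0 : y ≠ 0 := nonZeroDivisors.ne_zero hy
    refine ⟨y, hy0, algebraMap A B x, ?_⟩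
    have : algebraMap A K y ≠ 0 := by simpa using hy0
    rw [← IsScalarTower.algebraMap_apply, IsScalarTower.algebraMap_apply A K L,
      IsScalarTower.algebraMap_apply A K L, ← map_mul]
    congr 1
    field_simp
  | add x y _ _ hx hy =>
    obtain ⟨c, hc, b, hb⟩ := hx
    obtain ⟨c', hc', b', hb'⟩ := hy
    refine ⟨c * c', mul_ne_zero hc hc', algebraMap A B c' * b + algebraMap A B c * b', ?_⟩
    simp only [map_add, map_mul, hb, hb', ← IsScalarTower.algebraMap_apply]
    ring
  | mul x y _ _ hx hy =>
    obtain ⟨c, hc, b, hb⟩ := hx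
    obtain ⟨c', hc', b', hb'⟩ := hy
    refine ⟨c * c', mul_ne_zero hc hc', b * b', ?_⟩
    simp only [map_mul, hb, hb']
    ring

theorem clear_poly {A K : Type} [CommRing A] [IsDomain A] [Field K] [Algebra A K]
    [IsFractionRing A K] (r : Polynomial K) : ∃ c : A, c ≠ 0 ∧ ∃ R : Polynomial A,
      R.map (algebraMap A K) = Polynomial.C (algebraMap A K c) * r := by
  obtain ⟨b, hbm, hb⟩ := IsLocalization.integerNormalization_spec (nonZeroDivisors A) r
  refine ⟨b, nonZeroDivisors.ne_zero hbm, _, hb.trans ?_⟩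
  rw [Polynomial.C_mul', algebraMap_smul]

theorem prim_elem {d : ℕ} {A B : Type} [CommRing A] [IsDomain A] [IsIntegrallyClosed A]
    [CommRing B] [IsDomain B] [Algebra A B]
    (hinj : Function.Injective (algebraMap A B))
    (w : Fin d → B) (hw : Algebra.adjoin A (Set.range w) = ⊤)
    (E : Fin d → MvPolynomial (Fin d) A) (hE : ∀ i, aeval w (E i) = 0)
    (hdet : (Matrix.of fun i j => aeval w (pderiv j (E i))).det ≠ 0) :
    ∃ β : B, IsIntegral A β ∧ ∃ f : A, f ≠ 0 ∧ ∃ R : Fin d → Polynomial A,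
      (∀ i, algebraMap A B f * w i = Polynomial.aeval β (R i)) ∧
      ∃ U V : Polynomial A, U * minpoly A β + V * (minpoly A β).derivative = Polynomial.C f := by
  classical
  have : FaithfulSMul A B := (faithfulSMul_iff_algebraMap_injective A B).2 hinj
  let K := FractionRing A
  let L := FractionRing B
  let _ : Algebra K L := FractionRing.liftAlgebra A L
  have : IsScalarTower A K L := FractionRing.isScalarTower_liftAlgebra A L
  obtain ⟨h1, h2⟩ := fin_sep (K := K) (L := L) w hw E hE hdet
  obtain ⟨α, hα⟩ := Field.exists_primitive_element K L
  have hinjL : Function.Injective (algebraMap B L) := IsFractionRing.injective B L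
  have hinjAL : Function.Injective (algebraMap A L) := by
    rw [IsScalarTower.algebraMap_eq A B L]; exact hinjL.comp hinj
  have hinjAK : Function.Injective (algebraMap A K) := IsFractionRing.injective A K
  obtain ⟨c, hc, b, hb⟩ := clear_denom (A := A) (B := B) (K := K) α
  have hbalg : IsAlgebraic A b := by
    have : IsAlgebraic A (algebraMap B L b) := by
      rw [IsFractionRing.isAlgebraic_iff A K L]
      exact Algebra.IsAlgebraic.isAlgebraic _
    exact (isAlgebraic_algebraMap_iff hinjL).1 this
  obtain ⟨y, hy, hint⟩ := hbalg.exists_integral_multiple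
  set β := y • b with hβ
  have hβL : algebraMap B L β = algebraMap A L (y * c) * α := by
    rw [hβ, Algebra.smul_def, map_mul, hb, ← IsScalarTower.algebraMap_apply, map_mul, mul_assoc]
  have hyc : algebraMap A K (y * c) ≠ 0 := by
    rw [map_ne_zero_iff _ hinjAK]; exact mul_ne_zero hy hc
  have hprim : IntermediateField.adjoin K {algebraMap B L β} = ⊤ := by
    rw [eq_top_iff, ← hα, IntermediateField.adjoin_simple_le_iff]
    have : α = algebraMap K L (algebraMap A K (y * c))⁻¹ * algebraMap B L β := by
      rw [hβL, IsScalarTower.algebraMap_apply A K L, map_inv₀, inv_mul_cancel_left₀]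
      simpa using hyc
    rw [this]
    exact mul_mem (IntermediateField.algebraMap_mem _ _)
      (IntermediateField.mem_adjoin_simple_self K _)
  have hex : ∀ i, ∃ r : Polynomial K, algebraMap B L (w i) = Polynomial.aeval (algebraMap B L β) r := by
    intro i
    have h3 := IntermediateField.adjoin_simple_toSubalgebra_of_isAlgebraic
      (Algebra.IsAlgebraic.isAlgebraic (R := K) (algebraMap B L β))
    have : algebraMap B L (w i) ∈ Algebra.adjoin K {algebraMap B L β} := by
      rw [← h3, hprim]; trivial
    rw [Algebra.adjoin_singleton_eq_range_aeval] at this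
    obtain ⟨r, hr⟩ := this
    exact ⟨r, hr.symm⟩
  choose r hr using hex
  choose ci hci R hR using fun i => clear_poly (A := A) (r i)
  have hci' : ∀ i, algebraMap A B (ci i) * w i = Polynomial.aeval β (R i) := by
    intro i
    apply hinjL
    rw [map_mul, hr i, ← IsScalarTower.algebraMap_apply, ← Polynomial.aeval_algebraMap_apply,
      ← Polynomial.aeval_map_algebraMap K _ (R i), hR, map_mul, Polynomial.aeval_C,
      ← IsScalarTower.algebraMap_apply]
  have hmin : minpoly K (algebraMap B L β) = (minpoly A β).map (algebraMap A K) :=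
    minpoly.isIntegrallyClosed_eq_field_fractions K L hint
  have hsep : (minpoly K (algebraMap B L β)).Separable := Algebra.IsSeparable.isSeparable K _
  obtain ⟨u, v, huv⟩ := hsep
  rw [hmin, Polynomial.derivative_map] at huv
  obtain ⟨cu, hcu, U, hU⟩ := clear_poly (A := A) u
  obtain ⟨cv, hcv, V, hV⟩ := clear_poly (A := A) v
  have hbez : (Polynomial.C cv * U) * minpoly A β + (Polynomial.C cu * V) *
      (minpoly A β).derivative = Polynomial.C (cu * cv) := by
    apply Polynomial.map_injective _ hinjAK
    simp only [Polynomial.map_add, Polynomial.map_mul, Polynomial.map_C, hU, hV, map_mul]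
    linear_combination (Polynomial.C (algebraMap A K cu) * Polynomial.C (algebraMap A K cv)) * huv
  refine ⟨β, hint, (cu * cv) * ∏ i, ci i, mul_ne_zero (mul_ne_zero hcu hcv)
    (Finset.prod_ne_zero_iff.2 fun i _ => hci i),
    fun i => Polynomial.C (cu * cv * ∏ j ∈ Finset.univ.erase i, ci j) * R i, ?_,
    Polynomial.C (∏ i, ci i) * (Polynomial.C cv * U),
    Polynomial.C (∏ i, ci i) * (Polynomial.C cu * V), ?_⟩
  · intro i
    beta_reduce
    rw [map_mul (Polynomial.aeval β), Polynomial.aeval_C, ← hci', ← Finset.mul_prod_erase Finset.univ ci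
      (Finset.mem_univ i)]
    simp only [map_mul]
    ring
  · rw [mul_assoc, mul_assoc (Polynomial.C _) (Polynomial.C cu * V), ← mul_add, hbez,
      ← Polynomial.C_mul, mul_comm]

/-- ring homs over an evaluation -/
def homsOver {n : ℕ} (B : Type) [CommRing B] [Algebra (MvPolynomial (Fin n) ℝ) B]
    (a : Fin n → ℝ) : Set (B →+* ℝ) :=
  {φ | ∀ h, φ (algebraMap (MvPolynomial (Fin n) ℝ) B h) = eval a h}

theorem parity {n d : ℕ} (B : Type) [CommRing B] [IsDomain B] [Algebra (MvPolynomial (Fin n) ℝ) B]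
    (hinj : Function.Injective (algebraMap (MvPolynomial (Fin n) ℝ) B))
    (w : Fin d → B) (hw : Algebra.adjoin (MvPolynomial (Fin n) ℝ) (Set.range w) = ⊤)
    (E : Fin d → MvPolynomial (Fin d) (MvPolynomial (Fin n) ℝ)) (hE : ∀ i, aeval w (E i) = 0)
    (hdet : (Matrix.of fun i j => aeval w (pderiv j (E i))).det ≠ 0) :
    ∃ f : MvPolynomial (Fin n) ℝ, f ≠ 0 ∧ ∃ e : ℕ, ∀ a, eval a f ≠ 0 →
      (homsOver B a).ncard % 2 = e % 2 := by
  obtain ⟨β, hint, f, hf, R, hR, U, V, hUV⟩ := prim_elem hinj w hw E hE hdet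
  have : FaithfulSMul (MvPolynomial (Fin n) ℝ) B :=
    (faithfulSMul_iff_algebraMap_injective _ B).2 hinj
  have htf : Module.IsTorsionFree (MvPolynomial (Fin n) ℝ) B :=
    .trans_faithfulSMul _ B B
  set P := minpoly (MvPolynomial (Fin n) ℝ) β with hP
  have hmonic : P.Monic := minpoly.monic hint
  refine ⟨f, hf, P.natDegree, fun a ha => ?_⟩
  have hsep : (P.map (eval a)).Separable := by
    refine ⟨Polynomial.C (eval a f)⁻¹ * U.map (eval a), Polynomial.C (eval a f)⁻¹ * V.map (eval a),
      ?_⟩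
    rw [Polynomial.derivative_map, mul_assoc, mul_assoc, ← mul_add, ← Polynomial.map_mul,
      ← Polynomial.map_mul, ← Polynomial.map_add, hUV, Polynomial.map_C, ← Polynomial.C_mul,
      inv_mul_cancel₀ ha, Polynomial.C_1]
  rw [← hmonic.natDegree_map (eval a), ← card_roots_parity _ hsep]
  congr 1
  -- φ on aeval β h
  have hφ : ∀ φ ∈ homsOver B a, ∀ h : Polynomial (MvPolynomial (Fin n) ℝ),
      φ (Polynomial.aeval β h) = (h.map (eval a)).eval (φ β) := by
    intro φ hφ h
    rw [Polynomial.aeval_def, Polynomial.hom_eval₂, Polynomial.eval_map]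
    congr 1
    exact RingHom.ext hφ
  refine Set.ncard_congr (fun φ _ => φ β) ?_ ?_ ?_
  · intro φ h
    change Polynomial.eval _ _ = 0
    rw [← hφ φ h, minpoly.aeval, map_zero]
  · intro φ ψ h1 h2 h
    have h : φ β = ψ β := h
    ext b
    have hb : b ∈ Algebra.adjoin (MvPolynomial (Fin n) ℝ) (Set.range w) := hw ▸ trivial
    induction hb using Algebra.adjoin_induction with
    | mem x hx =>
      obtain ⟨i, rfl⟩ := hx
      have e1 := congrArg φ (hR i)
      have e2 := congrArg ψ (hR i)
      rw [map_mul, h1, hφ φ h1] at e1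
      rw [map_mul, h2, hφ ψ h2, ← h, ← e1] at e2
      exact (mul_left_cancel₀ ha e2).symm
    | algebraMap r => rw [h1 r, h2 r]
    | add x y _ _ hx hy => rw [map_add, map_add, hx, hy]
    | mul x y _ _ hx hy => rw [map_mul, map_mul, hx, hy]
  · intro t ht
    have ht : (P.map (eval a)).eval t = 0 := ht
    let χ : Polynomial (MvPolynomial (Fin n) ℝ) →+* ℝ := Polynomial.eval₂RingHom (eval a) t
    have hχ : ∀ h, χ h = (h.map (eval a)).eval t := fun h => by
      simp [χ, Polynomial.eval_map]
    let χB : Polynomial (MvPolynomial (Fin n) ℝ) →+* B := (Polynomial.aeval β).toRingHom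
    let v : Fin d → ℝ := fun i => χ (R i) / eval a f
    let ev : MvPolynomial (Fin d) (MvPolynomial (Fin n) ℝ) →+* ℝ := eval₂Hom (eval a) v
    have hsurj : Function.Surjective (aeval (R := MvPolynomial (Fin n) ℝ) w) := by
      rw [← AlgHom.range_eq_top, ← Algebra.adjoin_range_eq_range_aeval, hw]
    have h3 : χB.comp (algebraMap _ _) = algebraMap (MvPolynomial (Fin n) ℝ) B := by
      refine RingHom.ext fun h => ?_
      simp [χB]
    have h4 : χ.comp (algebraMap _ _) = eval a := by
      refine RingHom.ext fun h => ?_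
      simp [χ]
    have hχf : χ (Polynomial.C f) = eval a f := by simp [χ]
    have key : ∀ G (q : Polynomial (MvPolynomial (Fin n) ℝ)),
        aeval (R := MvPolynomial (Fin n) ℝ) w G = χB q → ev G = χ q := by
      intro G q hG
      obtain ⟨N, H, hH⟩ := homog (S := Polynomial (MvPolynomial (Fin n) ℝ))
        (Polynomial.C f) R G
      have e1 := hH B χB w (fun i => by simpa [χB] using hR i)
      have e2 := hH ℝ χ v (fun i => by
        simp only [v]
        rw [hχf]
        field_simp)
      rw [h3, ← aeval_def, hG, ← map_pow, ← map_mul, ← sub_eq_zero, ← map_sub] at e1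
      have hdvd : P ∣ (Polynomial.C f ^ N * q - H) := minpoly.isIntegrallyClosed_dvd hint e1
      obtain ⟨r, hr⟩ := hdvd
      have e3 := congrArg χ hr
      rw [map_mul χ P, hχ P, ht, zero_mul, map_sub, ← e2, h4, map_mul, map_pow, hχf, sub_eq_zero]
        at e3
      exact (mul_left_cancel₀ (pow_ne_zero _ ha) e3).symm
    have hker : ∀ G, aeval (R := MvPolynomial (Fin n) ℝ) w G = 0 → ev G = 0 := by
      intro G hG
      simpa using key G 0 (by simpa using hG)
    let φ : B →+* ℝ := RingHom.liftOfSurjective (aeval (R := MvPolynomial (Fin n) ℝ) w).toRingHom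
      hsurj ⟨ev, fun G hG => hker G hG⟩
    have hφev : ∀ G, φ (aeval (R := MvPolynomial (Fin n) ℝ) w G) = ev G := fun G =>
      RingHom.liftOfRightInverse_comp_apply _ _ _ ⟨ev, fun G hG => hker G hG⟩ G
    have hmem : φ ∈ homsOver B a := by
      intro h
      have := hφev (C h)
      rwa [aeval_C, show ev (C h) = eval a h by simp [ev]] at this
    refine ⟨φ, hmem, ?_⟩
    -- φ β = t
    obtain ⟨Q, hQ⟩ := hsurj β
    have := key Q Polynomial.X (by rw [hQ]; simp [χB])
    rw [← hφev, hQ] at this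
    exact this.trans (by simp [χ])
end RRJC


namespace RRJC
open MvPolynomial Topology Filter

theorem near {n d : ℕ} (U : (Fin n → ℝ) → (Fin d → ℝ)) (z : Fin n → ℝ) (hz : U z = 0)
    (Du : (Fin n → ℝ) →L[ℝ] (Fin d → ℝ)) (hU : HasFDerivAt U Du z)
    (E : (Fin d → ℝ) →L[ℝ] (Fin n → ℝ)) (J : (Fin d → ℝ) →L[ℝ] (Fin d → ℝ))
    (hJ : ∀ p, J (Du (E p)) = p) :
    ∃ ρ > 0, ∃ η > 0, ∀ p r, p ≠ 0 → ‖p‖ < ρ → ‖r‖ ≤ η * ‖p‖ → U (z + E p + r) ≠ 0 := by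
  set M := ‖J‖ + 1 with hM
  have hMpos : 0 < M := by positivity
  have hMp : ∀ p, ‖p‖ ≤ M * ‖Du (E p)‖ := by
    intro p
    calc ‖p‖ = ‖J (Du (E p))‖ := by rw [hJ]
      _ ≤ ‖J‖ * ‖Du (E p)‖ := J.le_opNorm _
      _ ≤ _ := by gcongr; simp [hM]
  set c := 1 / (4 * M * (‖E‖ + 1)) with hc
  have hcpos : 0 < c := by positivity
  set η := min 1 (1 / (4 * M * (‖Du‖ + 1))) with hη
  have hηpos : 0 < η := by positivity
  have hη1 : η ≤ 1 := min_le_left _ _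
  have hη2 : η * ‖Du‖ ≤ 1 / (4 * M) := by
    calc η * ‖Du‖ ≤ (1 / (4 * M * (‖Du‖ + 1))) * (‖Du‖ + 1) := by
          gcongr
          · exact min_le_right _ _
          · simp
      _ = _ := by field_simp
  have hlo := (hasFDerivAt_iff_isLittleO_nhds_zero.1 hU).def hcpos
  rw [Metric.eventually_nhds_iff] at hlo
  obtain ⟨ρ, hρ, hlo⟩ := hlo
  refine ⟨ρ / (‖E‖ + 1), by positivity, η, hηpos, fun p r hp hpρ hr h0 => ?_⟩
  have hpp : 0 < ‖p‖ := norm_pos_iff.2 hp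
  have hv : ‖E p + r‖ ≤ (‖E‖ + 1) * ‖p‖ := by
    calc ‖E p + r‖ ≤ ‖E p‖ + ‖r‖ := norm_add_le _ _
      _ ≤ ‖E‖ * ‖p‖ + 1 * ‖p‖ := by
        gcongr
        · exact E.le_opNorm _
        · exact hr.trans (by gcongr)
      _ = _ := by ring
  have h1 := hlo (y := E p + r) (by
    rw [dist_zero_right]
    refine hv.trans_lt ?_
    rw [lt_div_iff₀ (by positivity)] at hpρ
    linarith)
  rw [← add_assoc, h0, hz, sub_zero, zero_sub, norm_neg] at h1
  have h2 : ‖Du (E p)‖ ≤ ‖Du (E p + r)‖ + ‖Du r‖ := by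
    rw [map_add]
    exact norm_le_add_norm_add _ _
  have h3 : ‖Du r‖ ≤ 1 / (4 * M) * ‖p‖ := by
    calc ‖Du r‖ ≤ ‖Du‖ * ‖r‖ := Du.le_opNorm _
      _ ≤ ‖Du‖ * (η * ‖p‖) := by gcongr
      _ = (η * ‖Du‖) * ‖p‖ := by ring
      _ ≤ _ := by gcongr
  have h4 : c * ‖E p + r‖ ≤ 1 / (4 * M) * ‖p‖ := by
    calc _ ≤ c * ((‖E‖ + 1) * ‖p‖) := by gcongr
      _ = _ := by rw [hc]; field_simp
  have h5 : ‖p‖ ≤ M * (1 / (4 * M) * ‖p‖ + 1 / (4 * M) * ‖p‖) := by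
    refine (hMp p).trans ?_
    gcongr
    linarith
  have h6 : M * (1 / (4 * M) * ‖p‖ + 1 / (4 * M) * ‖p‖) = ‖p‖ / 2 := by field_simp; ring
  linarith

/-- the compact model -/
def KK (d : ℕ) : Set (Option (Fin d) → ℝ) :=
  {x | ∑ i, x (some i) ^ 2 = x none * (1 - x none)}

theorem KK_none {d : ℕ} {x : Option (Fin d) → ℝ} (hx : x ∈ KK d) : 0 ≤ x none ∧ x none ≤ 1 := by
  have h : ∑ i, x (some i) ^ 2 = x none * (1 - x none) := hx
  have h0 : 0 ≤ ∑ i, x (some i) ^ 2 := Finset.sum_nonneg fun i _ => sq_nonneg _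
  constructor <;> nlinarith

theorem KK_some {d : ℕ} {x : Option (Fin d) → ℝ} (hx : x ∈ KK d) (i : Fin d) :
    |x (some i)| ≤ 1 / 2 := by
  have h : ∑ i, x (some i) ^ 2 = x none * (1 - x none) := hx
  have h0 : x (some i) ^ 2 ≤ ∑ i, x (some i) ^ 2 :=
    Finset.single_le_sum (f := fun i => x (some i) ^ 2) (fun i _ => sq_nonneg _) (Finset.mem_univ i)
  apply abs_le_of_sq_le_sq _ (by norm_num)
  nlinarith [sq_nonneg (x none - 1 / 2)]

theorem KK_compact (d : ℕ) : IsCompact (KK d) := by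
  apply Metric.isCompact_of_isClosed_isBounded
  · exact isClosed_eq (by fun_prop) (by fun_prop)
  · rw [isBounded_iff_forall_norm_le]
    refine ⟨1, fun x hx => ?_⟩
    rw [pi_norm_le_iff_of_nonneg zero_le_one]
    rintro (_ | i)
    · rw [Real.norm_eq_abs, abs_le]
      have := KK_none hx
      constructor <;> linarith
    · rw [Real.norm_eq_abs]
      linarith [KK_some hx i]

theorem sw {d : ℕ} (f : KK d → ℝ) (hf : Continuous f) {δ : ℝ} (hδ : 0 < δ) :
    ∃ p : MvPolynomial (Option (Fin d)) ℝ, ∀ x : KK d, |eval (x : Option (Fin d) → ℝ) p - f x| < δ := by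
  have : CompactSpace (KK d) := isCompact_iff_compactSpace.1 (KK_compact d)
  let co : Option (Fin d) → C(KK d, ℝ) := fun o => ⟨fun x => (x : Option (Fin d) → ℝ) o,
    (continuous_apply o).comp continuous_subtype_val⟩
  let A : Subalgebra ℝ C(KK d, ℝ) := (aeval (R := ℝ) co).range
  have hsep : A.SeparatesPoints := by
    intro x y hxy
    have : ∃ o, (x : Option (Fin d) → ℝ) o ≠ (y : Option (Fin d) → ℝ) o := by
      by_contra! h
      exact hxy (Subtype.ext (funext h))
    obtain ⟨o, ho⟩ := this
    exact ⟨co o, ⟨co o, ⟨X o, by simp⟩, rfl⟩, ho⟩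
  have h1 : ∀ (p : MvPolynomial (Option (Fin d)) ℝ) (x : KK d),
      (aeval (R := ℝ) co p) x = eval (x : Option (Fin d) → ℝ) p := by
    intro p x
    induction p using MvPolynomial.induction_on with
    | C a => simp
    | add p q hp hq => rw [map_add, map_add, ContinuousMap.add_apply, hp, hq]
    | mul_X p i hp => rw [map_mul, map_mul, ContinuousMap.mul_apply, hp, aeval_X, eval_X]; rfl
  obtain ⟨⟨g, ⟨p, rfl⟩⟩, hg⟩ :=
    ContinuousMap.exists_mem_subalgebra_near_continuous_of_separatesPoints A hsep f hf δ hδ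
  refine ⟨p, fun x => ?_⟩
  have := hg x
  rw [Real.norm_eq_abs] at this
  rw [← h1]
  exact this

/-- the base point -/
def x1 (d : ℕ) : Option (Fin d) → ℝ := fun o => o.elim 1 (fun _ => 0)

theorem phi_exists {n d : ℕ} (W : Set (Fin n → ℝ)) (hW : IsOpen W)
    (F G : (Fin n → ℝ) → (Fin n → ℝ)) (hFc : Continuous F) (hFW : ∀ x, F x ∈ W)
    (hG : ContinuousOn G W) (hFG : ∀ y ∈ W, F (G y) = y)
    (U : (Fin n → ℝ) → (Fin d → ℝ)) (z : Fin n → ℝ) (hz : z ∉ W)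
    (hUW : ∀ y, y ∉ W → U y = 0)
    (Du : (Fin n → ℝ) →L[ℝ] (Fin d → ℝ)) (hU : HasFDerivAt U Du z)
    (E : (Fin d → ℝ) →L[ℝ] (Fin n → ℝ)) (J : (Fin d → ℝ) →L[ℝ] (Fin d → ℝ))
    (hJ : ∀ p, J (Du (E p)) = p) :
    ∃ ε : ℝ, 0 < ε ∧ ∃ κ : Fin n → MvPolynomial (Option (Fin d)) ℝ, ∀ x ∈ KK d,
      (z + ε • E (fun j => x (some j)) + (1 - x none) • (fun l => eval x (κ l))) ∉ W →
      x = x1 d := by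
  obtain ⟨ρ, hρ, η, hη, hnear⟩ := near U z (hUW z hz) Du hU E J hJ
  set ε := ρ / 2 with hεd
  have hε : 0 < ε := by positivity
  set pp : (Option (Fin d) → ℝ) → (Fin d → ℝ) := fun x j => x (some j) with hpp
  have hppc : Continuous pp := by fun_prop
  have hppn : ∀ x ∈ KK d, ‖pp x‖ ≤ 1 / 2 := fun x hx => by
    rw [pi_norm_le_iff_of_nonneg (by norm_num)]
    exact fun i => KK_some hx i
  have hnear' : ∀ x ∈ KK d, pp x ≠ 0 → ∀ r : Fin n → ℝ, ‖r‖ ≤ η * ε * ‖pp x‖ →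
      z + ε • E (pp x) + r ∈ W := by
    intro x hx hp r hr
    by_contra hc
    refine hnear (ε • pp x) r (smul_ne_zero hε.ne' hp) ?_ ?_ (by rw [map_smul]; exact hUW _ hc)
    · rw [norm_smul, Real.norm_eq_abs, abs_of_pos hε]
      have := hppn x hx
      nlinarith
    · rw [norm_smul, Real.norm_eq_abs, abs_of_pos hε]
      linarith
  -- the sphere
  let Sp : Set (Option (Fin d) → ℝ) := KK d ∩ {x | x none = 1 / 2}
  have hSp : IsClosed Sp := (KK_compact d).isClosed.inter (isClosed_eq (by fun_prop) (by fun_prop))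
  have hSpp : ∀ x ∈ Sp, pp x ≠ 0 := by
    rintro x ⟨hx, hx2⟩ h0
    have h : ∑ i, x (some i) ^ 2 = x none * (1 - x none) := hx
    have hx2 : x none = 1 / 2 := hx2
    have : ∀ i, x (some i) = 0 := fun i => congrFun h0 i
    simp [this, hx2] at h
    norm_num at h
  have hSpW : ∀ x ∈ Sp, z + ε • E (pp x) ∈ W := by
    intro x hx
    have := hnear' x hx.1 (hSpp x hx) 0 (by simp; positivity)
    simpa using this
  have hcont : Continuous fun x : Sp => G (z + ε • E (pp x)) := by
    apply hG.comp_continuous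
    · have := E.continuous
      fun_prop
    · exact fun x => hSpW x x.2
  obtain ⟨ξ, hξ⟩ := ContinuousMap.exists_restrict_eq hSp
    (⟨fun x : Sp => G (z + ε • E (pp x)), hcont⟩ : C(Sp, Fin n → ℝ))
  have hξ' : ∀ x ∈ Sp, ξ x = G (z + ε • E (pp x)) := fun x hx =>
    congrArg (fun g : C(Sp, Fin n → ℝ) => g ⟨x, hx⟩) hξ
  -- κ_c
  let κc : (Option (Fin d) → ℝ) → (Fin n → ℝ) := fun x => if 1 / 2 ≤ x none then 0 else
    (1 - x none)⁻¹ • (F (ξ x) - z - ε • E (pp x))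
  have hκlow : ∀ x ∈ KK d, x none ≤ 1 / 2 →
      κc x = (1 - x none)⁻¹ • (F (ξ x) - z - ε • E (pp x)) := by
    intro x hx hx2
    rcases hx2.lt_or_eq with h | h
    · simp only [κc]; rw [if_neg (by linarith)]
    · simp only [κc]; rw [if_pos (by linarith)]
      rw [hξ' x ⟨hx, h⟩, hFG _ (hSpW x ⟨hx, h⟩)]
      simp
  have hκcont : ContinuousOn κc (KK d) := by
    have h1 : ContinuousOn κc (KK d ∩ {x | 1 / 2 ≤ x none}) := by
      apply (continuousOn_const (c := (0 : Fin n → ℝ))).congr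
      rintro x ⟨_, hx⟩
      exact if_pos hx
    have h2 : ContinuousOn κc (KK d ∩ {x | x none ≤ 1 / 2}) := by
      have : ContinuousOn (fun x : Option (Fin d) → ℝ => (1 - x none)⁻¹ •
          (F (ξ x) - z - ε • E (pp x))) (KK d ∩ {x | x none ≤ 1 / 2}) := by
        refine ContinuousOn.smul (f := fun x : Option (Fin d) → ℝ => (1 - x none)⁻¹)
          (g := fun x => F (ξ x) - z - ε • E (pp x)) ?_ ?_
        · apply ContinuousOn.inv₀ (by fun_prop)
          rintro x ⟨_, hx⟩
          have hx : x none ≤ 1 / 2 := hx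
          linarith
        · have := E.continuous
          have := ξ.continuous
          fun_prop
      exact this.congr fun x hx => hκlow x hx.1 hx.2
    have := h1.union_of_isClosed h2
      ((KK_compact d).isClosed.inter (isClosed_le (by fun_prop) (by fun_prop)))
      ((KK_compact d).isClosed.inter (isClosed_le (by fun_prop) (by fun_prop)))
    refine this.mono fun x hx => ?_
    rcases le_total (1 / 2) (x none) with h | h
    · exact Or.inl ⟨hx, h⟩
    · exact Or.inr ⟨hx, h⟩
  -- compactness
  obtain ⟨δ0, hδ0, hthick⟩ := IsCompact.exists_thickening_subset_open
    ((KK_compact d).image (hFc.comp ξ.continuous)) hW (by rintro _ ⟨x, _, rfl⟩; exact hFW _)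
  set δ := min (δ0 / 2) (η * ε / (2 * (d + 1))) with hδd
  have hδ : 0 < δ := by positivity
  have hsw : ∀ l, ∃ p : MvPolynomial (Option (Fin d)) ℝ, ∀ x : KK d,
      |eval (x : Option (Fin d) → ℝ) p - κc x l| < δ := fun l =>
    sw (fun x : KK d => κc x l)
      ((continuous_apply l).comp (continuousOn_iff_continuous_restrict.1 hκcont)) hδ
  choose κ hκ using hsw
  have hκn : ∀ x ∈ KK d, ‖(fun l => eval x (κ l)) - κc x‖ ≤ δ := fun x hx => by
    rw [pi_norm_le_iff_of_nonneg hδ.le]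
    exact fun l => (hκ l ⟨x, hx⟩).le
  refine ⟨ε, hε, κ, fun x hx hxW => ?_⟩
  have hq := KK_none hx
  rcases le_total (x none) (1 / 2) with h | h
  · exfalso
    apply hxW
    apply hthick
    rw [Metric.mem_thickening_iff]
    refine ⟨F (ξ x), ⟨x, hx, rfl⟩, ?_⟩
    have e1 : F (ξ x) = z + ε • E (pp x) + (1 - x none) • κc x := by
      rw [hκlow x hx h, smul_smul, mul_inv_cancel₀ (by linarith), one_smul]
      abel
    rw [dist_eq_norm, e1]
    have e2 : z + ε • E (fun j => x (some j)) + (1 - x none) • (fun l => eval x (κ l)) -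
      (z + ε • E (pp x) + (1 - x none) • κc x) = (1 - x none) •
        ((fun l => eval x (κ l)) - κc x) := by
      rw [smul_sub, hpp]; abel
    rw [e2, norm_smul, Real.norm_eq_abs, abs_of_nonneg (by linarith)]
    have := hκn x hx
    have : δ ≤ δ0 / 2 := min_le_left _ _
    nlinarith [norm_nonneg ((fun l => eval x (κ l)) - κc x)]
  · have hK : ∑ i, x (some i) ^ 2 = x none * (1 - x none) := hx
    by_cases hp : pp x = 0
    · have h0 : ∀ i, x (some i) = 0 := fun i => congrFun hp i
      simp only [h0] at hK
      have : x none = 1 := by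
        simp at hK
        rcases hK with hK | hK <;> linarith
      funext o
      rcases o with _ | i
      · exact this
      · exact h0 i
    · exfalso
      apply hxW
      refine hnear' x hx hp _ ?_
      have h1 := hκn x hx
      have h2 : κc x = 0 := if_pos h
      rw [h2, sub_zero] at h1
      rw [norm_smul, Real.norm_eq_abs, abs_of_nonneg (by linarith)]
      have h3 : ∑ i, x (some i) ^ 2 ≤ d * ‖pp x‖ := by
        calc _ ≤ ∑ i : Fin d, ‖pp x‖ := by
              apply Finset.sum_le_sum
              intro i _
              have : |x (some i)| ≤ ‖pp x‖ := norm_le_pi_norm (pp x) i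
              have := KK_some hx i
              rw [← sq_abs]
              nlinarith [abs_nonneg (x (some i))]
          _ = _ := by simp
      have h4 : 1 - x none ≤ 2 * (d * ‖pp x‖) := by nlinarith
      have h5 : δ * (2 * (d + 1)) ≤ η * ε := by
        rw [← le_div_iff₀ (by positivity)]
        exact min_le_right _ _
      have hd : (0 : ℝ) ≤ d := Nat.cast_nonneg d
      calc _ ≤ 2 * (d * ‖pp x‖) * δ := by gcongr
        _ = δ * (2 * d) * ‖pp x‖ := by ring
        _ ≤ _ := by
          apply mul_le_mul_of_nonneg_right _ (norm_nonneg _)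
          nlinarith

end RRJC

namespace RRJC
open MvPolynomial Topology Filter

/-- evaluation in both sets of variables -/
noncomputable def ev2 {n d : ℕ} (a : Fin n → ℝ) (w : Fin d → ℝ) :
    MvPolynomial (Fin d) (MvPolynomial (Fin n) ℝ) →+* ℝ := eval₂Hom (eval a) w

theorem ev2_hom {n d : ℕ} {B : Type} [CommRing B] [Algebra (MvPolynomial (Fin n) ℝ) B]
    (a : Fin n → ℝ) (φ : B →+* ℝ)
    (hφ : ∀ h, φ (algebraMap (MvPolynomial (Fin n) ℝ) B h) = eval a h) (w : Fin d → B)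
    (H : MvPolynomial (Fin d) (MvPolynomial (Fin n) ℝ)) :
    φ (aeval w H) = ev2 a (fun i => φ (w i)) H := by
  have : (φ.comp (aeval w).toRingHom) = ev2 a (fun i => φ (w i)) := by
    apply MvPolynomial.ringHom_ext
    · intro r
      simp [ev2, hφ]
    · intro i
      simp [ev2]
  exact congrArg (fun g => g H) this

theorem ev2_analytic {n d : ℕ} (ω : (Fin n → ℝ) → (Fin d → ℝ)) (a : Fin n → ℝ)
    (hω : AnalyticAt ℝ ω a) (H : MvPolynomial (Fin d) (MvPolynomial (Fin n) ℝ)) :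
    AnalyticAt ℝ (fun a => ev2 a (ω a) H) a := by
  induction H using MvPolynomial.induction_on with
  | C p => simpa [ev2] using analyticAt_eval p a
  | add p q hp hq => simp only [map_add]; exact hp.add hq
  | mul_X p i hp =>
    have h1 : AnalyticAt ℝ (fun a => ω a i) a := by
      have := (ContinuousLinearMap.proj (R := ℝ) (φ := fun _ : Fin d => ℝ) i).analyticAt (ω a)
      exact this.comp hω
    have h2 : (fun a => ev2 a (ω a) (p * X i)) = fun a => ev2 a (ω a) p * ω a i := by
      funext a
      rw [map_mul]
      simp [ev2]
    rw [h2]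
    exact hp.mul h1

theorem ker_prime {n d : ℕ} (ω : (Fin n → ℝ) → (Fin d → ℝ)) (U : Set (Fin n → ℝ))
    (hUo : IsOpen U) (hUc : IsPreconnected U) (h0U : (0 : Fin n → ℝ) ∈ U)
    (hω : ∀ a ∈ U, AnalyticAt ℝ ω a) :
    ∃ I : Ideal (MvPolynomial (Fin d) (MvPolynomial (Fin n) ℝ)), I.IsPrime ∧
      ∀ H, H ∈ I ↔ ∀ a ∈ U, ev2 a (ω a) H = 0 := by
  let Θ : MvPolynomial (Fin d) (MvPolynomial (Fin n) ℝ) →+* (U → ℝ) :=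
    RingHom.pi fun a => ev2 a (ω a)
  have hker : ∀ H, H ∈ RingHom.ker Θ ↔ ∀ a ∈ U, ev2 a (ω a) H = 0 := by
    intro H
    rw [RingHom.mem_ker, funext_iff]
    exact ⟨fun h a ha => h ⟨a, ha⟩, fun h a => h a a.2⟩
  refine ⟨RingHom.ker Θ, ?_, hker⟩
  constructor
  · rw [Ne, Ideal.eq_top_iff_one, hker]
    intro h
    have := h 0 h0U
    simp at this
  · intro G H hGH
    by_contra hc
    push Not at hc
    obtain ⟨hG, hH⟩ := hc
    apply hH
    rw [hker] at hG hGH ⊢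
    push Not at hG
    obtain ⟨a0, ha0, hG⟩ := hG
    have han : ∀ H, AnalyticOnNhd ℝ (fun a => ev2 a (ω a) H) U := fun H a ha =>
      ev2_analytic ω a (hω a ha) H
    have := (han H).eqOn_zero_of_preconnected_of_eventuallyEq_zero hUc ha0 (by
      have h1 := ((han G) a0 ha0).continuousAt.eventually_ne hG
      filter_upwards [h1, hUo.mem_nhds ha0] with a h1 h2
      have := hGH a h2
      rw [map_mul] at this
      exact (mul_eq_zero.1 this).resolve_left h1)
    exact fun a ha => this ha

theorem exists_B {n d : ℕ} (I : Ideal (MvPolynomial (Fin d) (MvPolynomial (Fin n) ℝ)))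
    (hI : I.IsPrime) : ∃ (B : Type) (_ : CommRing B) (_ : IsDomain B)
      (_ : Algebra (MvPolynomial (Fin n) ℝ) B) (w : Fin d → B),
      Function.Surjective (aeval (R := MvPolynomial (Fin n) ℝ) w) ∧
      ∀ H, aeval (R := MvPolynomial (Fin n) ℝ) w H = 0 ↔ H ∈ I := by
  have hwa : (aeval (fun i => Ideal.Quotient.mk I (X i)) :
      MvPolynomial (Fin d) (MvPolynomial (Fin n) ℝ) →ₐ[MvPolynomial (Fin n) ℝ]
      MvPolynomial (Fin d) (MvPolynomial (Fin n) ℝ) ⧸ I) =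
      Ideal.Quotient.mkₐ (MvPolynomial (Fin n) ℝ) I := by
    apply MvPolynomial.algHom_ext
    intro i
    rw [aeval_X]; rfl
  refine ⟨MvPolynomial (Fin d) (MvPolynomial (Fin n) ℝ) ⧸ I, inferInstance,
    Ideal.Quotient.isDomain _, inferInstance, fun i => Ideal.Quotient.mk I (X i), ?_, ?_⟩
  · rw [hwa]
    exact Ideal.Quotient.mkₐ_surjective _ _
  · intro H
    rw [hwa]
    exact Ideal.Quotient.eq_zero_iff_mem

theorem T5app {n d : ℕ} (E : Fin d → MvPolynomial (Fin d) (MvPolynomial (Fin n) ℝ))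
    (Hb : MvPolynomial (Fin d) (MvPolynomial (Fin n) ℝ))
    (ω : (Fin n → ℝ) → (Fin d → ℝ)) (hω : AnalyticAt ℝ ω 0)
    (hE : ∀ i, ∀ᶠ a in 𝓝 0, ev2 a (ω a) (E i) = 0)
    (hHb : ∀ᶠ a in 𝓝 0, ev2 a (ω a) Hb = 0)
    (hdet : (Matrix.of fun i j => ev2 0 (ω 0) (pderiv j (E i))).det ≠ 0)
    (huniq : ∀ᶠ a in 𝓝 0, ∀ w, (∀ i, ev2 a w (E i) = 0) → ev2 a w Hb = 0 → w = ω a)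
    (hfar : ∀ f : MvPolynomial (Fin n) ℝ, f ≠ 0 → ∃ a, eval a f ≠ 0 ∧ ∀ w, ev2 a w Hb ≠ 0) :
    False := by
  obtain ⟨r, hr, hU⟩ := Metric.eventually_nhds_iff_ball.1
    ((((eventually_all.2 hE).and hHb).and huniq).and hω.eventually_analyticAt)
  set U := Metric.ball (0 : Fin n → ℝ) r with hUd
  have h0U : (0 : Fin n → ℝ) ∈ U := Metric.mem_ball_self hr
  have hUo : IsOpen U := Metric.isOpen_ball
  have hUc : IsPreconnected U := (convex_ball _ _).isPreconnected
  obtain ⟨I, hI, hker⟩ := ker_prime ω U hUo hUc h0U fun a ha => (hU a ha).2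
  obtain ⟨B, _, _, _, w, hsurj, hzero⟩ := exists_B I hI
  simp only [hker] at hzero
  obtain ⟨f, hf, e, hpar⟩ := parity B (by
      rw [injective_iff_map_eq_zero]
      intro h hh
      have hh : aeval w (C h : MvPolynomial (Fin d) (MvPolynomial (Fin n) ℝ)) = 0 := by
        rw [aeval_C, hh]
      rw [hzero] at hh
      refine vanish_open h U hUo ⟨0, h0U⟩ ?_
      intro a ha
      simpa [ev2] using hh a ha) w (by
      rw [eq_top_iff]
      rintro b -
      obtain ⟨H, rfl⟩ := hsurj b
      rw [Algebra.adjoin_range_eq_range_aeval]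
      exact ⟨H, rfl⟩) E (fun i => (hzero _).2 fun a ha => (hU a ha).1.1.1 i) (by
      intro h
      have h1 : (Matrix.of fun i j => aeval w (pderiv j (E i))).det =
        aeval w (Matrix.of fun i j => pderiv j (E i)).det := by
        rw [AlgHom.map_det]
        rfl
      rw [h1, hzero] at h
      apply hdet
      rw [← h 0 h0U, RingHom.map_det]
      rfl)
  -- near
  have hnear : e % 2 = 1 := by
    obtain ⟨a, ha, hfa⟩ : ∃ a ∈ U, eval a f ≠ 0 := by
      by_contra hc
      push Not at hc
      exact hf (vanish_open f U hUo ⟨0, h0U⟩ hc)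
    rw [← hpar a hfa]
    obtain ⟨ψ, hψ⟩ : ∃ ψ : B →+* ℝ, ∀ H, ψ (aeval w H) = ev2 a (ω a) H := by
      refine ⟨RingHom.liftOfSurjective (aeval w : MvPolynomial (Fin d)
        (MvPolynomial (Fin n) ℝ) →ₐ[_] B).toRingHom hsurj ⟨ev2 a (ω a), ?_⟩, ?_⟩
      · intro H hH
        exact (hzero H).1 hH a ha
      · intro H
        exact RingHom.liftOfRightInverse_comp_apply _ _ _ _ _
    have : homsOver B a = {ψ} := by
      apply Set.eq_singleton_iff_unique_mem.2
      constructor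
      · intro h
        have := hψ (C h)
        rw [aeval_C] at this
        rw [this]
        simp [ev2]
      · intro φ hφ
        have hφ' : ∀ h, φ (algebraMap (MvPolynomial (Fin n) ℝ) B h) = eval a h := hφ
        have h1 := ev2_hom a φ hφ' w
        have h2 : (fun i => φ (w i)) = ω a := by
          apply (hU a ha).1.2
          · intro i
            rw [← h1, (hzero _).2 fun a ha => (hU a ha).1.1.1 i, map_zero]
          · rw [← h1, (hzero _).2 fun a ha => (hU a ha).1.1.2, map_zero]
        apply RingHom.ext
        intro b
        obtain ⟨H, rfl⟩ := hsurj b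
        rw [h1, h2, hψ]
    rw [this]
    simp
  obtain ⟨a, hfa, ha⟩ := hfar f hf
  have : homsOver B a = ∅ := by
    rw [Set.eq_empty_iff_forall_notMem]
    intro φ hφ
    have h1 := ev2_hom a φ hφ w Hb
    rw [(hzero _).2 fun a ha => (hU a ha).1.1.2, map_zero] at h1
    exact ha _ h1.symm
  have h3 := hpar a hfa
  rw [this, hnear] at h3
  simp at h3

end RRJC

namespace RRJC
open MvPolynomial Topology Filter

theorem homog_smul {n : ℕ} {p : MvPolynomial (Fin n) ℝ} {k : ℕ} (hp : p.IsHomogeneous k)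
    (s : ℝ) (u : Fin n → ℝ) : eval (s • u) p = s ^ k * eval u p := by
  rw [eval_eq', eval_eq', Finset.mul_sum]
  apply Finset.sum_congr rfl
  intro m hm
  have h1 : m.degree = k := by
    have := hp (mem_support_iff.1 hm)
    rw [Finsupp.degree_eq_weight_one]; exact this
  have h2 : ∑ i, m i = k := by
    rw [← h1, Finsupp.degree_eq_sum]
  simp only [Pi.smul_apply, smul_eq_mul, mul_pow]
  rw [Finset.prod_mul_distrib, Finset.prod_pow_eq_pow_sum, h2]
  ring

theorem top_ne_zero {n : ℕ} {h : MvPolynomial (Fin n) ℝ} (hh : h ≠ 0) :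
    homogeneousComponent h.totalDegree h ≠ 0 := by
  obtain ⟨m, hm, hd⟩ := Finset.exists_mem_eq_sup h.support
    (support_nonempty.2 hh) (fun m => m.degree)
  intro h0
  have := congrArg (coeff m) h0
  rw [coeff_homogeneousComponent, if_pos] at this
  · exact mem_support_iff.1 hm (by simpa using this)
  · rw [← hd, totalDegree_eq]
    congr 1
    funext s
    rw [Finsupp.degree_eq_weight_one]
    simp [Finsupp.weight_apply, Finsupp.sum, Finsupp.card_toMultiset]

theorem far {n : ℕ} (h : MvPolynomial (Fin n) ℝ) (hh : h ≠ 0) (R : ℝ) (hR : 0 ≤ R) :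
    ∃ a : Fin n → ℝ, ∀ y, ‖y‖ ≤ R → eval (y + a) h ≠ 0 := by
  obtain ⟨v, hv⟩ : ∃ v : Fin n → ℝ, eval v (homogeneousComponent h.totalDegree h) ≠ 0 := by
    by_contra hc
    push Not at hc
    exact top_ne_zero hh (MvPolynomial.funext (by simpa using hc))
  set N := h.totalDegree with hN
  let K : ℝ × (Fin n → ℝ) → ℝ := fun q => ∑ k ∈ Finset.range (N + 1),
    q.1 ^ (N - k) * eval q.2 (homogeneousComponent k h)
  have hK : Continuous K := by
    apply continuous_finsetSum
    intro k _
    have := (continuous_eval' (homogeneousComponent k h))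
    fun_prop
  have hK0 : K (0, v) ≠ 0 := by
    have : K (0, v) = eval v (homogeneousComponent N h) := by
      simp only [K]
      rw [Finset.sum_range_succ, Finset.sum_eq_zero]
      · simp
      · intro k hk
        have : N - k ≠ 0 := by have := Finset.mem_range.1 hk; omega
        simp [this]
    rwa [this]
  obtain ⟨δ, hδ, hball⟩ := Metric.eventually_nhds_iff_ball.1 (hK.continuousAt.eventually_ne hK0)
  set s := δ / (2 * (R + 1)) with hs
  have hspos : 0 < s := by positivity
  have hs1 : s * (R + 1) = δ / 2 := by rw [hs]; field_simp
  refine ⟨s⁻¹ • v, fun y hy h0 => ?_⟩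
  apply hball (s, v + s • y)
  · rw [Metric.mem_ball, Prod.dist_eq, max_lt_iff]
    constructor
    · simp [abs_of_pos hspos]
      nlinarith
    · simp [norm_smul, abs_of_pos hspos]
      nlinarith [norm_nonneg y]
  · have h1 : v + s • y = s • (y + s⁻¹ • v) := by
      rw [smul_add, smul_smul, mul_inv_cancel₀ hspos.ne', one_smul, add_comm]
    have h2 : K (s, v + s • y) = s ^ N * eval (y + s⁻¹ • v) h := by
      simp only [K]
      conv_rhs => rw [← sum_homogeneousComponent h]
      rw [map_sum, Finset.mul_sum]
      apply Finset.sum_congr rfl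
      intro k hk
      have : k ≤ N := by have := Finset.mem_range.1 hk; omega
      rw [h1, homog_smul (homogeneousComponent_isHomogeneous k h), ← mul_assoc, ← pow_add,
        Nat.sub_add_cancel this]
    rw [h2, h0, mul_zero]

end RRJC

namespace RRJC
open MvPolynomial Topology Filter

/-- denominator of the chart -/
def DD {d : ℕ} (w : Fin d → ℝ) : ℝ := 1 + ∑ i, w i ^ 2

theorem DD_ge {d : ℕ} (w : Fin d → ℝ) : 1 ≤ DD w := by
  have : 0 ≤ ∑ i, w i ^ 2 := Finset.sum_nonneg fun i _ => sq_nonneg _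
  unfold DD; linarith

theorem DD_ne {d : ℕ} (w : Fin d → ℝ) : DD w ≠ 0 := by
  have := DD_ge w
  linarith

/-- the chart -/
noncomputable def xw {d : ℕ} (w : Fin d → ℝ) : Option (Fin d) → ℝ :=
  fun o => o.elim (DD w)⁻¹ (fun i => (DD w)⁻¹ * w i)

theorem xw_mem {d : ℕ} (w : Fin d → ℝ) : xw w ∈ KK d := by
  show ∑ i, ((DD w)⁻¹ * w i) ^ 2 = (DD w)⁻¹ * (1 - (DD w)⁻¹)
  have h : ∑ i, w i ^ 2 = DD w - 1 := by unfold DD; ring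
  simp only [mul_pow]
  rw [← Finset.mul_sum, h]
  have := DD_ne w
  field_simp

/-- the polynomial map in the chart -/
noncomputable def PhiM {n d : ℕ} (Ψ : Fin n → MvPolynomial (Option (Fin d)) ℝ) (w : Fin d → ℝ) :
    Fin n → ℝ := fun l => eval (xw w) (Ψ l)

theorem Phi_compact {n d : ℕ} (Ψ : Fin n → MvPolynomial (Option (Fin d)) ℝ)
    (Z : Set (Fin n → ℝ)) (hZ : IsClosed Z)
    (hΨ : ∀ x ∈ KK d, (fun l => eval x (Ψ l)) ∈ Z → x = x1 d)
    (O : Set (Fin d → ℝ)) (hO : O ∈ 𝓝 0) :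
    ∀ᶠ a in 𝓝 (0 : Fin n → ℝ), ∀ w, PhiM Ψ w + a ∈ Z → w ∈ O := by
  obtain ⟨r, hr, hrO⟩ := Metric.mem_nhds_iff.1 hO
  have hc : IsCompact (KK d ∩ {x | x none ≤ (1 + r ^ 2)⁻¹}) :=
    (KK_compact d).inter_right (isClosed_le (by fun_prop) (by fun_prop))
  have hcont : Continuous fun x : Option (Fin d) → ℝ => fun l => eval x (Ψ l) :=
    continuous_pi fun l => MvPolynomial.continuous_eval (Ψ l)
  obtain ⟨δ, hδ, hth⟩ := (hc.image hcont).exists_thickening_subset_open hZ.isOpen_compl (by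
    rintro _ ⟨x, ⟨hx, hx2⟩, rfl⟩ hxZ
    have := hΨ x hx hxZ
    have hx2 : x none ≤ (1 + r ^ 2)⁻¹ := hx2
    rw [this] at hx2
    have h3 : (1 : ℝ) ≤ (1 + r ^ 2)⁻¹ := hx2
    rw [le_inv_comm₀ (by norm_num) (by positivity)] at h3
    have : 0 < r ^ 2 := by positivity
    norm_num at h3
    linarith)
  filter_upwards [Metric.ball_mem_nhds (0 : Fin n → ℝ) hδ] with a ha w hw
  by_contra hwO
  have h1 : r ≤ ‖w‖ := by
    by_contra hc
    apply hwO
    apply hrO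
    simpa using hc
  have h2 : r ^ 2 ≤ ∑ i, w i ^ 2 := by
    by_contra hc
    push Not at hc
    have : ‖w‖ < r := by
      rw [pi_norm_lt_iff hr]
      intro i
      rw [Real.norm_eq_abs]
      apply abs_lt_of_sq_lt_sq _ hr.le
      exact lt_of_le_of_lt (Finset.single_le_sum (f := fun i => w i ^ 2)
        (fun i _ => sq_nonneg (w i)) (Finset.mem_univ i)) hc
    linarith
  refine hth (Metric.mem_thickening_iff.2 ⟨PhiM Ψ w, ⟨xw w, ⟨xw_mem w, ?_⟩, rfl⟩, ?_⟩) hw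
  · show (DD w)⁻¹ ≤ (1 + r ^ 2)⁻¹
    apply inv_anti₀ (by positivity)
    unfold DD; linarith
  · simpa using ha

theorem Phi_bdd {n d : ℕ} (Ψ : Fin n → MvPolynomial (Option (Fin d)) ℝ) :
    ∃ R : ℝ, 0 ≤ R ∧ ∀ w, ‖PhiM Ψ w‖ ≤ R := by
  have hcont : Continuous fun x : Option (Fin d) → ℝ => fun l => eval x (Ψ l) :=
    continuous_pi fun l => MvPolynomial.continuous_eval (Ψ l)
  obtain ⟨R, hR⟩ := ((KK_compact d).image hcont).isBounded.exists_norm_le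
  exact ⟨|R|, abs_nonneg R, fun w => (hR _ ⟨xw w, xw_mem w, rfl⟩).trans (le_abs_self R)⟩

theorem DD_analytic {d : ℕ} (w : Fin d → ℝ) : AnalyticAt ℝ (fun w : Fin d → ℝ => (DD w)⁻¹) w := by
  have h0 : AnalyticAt ℝ (fun w : Fin d → ℝ => DD w) w := by
   have : (fun w : Fin d → ℝ => DD w) = fun w => eval w (1 + ∑ i, X i ^ 2) := by
    funext w; simp [DD]
   rw [this]
   exact analyticAt_eval _ _
  exact h0.inv (DD_ne w)

theorem evxw_analytic {d : ℕ} (κ : MvPolynomial (Option (Fin d)) ℝ) (w : Fin d → ℝ) :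
    AnalyticAt ℝ (fun w => eval (xw w) κ) w := by
  refine AnalyticAt.aeval_mvPolynomial (f := fun w => xw w) ?_ κ
  intro o
  rcases o with _ | i
  · exact DD_analytic w
  · exact (DD_analytic w).mul ((ContinuousLinearMap.proj (R := ℝ)
      (φ := fun _ : Fin d => ℝ) i).analyticAt w)

theorem Phi_analytic {n d : ℕ} (Ψ : Fin n → MvPolynomial (Option (Fin d)) ℝ) (w : Fin d → ℝ) :
    AnalyticAt ℝ (PhiM Ψ) w := by
  apply AnalyticAt.pi
  intro l
  exact evxw_analytic _ _

theorem DD_deriv {d : ℕ} : HasFDerivAt (fun w : Fin d → ℝ => (DD w)⁻¹)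
    (0 : (Fin d → ℝ) →L[ℝ] ℝ) 0 := by
  have h1 : HasFDerivAt (fun w : Fin d → ℝ => DD w) (0 : (Fin d → ℝ) →L[ℝ] ℝ) 0 := by
    have : (fun w : Fin d → ℝ => DD w) = fun w => eval w (1 + ∑ i, X i ^ 2) := by
      funext w; simp [DD]
    rw [this]
    refine (hasFDerivAt_eval _ _).congr_fderiv ?_
    apply Finset.sum_eq_zero
    intro i _
    have : eval (0 : Fin d → ℝ) (pderiv i (1 + ∑ j, X j ^ 2 : MvPolynomial (Fin d) ℝ)) = 0 := by
      simp
    rw [this, zero_smul]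
  exact ((hasDerivAt_inv (DD_ne (0 : Fin d → ℝ))).comp_hasFDerivAt 0 h1).congr_fderiv
    (smul_zero _)

theorem Phi_deriv {n d : ℕ} (Ψ : Fin n → MvPolynomial (Option (Fin d)) ℝ)
    (z : Fin n → ℝ) (E : (Fin d → ℝ) →L[ℝ] (Fin n → ℝ))
    (κ : Fin n → MvPolynomial (Option (Fin d)) ℝ)
    (h : ∀ x, (fun l => eval x (Ψ l)) = z + E (fun j => x (some j)) +
      (1 - x none) • (fun l => eval x (κ l))) :
    PhiM Ψ 0 = z ∧ HasFDerivAt (PhiM Ψ) E 0 := by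
  have h1 : PhiM Ψ = fun w => z + E ((DD w)⁻¹ • w) +
      (1 - (DD w)⁻¹) • (fun l => eval (xw w) (κ l)) := by
    funext w
    exact h (xw w)
  have hD0 : DD (0 : Fin d → ℝ) = 1 := by simp [DD]
  constructor
  · rw [h1]; simp [hD0]
  · rw [h1]
    have h2 : HasFDerivAt (fun w : Fin d → ℝ => (DD w)⁻¹ • w)
        (ContinuousLinearMap.id ℝ (Fin d → ℝ)) 0 := by
      have := (DD_deriv (d := d)).smul (hasFDerivAt_id (𝕜 := ℝ) (0 : Fin d → ℝ))
      refine this.congr_fderiv ?_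
      ext v
      simp [hD0]
    have h3 : HasFDerivAt (fun w : Fin d → ℝ => (1 - (DD w)⁻¹) • (fun l => eval (xw w) (κ l)))
        (0 : (Fin d → ℝ) →L[ℝ] (Fin n → ℝ)) 0 := by
      have h4 : HasFDerivAt (fun w : Fin d → ℝ => (1 - (DD w)⁻¹)) (0 : (Fin d → ℝ) →L[ℝ] ℝ) 0 := by
        have := (DD_deriv (d := d)).const_sub 1
        simpa using this
      have h5 := (Phi_analytic κ 0).differentiableAt.hasFDerivAt
      have := h4.smul h5
      refine this.congr_fderiv ?_
      simp [hD0]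
    have := ((E.hasFDerivAt.comp 0 h2).const_add z).add h3
    refine this.congr_fderiv ?_
    simp

theorem comp_poly {n d : ℕ} (Ψ : Fin n → MvPolynomial (Option (Fin d)) ℝ)
    (h : MvPolynomial (Fin n) ℝ) : ∃ (N : ℕ) (H : MvPolynomial (Fin d) (MvPolynomial (Fin n) ℝ)),
      ∀ a w, ev2 a w H = DD w ^ N * eval (PhiM Ψ w + a) h := by
  obtain ⟨N, H, hH⟩ := homog (σ := Option (Fin d) ⊕ Fin n) (A0 := ℝ)
    (S := MvPolynomial (Fin d) (MvPolynomial (Fin n) ℝ)) (1 + ∑ i, X i ^ 2)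
    (Sum.elim (fun o => o.elim 1 (fun i => X i)) (fun l => (1 + ∑ i, X i ^ 2) * C (X l)))
    (bind₁ (fun l => rename Sum.inl (Ψ l) + X (Sum.inr l)) h)
  refine ⟨N, H, fun a w => ?_⟩
  have hD : ev2 a w (1 + ∑ i, X i ^ 2) = DD w := by simp [ev2, DD]
  rw [← hH ℝ (ev2 a w) (Sum.elim (xw w) a), hD]
  · congr 1
    rw [Subsingleton.elim ((ev2 a w).comp _) (RingHom.id ℝ), ← coe_eval₂Hom]
    rw [eval₂Hom_bind₁, eval]
    congr 2
    funext l
    rw [map_add, coe_eval₂Hom, eval₂_rename, eval₂_X]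
    rfl
  · rw [hD]
    rintro ((_ | i) | l)
    · simp [xw, DD_ne]
    · simp only [Sum.elim_inl, xw, Option.elim]
      rw [← mul_assoc, mul_inv_cancel₀ (DD_ne w)]
      simp [ev2]
    · simp only [Sum.elim_inr, map_mul, hD]
      simp [ev2]

end RRJC

namespace RRJC
open MvPolynomial Topology Filter

theorem implicit {n d : ℕ} (Φ : (Fin d → ℝ) → (Fin n → ℝ)) (hΦ : AnalyticAt ℝ Φ 0)
    (E : (Fin d → ℝ) →L[ℝ] (Fin n → ℝ)) (hE : HasFDerivAt Φ E 0)
    (U : (Fin n → ℝ) → (Fin d → ℝ)) (hU : AnalyticAt ℝ U (Φ 0))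
    (Du : (Fin n → ℝ) →L[ℝ] (Fin d → ℝ)) (hDu : HasFDerivAt U Du (Φ 0)) (hU0 : U (Φ 0) = 0)
    (hinj : ∀ w, Du (E w) = 0 → w = 0) :
    ∃ ω : (Fin n → ℝ) → (Fin d → ℝ), AnalyticAt ℝ ω 0 ∧ ω 0 = 0 ∧
      (∀ᶠ a in 𝓝 0, U (Φ (ω a) + a) = 0) ∧
      ∃ O ∈ 𝓝 (0 : Fin d → ℝ), ∀ᶠ a in 𝓝 0, ∀ w ∈ O, U (Φ w + a) = 0 → w = ω a := by
  let M : (Fin n → ℝ) × (Fin d → ℝ) → (Fin n → ℝ) × (Fin d → ℝ) := fun q => (q.1, U (Φ q.2 + q.1))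
  have hM0 : M (0, 0) = (0, 0) := by simp [M, hU0]
  have hin : AnalyticAt ℝ (fun q : (Fin n → ℝ) × (Fin d → ℝ) => Φ q.2 + q.1) (0, 0) := by
    have h1 : AnalyticAt ℝ (fun q : (Fin n → ℝ) × (Fin d → ℝ) => Φ q.2) (0, 0) :=
      AnalyticAt.comp (g := Φ) (f := Prod.snd) (x := ((0, 0) : (Fin n → ℝ) × (Fin d → ℝ))) hΦ
        analyticAt_snd
    exact h1.add analyticAt_fst
  have hMa : AnalyticAt ℝ M (0, 0) := by
    apply AnalyticAt.prod analyticAt_fst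
    refine AnalyticAt.comp (g := U) ?_ hin
    simpa using hU
  let M' : (Fin n → ℝ) × (Fin d → ℝ) →L[ℝ] (Fin n → ℝ) × (Fin d → ℝ) :=
    (ContinuousLinearMap.fst ℝ (Fin n → ℝ) (Fin d → ℝ)).prod (Du.comp
      (E.comp (ContinuousLinearMap.snd ℝ (Fin n → ℝ) (Fin d → ℝ)) +
        ContinuousLinearMap.fst ℝ (Fin n → ℝ) (Fin d → ℝ)))
  have hM' : HasFDerivAt M M' (0, 0) := by
    apply HasFDerivAt.prodMk hasFDerivAt_fst
    refine HasFDerivAt.comp (g := U) _ ?_ ?_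
    · simpa using hDu
    · refine HasFDerivAt.add ?_ hasFDerivAt_fst
      exact HasFDerivAt.comp (g := Φ) (f := Prod.snd)
        ((0, 0) : (Fin n → ℝ) × (Fin d → ℝ)) hE hasFDerivAt_snd
  have hM'i : Function.Injective M'.toLinearMap := by
    rw [injective_iff_map_eq_zero]
    rintro ⟨a, w⟩ h
    have h1 : a = 0 := congrArg Prod.fst h
    have h2 : Du (E w + a) = 0 := congrArg Prod.snd h
    subst h1
    rw [add_zero] at h2
    rw [hinj w h2]
    rfl
  let e := (LinearEquiv.ofInjectiveEndo M'.toLinearMap hM'i).toContinuousLinearEquiv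
  have he : (e : (Fin n → ℝ) × (Fin d → ℝ) →L[ℝ] (Fin n → ℝ) × (Fin d → ℝ)) = M' :=
    ContinuousLinearMap.ext fun q => rfl
  obtain ⟨g, hga, hg0, hg1, hg2⟩ := local_inv M (0, 0) hMa e (by rw [he]; exact hM')
  rw [hM0] at hga hg0 hg1
  have hj : AnalyticAt ℝ (fun a : Fin n → ℝ => (a, (0 : Fin d → ℝ))) 0 :=
    analyticAt_id.prod analyticAt_const
  have hjc : Tendsto (fun a : Fin n → ℝ => (a, (0 : Fin d → ℝ))) (𝓝 0) (𝓝 (0, 0)) :=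
    hj.continuousAt
  refine ⟨fun a => (g (a, 0)).2, ?_, by simp only []; rw [hg0], ?_, ?_⟩
  · have : AnalyticAt ℝ (fun a => g (a, 0)) 0 := AnalyticAt.comp (g := g) hga hj
    exact AnalyticAt.comp (g := Prod.snd) analyticAt_snd this
  · filter_upwards [hjc.eventually hg1] with a ha
    have h1 : (g (a, 0)).1 = a := congrArg Prod.fst ha
    have h2 : U (Φ (g (a, 0)).2 + (g (a, 0)).1) = 0 := congrArg Prod.snd ha
    rwa [h1] at h2
  · rw [nhds_prod_eq] at hg2
    obtain ⟨pa, hpa, pb, hpb, h⟩ := Filter.eventually_prod_iff.1 hg2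
    refine ⟨{w | pb w}, hpb, ?_⟩
    filter_upwards [hpa] with a ha w hw hUw
    have := h ha hw
    simp only [M, hUw] at this
    rw [this]

/-- gradient -/
noncomputable def grad {n : ℕ} (h : MvPolynomial (Fin n) ℝ) (y : Fin n → ℝ) : Fin n → ℝ :=
  fun l => eval y (pderiv l h)

open Matrix in
theorem alg_T {n d : ℕ} (Z : Set (Fin n → ℝ)) (u : Fin d → MvPolynomial (Fin n) ℝ)
    (M : Matrix (Fin n) (Fin d) ℝ)
    (hmax : ∀ y ∈ Z, ∀ g ∈ vanishingIdeal ℝ Z, LinearIndependent ℝ (fun i => grad (u i) y) →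
      grad g y ∈ Submodule.span ℝ (Set.range fun i => grad (u i) y))
    (g : MvPolynomial (Fin n) ℝ) (hg : g ∈ vanishingIdeal ℝ Z) :
    ∃ T : Fin n → MvPolynomial (Fin n) ℝ, (∀ l, T l ∈ vanishingIdeal ℝ Z) ∧
      ∀ (y v : Fin n → ℝ), (∀ i, grad (u i) y ⬝ᵥ v = 0) →
        ((Matrix.of fun i => grad (u i) y) * M).det ^ 2 * (grad g y ⬝ᵥ v) =
        ∑ l, v l * eval y (T l) := by
  let A : Matrix (Fin d) (Fin n) (MvPolynomial (Fin n) ℝ) := Matrix.of fun i l => pderiv l (u i)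
  let Mp : Matrix (Fin n) (Fin d) (MvPolynomial (Fin n) ℝ) := M.map C
  let gp : Fin n → MvPolynomial (Fin n) ℝ := fun l => pderiv l g
  let T : Fin n → MvPolynomial (Fin n) ℝ :=
    (A * Mp).det • ((A * Mp).det • gp - gp ᵥ* (Mp * (A * Mp).adjugate * A))
  let Ay : (Fin n → ℝ) → Matrix (Fin d) (Fin n) ℝ := fun y => Matrix.of fun i => grad (u i) y
  have hA : ∀ y, A.map (eval y) = Ay y := fun y => rfl
  have hMp : ∀ y : Fin n → ℝ, Mp.map (eval y) = M := fun y => by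
    ext i j; simp [Mp]
  have hAM : ∀ y, (A * Mp).map (eval y) = Ay y * M := fun y => by
    rw [Matrix.map_mul, hA, hMp]
  have hdet : ∀ y, eval y (A * Mp).det = (Ay y * M).det := fun y => by
    rw [RingHom.map_det, ← hAM]; rfl
  have hadj : ∀ y, (A * Mp).adjugate.map (eval y) = (Ay y * M).adjugate := fun y => by
    have := RingHom.map_adjugate (eval y) (A * Mp)
    rw [← hAM]
    exact this
  have hT : ∀ y, (fun l => eval y (T l)) = (Ay y * M).det • ((Ay y * M).det • grad g y -
      grad g y ᵥ* (M * (Ay y * M).adjugate * Ay y)) := by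
    intro y
    funext l
    simp only [T, Pi.smul_apply, Pi.sub_apply, smul_eq_mul, map_mul, map_sub, hdet]
    have h1 := RingHom.map_vecMul (eval y) (Mp * (A * Mp).adjugate * A) gp l
    rw [h1, Matrix.map_mul, Matrix.map_mul, hadj, hMp, hA]
    rfl
  refine ⟨T, ?_, ?_⟩
  · intro l y hy
    have h1 := congrFun (hT y) l
    change eval y (T l) = 0
    change eval y (T l) = _ at h1
    rw [h1]
    by_cases hΔ : (Ay y * M).det = 0
    · rw [hΔ, zero_smul]; rfl
    have hli : LinearIndependent ℝ (fun i => grad (u i) y) := by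
      rw [Fintype.linearIndependent_iff]
      intro c hc
      have h2 : c ᵥ* (Ay y) = 0 := by
        rw [← hc]
        funext l
        simp [Matrix.vecMul, dotProduct, Ay]
      have h3 : c ᵥ* (Ay y * M) = 0 := by
        rw [← Matrix.vecMul_vecMul, h2, Matrix.zero_vecMul]
      exact fun i => congrFun (Matrix.eq_zero_of_vecMul_eq_zero hΔ h3) i
    obtain ⟨c, hc⟩ := (Submodule.mem_span_range_iff_exists_fun ℝ).1 (hmax y hy g hg hli)
    have h2 : grad g y = c ᵥ* (Ay y) := by
      rw [← hc]
      funext l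
      simp [Matrix.vecMul, dotProduct, Ay]
    have h3 : grad g y ᵥ* (M * (Ay y * M).adjugate * Ay y) = (Ay y * M).det • grad g y := by
      rw [h2, Matrix.vecMul_vecMul]
      have : Ay y * (M * (Ay y * M).adjugate * Ay y) = (Ay y * M).det • Ay y := by
        rw [← Matrix.mul_assoc, ← Matrix.mul_assoc, Matrix.mul_adjugate, Matrix.smul_mul,
          Matrix.one_mul]
      rw [this, Matrix.vecMul_smul]
    rw [h3, sub_self, smul_zero]
    rfl
  · intro y v hv
    have h1 : ∑ l, v l * eval y (T l) = (fun l => eval y (T l)) ⬝ᵥ v := by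
      simp only [dotProduct]
      exact Finset.sum_congr rfl fun l _ => mul_comm _ _
    have h2 : Ay y *ᵥ v = 0 := by
      funext i
      exact hv i
    rw [h1, hT, smul_dotProduct, sub_dotProduct, smul_dotProduct, ← Matrix.dotProduct_mulVec,
      ← Matrix.mulVec_mulVec, h2, Matrix.mulVec_zero, dotProduct_zero, sub_zero]
    simp only [smul_eq_mul, Ay]
    ring

open Matrix in
theorem curve {n d : ℕ} (Z : Set (Fin n → ℝ)) (u : Fin d → MvPolynomial (Fin n) ℝ)
    (M : Matrix (Fin n) (Fin d) ℝ)
    (hmax : ∀ y ∈ Z, ∀ g ∈ vanishingIdeal ℝ Z, LinearIndependent ℝ (fun i => grad (u i) y) →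
      grad g y ∈ Submodule.span ℝ (Set.range fun i => grad (u i) y))
    (γ γ' : ℝ → (Fin n → ℝ)) (hγ : ∀ t ∈ Set.Icc (0 : ℝ) 1, HasDerivAt γ (γ' t) t)
    (hγ' : ContinuousOn γ' (Set.Icc (0 : ℝ) 1)) (h0 : γ 0 ∈ Z)
    (hu : ∀ t ∈ Set.Icc (0 : ℝ) 1, ∀ i, grad (u i) (γ t) ⬝ᵥ γ' t = 0)
    (hΔ : ∀ t ∈ Set.Icc (0 : ℝ) 1, ((Matrix.of fun i => grad (u i) (γ t)) * M).det ≠ 0)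
    (b : MvPolynomial (Fin n) ℝ) (hb : b ∈ vanishingIdeal ℝ Z) : eval (γ 1) b = 0 := by
  obtain ⟨r, gs, hgs⟩ := Submodule.fg_iff_exists_fin_generating_family.1
    (IsNoetherian.noetherian (vanishingIdeal ℝ Z))
  have hmem : ∀ i, gs i ∈ vanishingIdeal ℝ Z := fun i => by
    rw [← hgs]; exact Submodule.subset_span ⟨i, rfl⟩
  have hT := fun i => alg_T Z u M hmax (gs i) (hmem i)
  choose T hT1 hT2 using hT
  have hcomb : ∀ i l, ∃ c : Fin r → MvPolynomial (Fin n) ℝ, ∑ j, c j • gs j = T i l := fun i l => by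
    apply (Submodule.mem_span_range_iff_exists_fun _).1
    rw [hgs]; exact hT1 i l
  choose c hc using hcomb
  have hγc : ContinuousOn γ (Set.Icc (0 : ℝ) 1) := fun t ht =>
    (hγ t ht).continuousAt.continuousWithinAt
  have hec : ∀ p : MvPolynomial (Fin n) ℝ, ContinuousOn (fun t => eval (γ t) p)
      (Set.Icc (0 : ℝ) 1) := fun p => (continuous_eval' p).comp_continuousOn hγc
  let Δ : ℝ → ℝ := fun t => ((Matrix.of fun i => grad (u i) (γ t)) * M).det
  have hΔc : ContinuousOn Δ (Set.Icc (0 : ℝ) 1) := by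
    have h1 : ContinuousOn (fun t => ((Matrix.of fun i => grad (u i) (γ t)) * M))
        (Set.Icc (0 : ℝ) 1) := by
      apply continuousOn_pi.2
      intro i
      apply continuousOn_pi.2
      intro j
      simp only [Matrix.mul_apply]
      apply continuousOn_finsetSum
      intro l _
      exact (hec _).mul continuousOn_const
    exact (Continuous.matrix_det continuous_id).comp_continuousOn h1
  let Am : ℝ → Fin r → Fin r → ℝ := fun t i j =>
    (Δ t ^ 2)⁻¹ * ∑ l, γ' t l * eval (γ t) (c i l j)
  have hAm : ∀ i j, ContinuousOn (fun t => Am t i j) (Set.Icc (0 : ℝ) 1) := by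
    intro i j
    apply ContinuousOn.mul
    · exact (hΔc.pow 2).inv₀ fun t ht => pow_ne_zero 2 (hΔ t ht)
    · apply continuousOn_finsetSum
      intro l _
      exact ((continuous_apply l).comp_continuousOn hγ').mul (hec _)
  let f : ℝ → Fin r → ℝ := fun t i => eval (γ t) (gs i)
  let f' : ℝ → Fin r → ℝ := fun t i => grad (gs i) (γ t) ⬝ᵥ γ' t
  have hder : ∀ (p : MvPolynomial (Fin n) ℝ), ∀ t ∈ Set.Icc (0 : ℝ) 1,
      HasDerivAt (fun t => eval (γ t) p) (grad p (γ t) ⬝ᵥ γ' t) t := by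
    intro p t ht
    have := (hasFDerivAt_eval p (γ t)).comp_hasDerivAt t (hγ t ht)
    refine this.congr_deriv ?_
    simp [dotProduct, grad]
  have hff' : ∀ t ∈ Set.Icc (0 : ℝ) 1, HasDerivAt f (f' t) t := fun t ht =>
    hasDerivAt_pi.2 fun i => hder _ t ht
  have hf'A : ∀ t ∈ Set.Icc (0 : ℝ) 1, ∀ i, f' t i = ∑ j, Am t i j * f t j := by
    intro t ht i
    have h1 := hT2 i (γ t) (γ' t) (hu t ht)
    have h2 : Δ t ^ 2 ≠ 0 := pow_ne_zero 2 (hΔ t ht)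
    have h3 : f' t i = (Δ t ^ 2)⁻¹ * ∑ l, γ' t l * eval (γ t) (T i l) := by
      rw [← h1]
      change _ = (Δ t ^ 2)⁻¹ * (Δ t ^ 2 * f' t i)
      rw [← mul_assoc, inv_mul_cancel₀ h2, one_mul]
    rw [h3]
    simp only [Am, f, ← hc, map_sum, smul_eq_mul, map_mul, Finset.mul_sum, Finset.sum_mul]
    rw [Finset.sum_comm]
    refine Finset.sum_congr rfl fun j _ => Finset.sum_congr rfl fun l _ => by ring
  have hK : ∃ K : ℝ, ∀ t ∈ Set.Icc (0 : ℝ) 1, ∑ i, ∑ j, |Am t i j| ≤ K := by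
    have : ContinuousOn (fun t => ∑ i, ∑ j, |Am t i j|) (Set.Icc (0 : ℝ) 1) := by
      apply continuousOn_finsetSum
      intro i _
      apply continuousOn_finsetSum
      intro j _
      exact (hAm i j).abs
    obtain ⟨K, hK⟩ := (isCompact_Icc.image_of_continuousOn this).bddAbove
    exact ⟨K, fun t ht => hK ⟨t, ht, rfl⟩⟩
  obtain ⟨K, hK⟩ := hK
  have hzero : ∀ t ∈ Set.Icc (0 : ℝ) 1, f t = 0 := by
    apply eq_zero_of_abs_deriv_le_mul_abs_self_of_eq_zero_right (f' := f') (K := K)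
    · exact fun t ht => (hff' t ht).continuousAt.continuousWithinAt
    · exact fun t ht => (hff' t (Set.Ico_subset_Icc_self ht)).hasDerivWithinAt
    · funext i
      exact hmem i _ h0
    · intro t ht
      have ht := Set.Ico_subset_Icc_self ht
      have hK0 : 0 ≤ K := le_trans (Finset.sum_nonneg fun i _ => Finset.sum_nonneg
        fun j _ => abs_nonneg _) (hK t ht)
      rw [pi_norm_le_iff_of_nonneg (by positivity)]
      intro i
      rw [hf'A t ht i, Real.norm_eq_abs]
      calc |∑ j, Am t i j * f t j| ≤ ∑ j, |Am t i j * f t j| := Finset.abs_sum_le_sum_abs _ _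
        _ ≤ ∑ j, |Am t i j| * ‖f t‖ := by
          apply Finset.sum_le_sum
          intro j _
          rw [abs_mul]
          exact mul_le_mul_of_nonneg_left (norm_le_pi_norm (f t) j) (abs_nonneg _)
        _ = (∑ j, |Am t i j|) * ‖f t‖ := by rw [Finset.sum_mul]
        _ ≤ K * ‖f t‖ := by
          apply mul_le_mul_of_nonneg_right _ (norm_nonneg _)
          exact (Finset.single_le_sum (f := fun i => ∑ j, |Am t i j|) (fun i _ =>
            Finset.sum_nonneg fun j _ => abs_nonneg _) (Finset.mem_univ i)).trans (hK t ht)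
  rw [← hgs] at hb
  obtain ⟨cb, hcb⟩ := (Submodule.mem_span_range_iff_exists_fun _).1 hb
  rw [← hcb, map_sum]
  apply Finset.sum_eq_zero
  intro j _
  have : eval (γ 1) (gs j) = 0 := congrFun (hzero 1 (by simp)) j
  rw [smul_eq_mul, map_mul, this, mul_zero]

end RRJC

namespace RRJC
open MvPolynomial Topology Filter

theorem ev2_deriv {n d : ℕ} (a : Fin n → ℝ) (H : MvPolynomial (Fin d) (MvPolynomial (Fin n) ℝ))
    (w : Fin d → ℝ) : HasFDerivAt (fun w => ev2 a w H)
      (∑ j, ev2 a w (pderiv j H) •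
        ContinuousLinearMap.proj (R := ℝ) (φ := fun _ : Fin d => ℝ) j) w := by
  have h : ∀ (w : Fin d → ℝ) K, ev2 a w K = eval w (map (eval a) K) := by
    intro w K
    rw [eval_map]
    rfl
  simp only [h]
  refine (hasFDerivAt_eval _ _).congr_fderiv ?_
  simp only [pderiv_map]

theorem jac_eq {n d : ℕ} (Ψ : Fin n → MvPolynomial (Option (Fin d)) ℝ)
    (E : (Fin d → ℝ) →L[ℝ] (Fin n → ℝ)) (hE : HasFDerivAt (PhiM Ψ) E 0)
    (u : MvPolynomial (Fin n) ℝ) (hu : eval (PhiM Ψ 0) u = 0) (N : ℕ)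
    (H : MvPolynomial (Fin d) (MvPolynomial (Fin n) ℝ))
    (hH : ∀ a w, ev2 a w H = DD w ^ N * eval (PhiM Ψ w + a) u) (j : Fin d) :
    ev2 0 0 (pderiv j H) = grad u (PhiM Ψ 0) ⬝ᵥ E (Pi.single j 1) := by
  have h1 := ev2_deriv (0 : Fin n → ℝ) H 0
  have h2 : (fun w => ev2 (0 : Fin n → ℝ) w H) = fun w => DD w ^ N * eval (PhiM Ψ w) u := by
    funext w
    rw [hH, add_zero]
  have h3 : DifferentiableAt ℝ (fun w : Fin d → ℝ => DD w ^ N) 0 := by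
    unfold DD; fun_prop
  have h4 := h3.hasFDerivAt.mul ((hasFDerivAt_eval u (PhiM Ψ 0)).comp 0 hE)
  rw [h2] at h1
  have h5 := h1.unique h4
  have h6 := congrArg (fun L : (Fin d → ℝ) →L[ℝ] ℝ => L (Pi.single j 1)) h5
  have hD0 : DD (0 : Fin d → ℝ) = 1 := by simp [DD]
  simp [hD0, hu, Pi.single_apply] at h6
  rw [h6]
  simp [dotProduct, grad]

theorem exists_max {n : ℕ} (Z : Set (Fin n → ℝ)) (hne : Z.Nonempty) :
    ∃ d : ℕ, ∃ z ∈ Z, ∃ u : Fin d → MvPolynomial (Fin n) ℝ,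
      (∀ i, u i ∈ vanishingIdeal ℝ Z) ∧ LinearIndependent ℝ (fun i => grad (u i) z) ∧
      ∀ y ∈ Z, ∀ g ∈ vanishingIdeal ℝ Z, LinearIndependent ℝ (fun i => grad (u i) y) →
      grad g y ∈ Submodule.span ℝ (Set.range fun i => grad (u i) y) := by
  classical
  let Q : ℕ → Prop := fun d => ∃ z ∈ Z, ∃ u : Fin d → MvPolynomial (Fin n) ℝ,
      (∀ i, u i ∈ vanishingIdeal ℝ Z) ∧ LinearIndependent ℝ (fun i => grad (u i) z)
  have hQ0 : Q 0 := by
    obtain ⟨z, hz⟩ := hne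
    exact ⟨z, hz, Fin.elim0, fun i => i.elim0, linearIndependent_empty_type⟩
  have hQn : ∀ d, Q d → d ≤ n := by
    rintro d ⟨z, hz, u, hu, hli⟩
    simpa using hli.fintype_card_le_finrank
  have hQ := Nat.findGreatest_spec (P := Q) (Nat.zero_le n) hQ0
  set d := Nat.findGreatest Q n with hd
  obtain ⟨z, hz, u, hu, hli⟩ := hQ
  refine ⟨d, z, hz, u, hu, hli, ?_⟩
  intro y hy g hg hliy
  by_contra hc
  have hQd : Q (d + 1) := by
    refine ⟨y, hy, Fin.cons g u, ?_, ?_⟩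
    · intro i
      refine Fin.cases hg (fun i => hu i) i
    · have : (fun i => grad ((Fin.cons g u : Fin (d + 1) → MvPolynomial (Fin n) ℝ) i) y) =
          Fin.cons (grad g y) (fun i => grad (u i) y) := by
        funext i
        refine Fin.cases rfl (fun i => rfl) i
      rw [this, linearIndependent_finCons]
      exact ⟨hliy, hc⟩
  have := Nat.le_findGreatest (hQn _ hQd) hQd
  omega

theorem zeta_zero {n d : ℕ} (Z : Set (Fin n → ℝ)) (u : Fin d → MvPolynomial (Fin n) ℝ)
    (M : Matrix (Fin n) (Fin d) ℝ)
    (hmax : ∀ y ∈ Z, ∀ g ∈ vanishingIdeal ℝ Z, LinearIndependent ℝ (fun i => grad (u i) y) →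
      grad g y ∈ Submodule.span ℝ (Set.range fun i => grad (u i) y))
    (ζ : (Fin n → ℝ) → (Fin n → ℝ)) (hζ : AnalyticAt ℝ ζ 0) (hζ0 : ζ 0 ∈ Z)
    (hu : ∀ᶠ a in 𝓝 0, ∀ i, eval (ζ a) (u i) = 0)
    (hΔ : ((Matrix.of fun i => grad (u i) (ζ 0)) * M).det ≠ 0)
    (b : MvPolynomial (Fin n) ℝ) (hb : b ∈ vanishingIdeal ℝ Z) :
    ∀ᶠ a in 𝓝 0, eval (ζ a) b = 0 := by
  have hΔc : ContinuousAt (fun a => ((Matrix.of fun i => grad (u i) (ζ a)) * M).det) 0 := by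
    have h1 : Continuous (fun y => ((Matrix.of fun i => grad (u i) y) * M).det) := by
      apply Continuous.matrix_det
      apply Continuous.matrix_mul _ continuous_const
      apply continuous_pi
      intro i
      apply continuous_pi
      intro l
      exact continuous_eval' _
    exact h1.continuousAt.comp (f := ζ) hζ.continuousAt
  obtain ⟨r, hr, hball⟩ := Metric.eventually_nhds_iff_ball.1
    ((hu.and hζ.eventually_analyticAt).and (hΔc.eventually_ne hΔ))
  rw [Metric.eventually_nhds_iff_ball]
  refine ⟨r, hr, fun a ha => ?_⟩
  have hta : ∀ t ∈ Set.Icc (0 : ℝ) 1, t • a ∈ Metric.ball (0 : Fin n → ℝ) r := by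
    intro t ht
    rw [mem_ball_zero_iff] at ha ⊢
    rw [norm_smul, Real.norm_eq_abs, abs_of_nonneg ht.1]
    nlinarith [ht.1, ht.2, norm_nonneg a]
  have hγ : ∀ t ∈ Set.Icc (0 : ℝ) 1, HasDerivAt (fun t : ℝ => ζ (t • a)) (fderiv ℝ ζ (t • a) a) t := by
    intro t ht
    have h1 := (hball _ (hta t ht)).1.2.differentiableAt.hasFDerivAt
    have h2 : HasDerivAt (fun t : ℝ => t • a) a t := by
      simpa using (hasDerivAt_id t).smul_const a
    exact h1.comp_hasDerivAt t h2
  have := curve Z u M hmax (fun t => ζ (t • a)) (fun t => fderiv ℝ ζ (t • a) a) hγ ?_ ?_ ?_ ?_ b hb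
  · simpa using this
  · intro t ht
    apply ContinuousAt.continuousWithinAt
    have h1 : ContinuousAt (fderiv ℝ ζ) (t • a) := (hball _ (hta t ht)).1.2.fderiv.continuousAt
    have h2 : ContinuousAt (fun t : ℝ => fderiv ℝ ζ (t • a)) t :=
      ContinuousAt.comp (g := fderiv ℝ ζ) (f := fun t : ℝ => t • a) h1 (by fun_prop)
    exact h2.clm_apply continuousAt_const
  · simpa using hζ0
  · intro t ht i
    have h1 := (hasFDerivAt_eval (u i) (ζ (t • a))).comp_hasDerivAt t (hγ t ht)
    have h2 : HasDerivAt (fun t : ℝ => eval (ζ (t • a)) (u i)) 0 t := by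
      apply (hasDerivAt_const t (0 : ℝ)).congr_of_eventuallyEq
      have h3 : ContinuousAt (fun t : ℝ => t • a) t := by fun_prop
      filter_upwards [h3.preimage_mem_nhds (Metric.isOpen_ball.mem_nhds (hta t ht))] with s hs
      exact (hball _ hs).1.1 i
    have h3 := h1.unique h2
    rw [← h3]
    simp [dotProduct, grad]
  · intro t ht
    exact (hball _ (hta t ht)).2

open Matrix in
theorem gram {n d : ℕ} (A : Matrix (Fin d) (Fin n) ℝ) (h : LinearIndependent ℝ (fun i => A i)) :
    (A * Aᵀ).det ≠ 0 := by
  intro h0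
  obtain ⟨v, hv, hv0⟩ := Matrix.exists_mulVec_eq_zero_iff.2 h0
  have h1 : Aᵀ *ᵥ v = 0 := by
    have : (Aᵀ *ᵥ v) ⬝ᵥ (Aᵀ *ᵥ v) = 0 := by
      rw [Matrix.dotProduct_mulVec, Matrix.vecMul_transpose, Matrix.mulVec_mulVec, hv0,
        zero_dotProduct]
    exact dotProduct_self_eq_zero.1 this
  apply hv
  rw [Fintype.linearIndependent_iff] at h
  funext i
  refine h v ?_ i
  rw [← h1]
  funext l
  simp [Matrix.mulVec, dotProduct, mul_comm]

end RRJC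

namespace RRJC
open MvPolynomial Topology Filter

open Matrix in
theorem theoremT {n : ℕ} (b : MvPolynomial (Fin n) ℝ) (F G : (Fin n → ℝ) → (Fin n → ℝ))
    (hFc : Continuous F) (hFb : ∀ x, eval (F x) b ≠ 0)
    (hG : ContinuousOn G {y | eval y b ≠ 0}) (hFG : ∀ y, eval y b ≠ 0 → F (G y) = y) :
    ∀ y, eval y b ≠ 0 := by
  by_contra hcon
  push Not at hcon
  obtain ⟨z0, hz0⟩ := hcon
  have hb0 : b ≠ 0 := by
    rintro rfl
    exact hFb 0 (by simp)
  let Z : Set (Fin n → ℝ) := {y | eval y b = 0}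
  have hZc : IsClosed Z := isClosed_eq (continuous_eval' b) continuous_const
  have hbI : b ∈ vanishingIdeal ℝ Z := fun y hy => hy
  obtain ⟨d, z, hz, u, hu, hli, hmax⟩ := exists_max Z ⟨z0, hz0⟩
  let A : Matrix (Fin d) (Fin n) ℝ := Matrix.of fun i => grad (u i) z
  have hdetA := gram A hli
  let U : (Fin n → ℝ) → (Fin d → ℝ) := fun y i => eval y (u i)
  let Du : (Fin n → ℝ) →L[ℝ] (Fin d → ℝ) := A.mulVecLin.toContinuousLinearMap
  let E : (Fin d → ℝ) →L[ℝ] (Fin n → ℝ) := Aᵀ.mulVecLin.toContinuousLinearMap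
  let J : (Fin d → ℝ) →L[ℝ] (Fin d → ℝ) := (A * Aᵀ)⁻¹.mulVecLin.toContinuousLinearMap
  have hDu : ∀ v, Du v = A *ᵥ v := fun v => rfl
  have hEv : ∀ v, E v = Aᵀ *ᵥ v := fun v => rfl
  have hJv : ∀ v, J v = (A * Aᵀ)⁻¹ *ᵥ v := fun v => rfl
  have hU : HasFDerivAt U Du z := by
    rw [hasFDerivAt_pi']
    intro i
    refine (hasFDerivAt_eval (u i) z).congr_fderiv ?_
    ext1 v
    simp [Du, A, Matrix.mulVec, dotProduct, grad]
  have hJ : ∀ p, J (Du (E p)) = p := by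
    intro p
    rw [hJv, hDu, hEv, Matrix.mulVec_mulVec, Matrix.mulVec_mulVec, Matrix.mul_assoc,
      Matrix.nonsing_inv_mul _ (isUnit_iff_ne_zero.2 hdetA), Matrix.one_mulVec]
  have hUZ : ∀ y ∈ Z, U y = 0 := fun y hy => funext fun i => hu i y hy
  obtain ⟨ε, hε, κ, hκ⟩ := phi_exists {y | eval y b ≠ 0} hZc.isOpen_compl F G hFc hFb hG hFG U z
    (fun hc => hc hz) (fun y hy => hUZ y (not_not.1 hy)) Du hU E J hJ
  let Ψ : Fin n → MvPolynomial (Option (Fin d)) ℝ := fun l =>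
    C (z l) + ∑ j, C (ε * A j l) * X (some j) + (1 - X none) * κ l
  have hΨ : ∀ x, (fun l => eval x (Ψ l)) = z + (ε • E) (fun j => x (some j)) +
      (1 - x none) • (fun l => eval x (κ l)) := by
    intro x
    funext l
    simp [Ψ, hEv, Matrix.mulVec, dotProduct, Finset.mul_sum, mul_assoc]
  obtain ⟨hΦ0, hΦd⟩ := Phi_deriv Ψ z (ε • E) κ hΨ
  have hKZ : ∀ x ∈ KK d, (fun l => eval x (Ψ l)) ∈ Z → x = x1 d := by
    intro x hx hxZ
    refine hκ x hx ?_
    rw [hΨ] at hxZ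
    exact fun hc => hc hxZ
  have hUa : AnalyticAt ℝ U (PhiM Ψ 0) := AnalyticAt.pi fun i => analyticAt_eval (u i) _
  obtain ⟨ω, hωa, hω0, hωU, O, hO, hωO⟩ := implicit (PhiM Ψ) (Phi_analytic Ψ 0) (ε • E) hΦd U hUa
    Du (by rw [hΦ0]; exact hU) (by rw [hΦ0]; exact hUZ z hz) (by
      intro w hw
      have h1 : ε • Du (E w) = 0 := by rw [← hw]; simp
      have h2 : Du (E w) = 0 := (smul_eq_zero.1 h1).resolve_left hε.ne'
      rw [← hJ w, h2, map_zero])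
  have hζa : AnalyticAt ℝ (fun a => PhiM Ψ (ω a) + a) 0 := by
    refine AnalyticAt.add ?_ analyticAt_id
    exact AnalyticAt.comp (g := PhiM Ψ) (Phi_analytic Ψ _) hωa
  have hζb : ∀ᶠ a in 𝓝 0, eval (PhiM Ψ (ω a) + a) b = 0 := by
    apply zeta_zero Z u Aᵀ hmax (fun a => PhiM Ψ (ω a) + a) hζa _ _ _ b hbI
    · simp only [hω0, hΦ0, add_zero]; exact hz
    · filter_upwards [hωU] with a ha i
      exact congrFun ha i
    · simp only [hω0, hΦ0, add_zero]; exact hdetA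
  have hcp := fun i => comp_poly Ψ (u i)
  choose N Ei hEi using hcp
  obtain ⟨Nb, Hb, hHb⟩ := comp_poly Ψ b
  obtain ⟨R, hR, hΦR⟩ := Phi_bdd Ψ
  refine T5app Ei Hb ω hωa ?_ ?_ ?_ ?_ ?_
  · intro i
    filter_upwards [hωU] with a ha
    rw [hEi]
    have : eval (PhiM Ψ (ω a) + a) (u i) = 0 := congrFun ha i
    rw [this, mul_zero]
  · filter_upwards [hζb] with a ha
    rw [hHb, ha, mul_zero]
  · have : (Matrix.of fun i j => ev2 0 (ω 0) (pderiv j (Ei i))) = ε • (A * Aᵀ) := by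
      ext i j
      rw [hω0]
      simp only [Matrix.of_apply]
      rw [jac_eq Ψ (ε • E) hΦd (u i) (by rw [hΦ0]; exact hu i z hz) (N i) (Ei i) (hEi i) j, hΦ0]
      simp [hEv, Matrix.mul_apply, dotProduct, A, Finset.mul_sum]
      exact Finset.sum_congr rfl fun l _ => by ring
    rw [this, Matrix.det_smul]
    exact mul_ne_zero (pow_ne_zero _ hε.ne') hdetA
  · filter_upwards [Phi_compact Ψ Z hZc hKZ O hO, hωO] with a h1 h2 w hw hwb
    have h3 : ∀ (N : ℕ) (t : ℝ), DD w ^ N * t = 0 → t = 0 := fun N t h =>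
      (mul_eq_zero.1 h).resolve_left (pow_ne_zero _ (DD_ne w))
    refine h2 w (h1 w ?_) ?_
    · rw [hHb] at hwb
      exact h3 _ _ hwb
    · funext i
      have := hw i
      rw [hEi] at this
      exact h3 _ _ this
  · intro f hf
    obtain ⟨a, ha⟩ := far (f * b) (mul_ne_zero hf hb0) R hR
    refine ⟨a, ?_, ?_⟩
    · have := ha 0 (by simpa using hR)
      rw [zero_add, map_mul] at this
      exact left_ne_zero_of_mul this
    · intro w
      have := ha _ (hΦR w)
      rw [map_mul] at this
      rw [hHb]
      exact mul_ne_zero (pow_ne_zero _ (DD_ne w)) (right_ne_zero_of_mul this)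

end RRJC

namespace RRJC
open MvPolynomial Topology Filter

theorem uni_bigO (k : ℕ) : ∀ Q : Polynomial ℝ,
    (fun t : ℝ => Q.eval t) =O[𝓝[≠] 0] (fun t : ℝ => t ^ k) → ∀ j < k, Q.coeff j = 0 := by
  induction k with
  | zero => intro Q _ j hj; omega
  | succ k ih =>
    intro Q hQ
    have h0 : Q.coeff 0 = 0 := by
      have h1 : Tendsto (fun t : ℝ => Q.eval t) (𝓝[≠] 0) (𝓝 0) := by
        apply hQ.trans_tendsto
        have : ContinuousAt (fun t : ℝ => t ^ (k + 1)) 0 := by fun_prop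
        have h2 := this.tendsto.mono_left (nhdsWithin_le_nhds (s := {0}ᶜ))
        simpa using h2
      have h2 : Tendsto (fun t : ℝ => Q.eval t) (𝓝[≠] 0) (𝓝 (Q.eval 0)) :=
        Q.continuous.continuousAt.tendsto.mono_left nhdsWithin_le_nhds
      rw [Polynomial.coeff_zero_eq_eval_zero]
      exact tendsto_nhds_unique h2 h1
    have hX : Q = Q.divX * Polynomial.X := by
      conv_lhs => rw [← Polynomial.divX_mul_X_add Q, h0]
      simp
    have h3 := ih Q.divX (by
      obtain ⟨c, hc⟩ := hQ.bound
      apply Asymptotics.IsBigO.of_bound c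
      filter_upwards [hc, self_mem_nhdsWithin] with t ht ht0
      have ht0 : 0 < |t| := abs_pos.2 ht0
      rw [hX] at ht
      simp only [Polynomial.eval_mul, Polynomial.eval_X, norm_mul, Real.norm_eq_abs, pow_succ]
        at ht
      rw [Real.norm_eq_abs, Real.norm_eq_abs]
      rw [← mul_assoc] at ht
      exact le_of_mul_le_mul_right ht ht0)
    intro j hj
    rcases j with _ | j
    · exact h0
    · rw [← Polynomial.coeff_divX]
      exact h3 j (by omega)

theorem multi_bigO {n : ℕ} (e : MvPolynomial (Fin n) ℝ) (k : ℕ)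
    (he : (fun v : Fin n → ℝ => eval v e) =O[𝓝 0] (fun v => ‖v‖ ^ k)) :
    e ∈ idealOfVars (Fin n) ℝ ^ k := by
  rw [mem_pow_idealOfVars_iff']
  intro m hm
  have hz : homogeneousComponent m.degree e = 0 := by
    apply MvPolynomial.funext
    intro v
    let Q : Polynomial ℝ := ∑ j ∈ Finset.range (e.totalDegree + 1),
      Polynomial.C (eval v (homogeneousComponent j e)) * Polynomial.X ^ j
    have hQe : ∀ t, Q.eval t = eval (t • v) e := by
      intro t
      conv_rhs => rw [← sum_homogeneousComponent e]
      rw [map_sum, Polynomial.eval_finset_sum]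
      apply Finset.sum_congr rfl
      intro j _
      rw [homog_smul (homogeneousComponent_isHomogeneous j e)]
      rw [Polynomial.eval_mul, Polynomial.eval_C, Polynomial.eval_pow, Polynomial.eval_X, mul_comm]
    have hb := uni_bigO k Q (by
      have h1 : Tendsto (fun t : ℝ => t • v) (𝓝[≠] 0) (𝓝 0) := by
        have : ContinuousAt (fun t : ℝ => t • v) 0 := by fun_prop
        have h2 := this.tendsto.mono_left (nhdsWithin_le_nhds (s := {0}ᶜ))
        simpa using h2
      have h2 := he.comp_tendsto h1
      simp only [hQe]
      refine h2.trans ?_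
      apply Asymptotics.IsBigO.of_bound (‖v‖ ^ k)
      filter_upwards with t
      simp [norm_smul, mul_pow, mul_comm]) _ hm
    simp only [Q, Polynomial.finset_sum_coeff, Polynomial.coeff_C_mul_X_pow] at hb
    rw [map_zero]
    by_cases hd : m.degree < e.totalDegree + 1
    · rw [Finset.sum_ite_eq, if_pos (Finset.mem_range.2 hd)] at hb
      exact hb
    · rw [homogeneousComponent_eq_zero _ _ (by omega), map_zero]
  have := congrArg (coeff m) hz
  rw [coeff_homogeneousComponent, if_pos rfl] at this
  simpa using this

theorem partialSum_poly {n : ℕ} (p : FormalMultilinearSeries ℝ (Fin n → ℝ) ℝ) (k : ℕ) :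
    ∃ c : MvPolynomial (Fin n) ℝ, ∀ v, eval v c = p.partialSum k v := by
  refine ⟨∑ j ∈ Finset.range k, ∑ r : Fin j → Fin n, (∏ i, X (r i)) *
    C (p j (fun i => Pi.single (r i) 1)), fun v => ?_⟩
  rw [FormalMultilinearSeries.partialSum, map_sum]
  apply Finset.sum_congr rfl
  intro j _
  have hv : (fun _ : Fin j => v) = fun _ => ∑ l, v l • (Pi.single l 1 : Fin n → ℝ) := by
    funext _
    exact pi_eq_sum_univ' v
  rw [hv]
  have h1 := (p j).toMultilinearMap.map_sum
    (fun (_ : Fin j) (l : Fin n) => v l • (Pi.single l 1 : Fin n → ℝ))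
  have h2 : ∀ r : Fin j → Fin n, (p j).toMultilinearMap
      (fun i => v (r i) • (Pi.single (r i) 1 : Fin n → ℝ)) =
      (∏ i, v (r i)) • (p j) (fun i => Pi.single (r i) 1) := fun r =>
    (p j).toMultilinearMap.map_smul_univ (fun i => v (r i)) _
  refine Eq.trans ?_ h1.symm
  rw [map_sum]
  apply Finset.sum_congr rfl
  intro r _
  rw [h2]
  simp

theorem AN0 {n : ℕ} (a b : MvPolynomial (Fin n) ℝ) (c : (Fin n → ℝ) → ℝ) (hc : AnalyticAt ℝ c 0)
    (h : ∀ᶠ y in 𝓝 0, eval y a = c y * eval y b) :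
    ∃ s : MvPolynomial (Fin n) ℝ, eval 0 s = 0 ∧ b ∣ (1 - s) * a := by
  obtain ⟨p, hp⟩ := hc
  let M := MvPolynomial (Fin n) ℝ ⧸ Ideal.span {b}
  have hk : ∀ k : ℕ, ∃ ck, a - b * ck ∈ idealOfVars (Fin n) ℝ ^ k := by
    intro k
    obtain ⟨ck, hck⟩ := partialSum_poly p k
    refine ⟨ck, multi_bigO _ k ?_⟩
    have h1 := hp.isBigO_sub_partialSum_pow k
    simp only [zero_add] at h1
    have h2 : (fun v : Fin n → ℝ => eval v b) =O[𝓝 0] (fun _ => (1 : ℝ)) :=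
      (continuous_eval' b).continuousAt.tendsto.isBigO_one ℝ
    have h3 := h2.mul h1
    simp only [one_mul] at h3
    refine h3.congr' ?_ (EventuallyEq.refl _ _)
    filter_upwards [h] with y hy
    rw [map_sub, map_mul, hck, hy]
    ring
  have hmem : (Ideal.Quotient.mk (Ideal.span {b}) a : M) ∈
      (⨅ i : ℕ, idealOfVars (Fin n) ℝ ^ i • ⊤ : Submodule (MvPolynomial (Fin n) ℝ) M) := by
    rw [Submodule.mem_iInf]
    intro k
    obtain ⟨ck, hck⟩ := hk k
    have h1 : (Ideal.Quotient.mk (Ideal.span {b}) a : M) =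
        (a - b * ck) • (1 : M) := by
      change _ = Ideal.Quotient.mk (Ideal.span {b}) ((a - b * ck) * 1)
      rw [mul_one, Ideal.Quotient.eq, Ideal.mem_span_singleton]
      exact ⟨ck, by ring⟩
    rw [h1]
    exact Submodule.smul_mem_smul hck trivial
  rw [Ideal.mem_iInf_smul_pow_eq_bot_iff] at hmem
  obtain ⟨⟨s, hs⟩, hsa⟩ := hmem
  refine ⟨s, ?_, ?_⟩
  · have : idealOfVars (Fin n) ℝ ≤ RingHom.ker (eval (0 : Fin n → ℝ)) := by
      rw [idealOfVars, Ideal.span_le]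
      rintro _ ⟨i, rfl⟩
      simp
    exact this hs
  · rw [← Ideal.mem_span_singleton, ← Ideal.Quotient.eq_zero_iff_mem]
    change Ideal.Quotient.mk (Ideal.span {b}) (s * a) = _ at hsa
    rw [sub_mul, one_mul, map_sub, hsa]
    exact sub_self _

theorem AN {n : ℕ} (a b : MvPolynomial (Fin n) ℝ) (hab : IsRelPrime a b)
    (c : (Fin n → ℝ) → ℝ) (y0 : Fin n → ℝ) (hc : AnalyticAt ℝ c y0)
    (h : ∀ᶠ y in 𝓝 y0, eval y a = c y * eval y b) : eval y0 b ≠ 0 := by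
  let τ : (Fin n → ℝ) → (MvPolynomial (Fin n) ℝ →ₐ[ℝ] MvPolynomial (Fin n) ℝ) := fun v =>
    bind₁ (fun i => X i + C (v i))
  have hτ : ∀ v y p, eval y (τ v p) = eval (y + v) p := by
    intro v y p
    rw [eval, eval₂Hom_bind₁, eval]
    congr 2
    funext i
    simp
  have hτ2 : ∀ v p, τ (-v) (τ v p) = p := by
    intro v p
    apply MvPolynomial.funext
    intro y
    rw [hτ, hτ]
    simp
  have htr : Tendsto (fun y => y + y0) (𝓝 0) (𝓝 y0) := by
    have : ContinuousAt (fun y : Fin n → ℝ => y + y0) 0 := by fun_prop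
    simpa using this.tendsto
  obtain ⟨s, hs, hdvd⟩ := AN0 (τ y0 a) (τ y0 b) (fun y => c (y + y0)) (by
    refine AnalyticAt.comp' (g := c) (by simpa using hc) (f := fun y => y + y0) ?_
    exact analyticAt_id.add analyticAt_const) (by
    filter_upwards [htr.eventually h] with y hy
    rw [hτ, hτ, hy])
  have h1 := map_dvd (τ (-y0)) hdvd
  rw [map_mul, hτ2, hτ2] at h1
  have h2 : b ∣ τ (-y0) (1 - s) := hab.symm.dvd_of_dvd_mul_right h1
  obtain ⟨q, hq⟩ := h2
  have h3 := congrArg (eval y0) hq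
  rw [hτ, map_mul] at h3
  intro h0
  rw [h0] at h3
  rw [add_neg_cancel, map_sub, map_one, hs] at h3
  simp at h3

end RRJC


namespace RRJC
open MvPolynomial Topology Filter

/-- A rational function together with the everywhere defined function it induces. -/
def Reg {n : ℕ} (r : FractionRing (MvPolynomial (Fin n) ℝ)) (φ : (Fin n → ℝ) → ℝ) : Prop :=
  ∃ p q : MvPolynomial (Fin n) ℝ, (∀ x, eval x q ≠ 0) ∧
    r = algebraMap (MvPolynomial (Fin n) ℝ) (FractionRing (MvPolynomial (Fin n) ℝ)) p /
      algebraMap (MvPolynomial (Fin n) ℝ) (FractionRing (MvPolynomial (Fin n) ℝ)) q ∧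
    ∀ x, φ x = eval x p / eval x q

theorem ne_of_eval {n : ℕ} {q : MvPolynomial (Fin n) ℝ} (h : ∀ x, eval x q ≠ 0) : q ≠ 0 := by
  rintro rfl
  exact h 0 (map_zero _)

theorem amap_ne {n : ℕ} {q : MvPolynomial (Fin n) ℝ} (h : q ≠ 0) :
    algebraMap (MvPolynomial (Fin n) ℝ) (FractionRing (MvPolynomial (Fin n) ℝ)) q ≠ 0 := by
  intro h0
  exact h ((IsFractionRing.injective (MvPolynomial (Fin n) ℝ) (FractionRing (MvPolynomial (Fin n) ℝ)))
    (h0.trans (map_zero _).symm))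

theorem Reg.poly {n : ℕ} (p : MvPolynomial (Fin n) ℝ) :
    Reg (algebraMap (MvPolynomial (Fin n) ℝ) (FractionRing (MvPolynomial (Fin n) ℝ)) p)
      (fun x => eval x p) :=
  ⟨p, 1, by simp, by simp, by simp⟩

theorem Reg.add {n : ℕ} {r s : FractionRing (MvPolynomial (Fin n) ℝ)} {φ ψ : (Fin n → ℝ) → ℝ}
    (h1 : Reg r φ) (h2 : Reg s ψ) : Reg (r + s) (fun x => φ x + ψ x) := by
  obtain ⟨p, q, hq, hr, hφ⟩ := h1
  obtain ⟨p', q', hq', hs, hψ⟩ := h2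
  refine ⟨p * q' + q * p', q * q', fun x => ?_, ?_, fun x => ?_⟩
  · rw [map_mul]; exact mul_ne_zero (hq x) (hq' x)
  · rw [hr, hs, div_add_div _ _ (amap_ne (ne_of_eval hq)) (amap_ne (ne_of_eval hq'))]
    simp only [map_add, map_mul]
  · beta_reduce
    rw [hφ, hψ, div_add_div _ _ (hq x) (hq' x)]
    simp only [map_add, map_mul]

theorem Reg.mul {n : ℕ} {r s : FractionRing (MvPolynomial (Fin n) ℝ)} {φ ψ : (Fin n → ℝ) → ℝ}
    (h1 : Reg r φ) (h2 : Reg s ψ) : Reg (r * s) (fun x => φ x * ψ x) := by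
  obtain ⟨p, q, hq, hr, hφ⟩ := h1
  obtain ⟨p', q', hq', hs, hψ⟩ := h2
  refine ⟨p * p', q * q', fun x => ?_, ?_, fun x => ?_⟩
  · rw [map_mul]; exact mul_ne_zero (hq x) (hq' x)
  · rw [hr, hs, div_mul_div_comm]
    simp only [map_mul]
  · beta_reduce
    rw [hφ, hψ, div_mul_div_comm]
    simp only [map_mul]

theorem Reg.aeval {n : ℕ} {F : (Fin n → ℝ) → (Fin n → ℝ)}
    {f : Fin n → FractionRing (MvPolynomial (Fin n) ℝ)} (hF : ∀ i, Reg (f i) (fun x => F x i))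
    (h : MvPolynomial (Fin n) ℝ) : Reg (MvPolynomial.aeval f h) (fun x => eval (F x) h) := by
  induction h using MvPolynomial.induction_on with
  | C a =>
    have := Reg.poly (n := n) (C a)
    simp only [eval_C] at this
    simp only [eval_C, aeval_C]
    rwa [IsScalarTower.algebraMap_apply ℝ (MvPolynomial (Fin n) ℝ), MvPolynomial.algebraMap_eq]
  | add p q hp hq =>
    simp only [map_add]
    exact hp.add hq
  | mul_X p j hp =>
    simp only [map_mul, eval_X, aeval_X]
    exact hp.mul (hF j)

theorem Reg.unique {n : ℕ} {r : FractionRing (MvPolynomial (Fin n) ℝ)} {φ ψ : (Fin n → ℝ) → ℝ}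
    (h1 : Reg r φ) (h2 : Reg r ψ) : φ = ψ := by
  obtain ⟨p, q, hq, hr, hφ⟩ := h1
  obtain ⟨p', q', hq', hs, hψ⟩ := h2
  rw [hr, div_eq_div_iff (amap_ne (ne_of_eval hq)) (amap_ne (ne_of_eval hq')), ← map_mul,
    ← map_mul] at hs
  have h := (IsFractionRing.injective (MvPolynomial (Fin n) ℝ)
    (FractionRing (MvPolynomial (Fin n) ℝ))) hs
  funext x
  rw [hφ, hψ, div_eq_div_iff (hq x) (hq' x), ← map_mul, ← map_mul, h]

theorem Reg.analytic {n : ℕ} {r : FractionRing (MvPolynomial (Fin n) ℝ)} {φ : (Fin n → ℝ) → ℝ}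
    (h1 : Reg r φ) (x : Fin n → ℝ) : AnalyticAt ℝ φ x := by
  obtain ⟨p, q, hq, hr, hφ⟩ := h1
  have : φ = fun x => eval x p / eval x q := funext hφ
  rw [this]
  exact (analyticAt_eval p x).div (analyticAt_eval q x) (hq x)

theorem loc {n : ℕ} (F : (Fin n → ℝ) → (Fin n → ℝ)) (hF : ∀ x, AnalyticAt ℝ F x)
    (hjac : ∀ x : Fin n → ℝ, (fderiv ℝ F x).det ≠ 0) (x0 : Fin n → ℝ) :
    ∃ g : (Fin n → ℝ) → (Fin n → ℝ), AnalyticAt ℝ g (F x0) ∧ g (F x0) = x0 ∧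
      (∀ᶠ y in 𝓝 (F x0), F (g y) = y) := by
  have hd := hjac x0
  let e := ContinuousLinearMap.toContinuousLinearEquivOfDetNeZero _ hd
  have he : HasFDerivAt F (e : (Fin n → ℝ) →L[ℝ] (Fin n → ℝ)) x0 := by
    refine (hF x0).differentiableAt.hasFDerivAt.congr_fderiv ?_
    exact (ContinuousLinearMap.coe_toContinuousLinearEquivOfDetNeZero _ hd).symm
  obtain ⟨g, h1, h2, h3, -⟩ := local_inv F x0 (hF x0) e he
  exact ⟨g, h1, h2, h3⟩

theorem vanish_range {n : ℕ} (F : (Fin n → ℝ) → (Fin n → ℝ)) (hF : ∀ x, AnalyticAt ℝ F x)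
    (hjac : ∀ x : Fin n → ℝ, (fderiv ℝ F x).det ≠ 0) (h : MvPolynomial (Fin n) ℝ)
    (hz : ∀ x, eval (F x) h = 0) : h = 0 := by
  obtain ⟨g, -, -, hg⟩ := loc F hF hjac 0
  obtain ⟨U, hU, hUo, hx⟩ := eventually_nhds_iff.1 hg
  refine vanish_open h U hUo ⟨_, hx⟩ fun y hy => ?_
  rw [← hU y hy]
  exact hz _

theorem core1 {n : ℕ} (F : (Fin n → ℝ) → (Fin n → ℝ))
    (f : Fin n → FractionRing (MvPolynomial (Fin n) ℝ))
    (hF : ∀ i, Reg (f i) (fun x => F x i))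
    (hjac : ∀ x : Fin n → ℝ, (fderiv ℝ F x).det ≠ 0)
    (hbir : IntermediateField.adjoin ℝ (Set.range f) = ⊤) :
    (∀ x, AnalyticAt ℝ F x) ∧ (∀ h : MvPolynomial (Fin n) ℝ, MvPolynomial.aeval f h = 0 → h = 0) ∧
    ∃ a b : Fin n → MvPolynomial (Fin n) ℝ,
      (∀ i, MvPolynomial.aeval f (a i) = algebraMap (MvPolynomial (Fin n) ℝ)
        (FractionRing (MvPolynomial (Fin n) ℝ)) (X i) * MvPolynomial.aeval f (b i)) ∧
      (∀ i x, eval (F x) (a i) = x i * eval (F x) (b i)) ∧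
      (∀ i x, eval (F x) (b i) ≠ 0) := by
  have hFa : ∀ x, AnalyticAt ℝ F x := fun x => AnalyticAt.pi (fun i => (hF i).analytic x)
  have hinj : ∀ h : MvPolynomial (Fin n) ℝ, MvPolynomial.aeval f h = 0 → h = 0 := by
    intro h hh
    apply vanish_range F hFa hjac
    intro x
    have h1 := Reg.aeval hF h
    rw [hh] at h1
    have h2 := Reg.poly (n := n) 0
    rw [map_zero] at h2
    have := congrFun (h1.unique h2) x
    simpa using this
  refine ⟨hFa, hinj, ?_⟩
  have hex : ∀ i : Fin n, ∃ a b : MvPolynomial (Fin n) ℝ, IsRelPrime a b ∧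
      MvPolynomial.aeval f a = algebraMap (MvPolynomial (Fin n) ℝ)
        (FractionRing (MvPolynomial (Fin n) ℝ)) (X i) * MvPolynomial.aeval f b := by
    intro i
    have hm : algebraMap (MvPolynomial (Fin n) ℝ) (FractionRing (MvPolynomial (Fin n) ℝ)) (X i) ∈
        IntermediateField.adjoin ℝ (Set.range f) := by rw [hbir]; trivial
    rw [IntermediateField.mem_adjoin_range_iff] at hm
    obtain ⟨r, s, hrs⟩ := hm
    have hX := amap_ne (n := n) (X_ne_zero (R := ℝ) i)
    have hs : MvPolynomial.aeval f s ≠ 0 := by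
      intro h
      rw [h, div_zero] at hrs
      exact hX hrs
    have hs0 : s ≠ 0 := by
      rintro rfl
      exact hs (map_zero _)
    obtain ⟨a, b, c, hab, ha, hb⟩ := UniqueFactorizationMonoid.exists_reduced_factors' r s hs0
    refine ⟨a, b, hab, ?_⟩
    rw [eq_div_iff hs, ← ha, ← hb, map_mul, map_mul] at hrs
    have hc : MvPolynomial.aeval f c ≠ 0 := by
      intro h
      rw [← hb, map_mul, h, zero_mul] at hs
      exact hs rfl
    apply mul_left_cancel₀ hc
    rw [← hrs]
    ring
  choose a b hab hxa using hex
  have hev : ∀ i x, eval (F x) (a i) = x i * eval (F x) (b i) := by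
    intro i x
    have h1 := Reg.aeval hF (a i)
    rw [hxa] at h1
    have h2 := (Reg.poly (X i)).mul (Reg.aeval hF (b i))
    have := congrFun (h1.unique h2) x
    simpa using this
  refine ⟨a, b, hxa, hev, ?_⟩
  intro i x
  obtain ⟨g, hg1, hg2, hg3⟩ := loc F hFa hjac x
  refine AN (a i) (b i) (hab i) (fun y => g y i) (F x) ?_ ?_
  · exact (analyticAt_pi_iff.1 hg1) i
  · filter_upwards [hg3] with y hy
    have := hev i (g y)
    rwa [hy] at this

end RRJC


namespace RRJC
open MvPolynomial Topology Filter

theorem core2 {n : ℕ} (F : (Fin n → ℝ) → (Fin n → ℝ))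
    (f : Fin n → FractionRing (MvPolynomial (Fin n) ℝ))
    (hF : ∀ i, Reg (f i) (fun x => F x i))
    (hFa : ∀ x, AnalyticAt ℝ F x)
    (hjac : ∀ x : Fin n → ℝ, (fderiv ℝ F x).det ≠ 0)
    (a b : Fin n → MvPolynomial (Fin n) ℝ)
    (hev : ∀ i x, eval (F x) (a i) = x i * eval (F x) (b i))
    (hb : ∀ i x, eval (F x) (b i) ≠ 0) :
    (∀ i y, eval y (b i) ≠ 0) ∧ (∀ y, F (fun i => eval y (a i) / eval y (b i)) = y) := by
  have hBb : ∀ y, eval y (∏ i, b i) ≠ 0 → ∀ i, eval y (b i) ≠ 0 := by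
    intro y hy i
    rw [map_prod, Finset.prod_ne_zero_iff] at hy
    exact hy i (Finset.mem_univ i)
  have hBF : ∀ x, eval (F x) (∏ i, b i) ≠ 0 := by
    intro x
    rw [map_prod, Finset.prod_ne_zero_iff]
    exact fun i _ => hb i x
  have hxF : ∀ x, (fun i => eval (F x) (a i) / eval (F x) (b i)) = x := by
    intro x
    funext i
    rw [hev, mul_div_cancel_right₀ _ (hb i x)]
  have hR : ∀ y, eval y (∏ i, b i) ≠ 0 → ∀ i, eval y (∏ i, b i) * (eval y (a i) / eval y (b i)) =
      eval y (a i * ∏ j ∈ Finset.univ.erase i, b j) := by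
    intro y hy i
    rw [← Finset.mul_prod_erase Finset.univ b (Finset.mem_univ i), map_mul, map_mul]
    have := hBb y hy i
    field_simp
  have hFG : ∀ y, eval y (∏ i, b i) ≠ 0 →
      F (fun i => eval y (a i) / eval y (b i)) = y := by
    intro y hy
    funext i
    obtain ⟨p, q, hq, -, hφ⟩ := hF i
    obtain ⟨N1, H1, hH1⟩ := homog (A0 := ℝ) (∏ i, b i)
      (fun i => a i * ∏ j ∈ Finset.univ.erase i, b j) q
    obtain ⟨N2, H2, hH2⟩ := homog (A0 := ℝ) (∏ i, b i)
      (fun i => a i * ∏ j ∈ Finset.univ.erase i, b j) p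
    have e1 : ∀ y, eval y (∏ i, b i) ≠ 0 → eval y (∏ i, b i) ^ N1 *
        eval (fun i => eval y (a i) / eval y (b i)) q = eval y H1 := by
      intro y hy
      have := hH1 ℝ (eval y) _ (hR y hy)
      rwa [Subsingleton.elim ((eval y).comp (algebraMap ℝ (MvPolynomial (Fin n) ℝ)))
        (RingHom.id ℝ)] at this
    have e2 : ∀ y, eval y (∏ i, b i) ≠ 0 → eval y (∏ i, b i) ^ N2 *
        eval (fun i => eval y (a i) / eval y (b i)) p = eval y H2 := by
      intro y hy
      have := hH2 ℝ (eval y) _ (hR y hy)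
      rwa [Subsingleton.elim ((eval y).comp (algebraMap ℝ (MvPolynomial (Fin n) ℝ)))
        (RingHom.id ℝ)] at this
    have key : X i * H1 * (∏ i, b i) ^ N2 - H2 * (∏ i, b i) ^ N1 = 0 := by
      apply vanish_range F hFa hjac
      intro x
      have h1 := e1 _ (hBF x)
      have h2 := e2 _ (hBF x)
      rw [hxF] at h1 h2
      have h3 := hφ x
      beta_reduce at h3
      rw [eq_div_iff (hq x)] at h3
      rw [map_sub, map_mul, map_mul, map_mul, map_pow, map_pow, eval_X, ← h1, ← h2, ← h3]
      ring
    have h1 := e1 y hy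
    have h2 := e2 y hy
    have h4 := congrArg (eval y) key
    rw [map_sub, map_mul, map_mul, map_mul, map_pow, map_pow, eval_X, ← h1, ← h2, map_zero] at h4
    have h3 := hφ (fun i => eval y (a i) / eval y (b i))
    beta_reduce at h3
    rw [h3, div_eq_iff (hq _)]
    apply mul_left_cancel₀ (mul_ne_zero (pow_ne_zero N1 hy) (pow_ne_zero N2 hy))
    linear_combination -h4
  have hT := theoremT (∏ i, b i) F (fun y i => eval y (a i) / eval y (b i))
    (continuous_iff_continuousAt.2 fun x => (hFa x).continuousAt) hBF (by
      apply continuousOn_pi.2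
      intro i
      exact (continuous_eval' _).continuousOn.div (continuous_eval' _).continuousOn
        (fun y hy => hBb y hy i)) hFG
  exact ⟨fun i y => hBb y (hT y) i, fun y => hFG y (hT y)⟩

end RRJC


namespace RRJC
open MvPolynomial

/-- polynomials with coefficients in the subfield `k` -/
def KP (n : ℕ) (k : Subfield ℝ) : Subring (MvPolynomial (Fin n) ℝ) where
  carrier := {p | ∀ m, coeff m p ∈ k}
  mul_mem' := by
    classical
    intro p q hp hq m
    rw [coeff_mul]
    exact sum_mem fun x _ => mul_mem (hp _) (hq _)
  one_mem' := by
    classical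
    intro m
    rw [coeff_one]
    split_ifs
    · exact one_mem _
    · exact zero_mem _
  add_mem' := by
    intro p q hp hq m
    rw [coeff_add]
    exact add_mem (hp m) (hq m)
  zero_mem' := by
    intro m
    rw [coeff_zero]
    exact zero_mem _
  neg_mem' := by
    intro p hp m
    rw [coeff_neg]
    exact neg_mem (hp m)

theorem KP_X {n : ℕ} (k : Subfield ℝ) (i : Fin n) : (X i : MvPolynomial (Fin n) ℝ) ∈ KP n k := by
  classical
  intro m
  rw [coeff_X']
  split_ifs
  · exact one_mem _
  · exact zero_mem _

/-- apply a linear functional to the coefficients -/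
noncomputable def lamP {n : ℕ} {k : Subfield ℝ} (l : ℝ →ₗ[k] k) (p : MvPolynomial (Fin n) ℝ) :
    MvPolynomial (Fin n) ℝ :=
  ∑ m ∈ p.support, monomial m (l (coeff m p) : ℝ)

theorem coeff_lamP {n : ℕ} {k : Subfield ℝ} (l : ℝ →ₗ[k] k) (p : MvPolynomial (Fin n) ℝ)
    (m : Fin n →₀ ℕ) : coeff m (lamP l p) = l (coeff m p) := by
  classical
  rw [lamP, coeff_sum]
  simp only [coeff_monomial]
  rw [Finset.sum_ite_eq']
  split_ifs with h
  · rfl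
  · rw [notMem_support_iff.1 h, map_zero]
    rfl

theorem lamP_mem {n : ℕ} {k : Subfield ℝ} (l : ℝ →ₗ[k] k) (p : MvPolynomial (Fin n) ℝ) :
    lamP l p ∈ KP n k := by
  intro m
  rw [coeff_lamP]
  exact (l _).2

theorem l_mul {k : Subfield ℝ} (l : ℝ →ₗ[k] k) (c : ℝ) {d : ℝ} (hd : d ∈ k) :
    (l (c * d) : ℝ) = l c * d := by
  have : c * d = (⟨d, hd⟩ : k) • c := by
    rw [mul_comm]
    rfl
  rw [this, map_smul, mul_comm]
  rfl

theorem lamP_mul {n : ℕ} {k : Subfield ℝ} (l : ℝ →ₗ[k] k) (p q : MvPolynomial (Fin n) ℝ)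
    (hq : q ∈ KP n k) : lamP l (p * q) = lamP l p * q := by
  classical
  ext m
  rw [coeff_lamP, coeff_mul, coeff_mul, map_sum, AddSubmonoidClass.coe_finset_sum]
  apply Finset.sum_congr rfl
  intro x _
  rw [coeff_lamP, l_mul l _ (hq _)]

theorem lamP_add {n : ℕ} {k : Subfield ℝ} (l : ℝ →ₗ[k] k) (p q : MvPolynomial (Fin n) ℝ) :
    lamP l (p + q) = lamP l p + lamP l q := by
  ext m
  simp [coeff_lamP]

theorem lamP_sum {n : ℕ} {k : Subfield ℝ} (l : ℝ →ₗ[k] k) {ι : Type*} (S : Finset ι)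
    (p : ι → MvPolynomial (Fin n) ℝ) :
    lamP l (∑ i ∈ S, p i) = ∑ i ∈ S, lamP l (p i) := by
  ext m
  simp [coeff_lamP, coeff_sum]

theorem lamP_C {n : ℕ} {k : Subfield ℝ} (l : ℝ →ₗ[k] k) (c : ℝ) :
    lamP (n := n) l (C c) = C (l c : ℝ) := by
  classical
  ext m
  rw [coeff_lamP, coeff_C, coeff_C]
  split_ifs
  · rfl
  · rw [map_zero]
    rfl

theorem eval_mem {n : ℕ} {k : Subfield ℝ} (x : Fin n → ℝ) (hx : ∀ i, x i ∈ k)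
    (l : ℝ →ₗ[k] k) (p : MvPolynomial (Fin n) ℝ) : eval x (lamP l p) = l (eval x p) := by
  rw [lamP, map_sum, eval_eq, map_sum, AddSubmonoidClass.coe_finset_sum]
  apply Finset.sum_congr rfl
  intro m _
  rw [eval_monomial, l_mul]
  · rfl
  · exact prod_mem fun i _ => pow_mem (hx i) _

theorem exists_l {k : Subfield ℝ} {c : ℝ} (hc : c ≠ 0) : ∃ l : ℝ →ₗ[k] k, (l c : ℝ) ≠ 0 := by
  by_contra! h
  apply hc
  rw [← Module.forall_dual_apply_eq_zero_iff k c]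
  intro l
  exact Subtype.ext (h l)

theorem value_mem {n : ℕ} {k : Subfield ℝ} {r : FractionRing (MvPolynomial (Fin n) ℝ)}
    {φ : (Fin n → ℝ) → ℝ} (hr : Reg r φ) (hk : MemSubfieldFuncField n k r)
    (x : Fin n → ℝ) (hx : ∀ i, x i ∈ k) : φ x ∈ k := by
  obtain ⟨p, q, hq, hpq, hφ⟩ := hr
  obtain ⟨p', q', hp', hq', hq0, hr'⟩ := hk
  rw [hpq, div_eq_div_iff (amap_ne (ne_of_eval hq)) (amap_ne hq0), ← map_mul,
    ← map_mul] at hr'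
  have h := (IsFractionRing.injective (MvPolynomial (Fin n) ℝ)
    (FractionRing (MvPolynomial (Fin n) ℝ))) hr'
  obtain ⟨l, hl⟩ := exists_l (k := k) (hq x)
  have h1 := congrArg (lamP l) h
  rw [lamP_mul l _ _ hq', mul_comm p' q, lamP_mul l _ _ hp'] at h1
  have h2 : p * lamP l q = q * lamP l p := by
    apply mul_right_cancel₀ hq0
    linear_combination (lamP l q) * h - q * h1
  have h3 := congrArg (eval x) h2
  rw [map_mul, map_mul, eval_mem x hx, eval_mem x hx] at h3
  have h4 : φ x = (l (eval x p) : ℝ) / l (eval x q) := by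
    rw [hφ, div_eq_div_iff (hq x) hl, h3, mul_comm]
  rw [h4]
  exact div_mem (l _).2 (l _).2

theorem aeval_sum {n : ℕ} (f : Fin n → FractionRing (MvPolynomial (Fin n) ℝ))
    (S : Finset (Fin n →₀ ℕ)) (h : MvPolynomial (Fin n) ℝ) (hS : h.support ⊆ S) :
    aeval f h = ∑ m ∈ S, algebraMap (MvPolynomial (Fin n) ℝ)
        (FractionRing (MvPolynomial (Fin n) ℝ)) (C (coeff m h)) * ∏ j, f j ^ m j := by
  rw [aeval_def, eval₂_eq']
  refine (Finset.sum_congr rfl fun m _ => ?_).trans (Finset.sum_subset hS fun m _ hm => ?_)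
  · rw [IsScalarTower.algebraMap_apply ℝ (MvPolynomial (Fin n) ℝ), MvPolynomial.algebraMap_eq]
  · rw [notMem_support_iff.1 hm]
    simp

theorem descend {n : ℕ} {k : Subfield ℝ} (f : Fin n → FractionRing (MvPolynomial (Fin n) ℝ))
    (hk : ∀ i, MemSubfieldFuncField n k (f i)) (a b : MvPolynomial (Fin n) ℝ) (i : Fin n)
    (h : aeval f a = algebraMap (MvPolynomial (Fin n) ℝ)
        (FractionRing (MvPolynomial (Fin n) ℝ)) (X i) * aeval f b) (l : ℝ →ₗ[k] k) :
    aeval f (lamP l a) = algebraMap (MvPolynomial (Fin n) ℝ)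
        (FractionRing (MvPolynomial (Fin n) ℝ)) (X i) * aeval f (lamP l b) := by
  classical
  choose p q hp hq hq0 hf using hk
  let S := a.support ∪ b.support
  let N := S.sup Finsupp.degree
  let Q := ∏ j, q j
  let R : Fin n → MvPolynomial (Fin n) ℝ := fun j => p j * ∏ t ∈ Finset.univ.erase j, q t
  let W : (Fin n →₀ ℕ) → MvPolynomial (Fin n) ℝ := fun m => Q ^ (N - m.degree) * ∏ j, R j ^ m j
  have hQ0 : Q ≠ 0 := Finset.prod_ne_zero_iff.2 fun j _ => hq0 j
  have hQK : Q ∈ KP n k := prod_mem fun j _ => hq j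
  have hRK : ∀ j, R j ∈ KP n k := fun j => mul_mem (hp j) (prod_mem fun t _ => hq t)
  have hWK : ∀ m, W m ∈ KP n k := fun m =>
    mul_mem (pow_mem hQK _) (prod_mem fun j _ => pow_mem (hRK j) _)
  have hR : ∀ j, algebraMap _ (FractionRing (MvPolynomial (Fin n) ℝ)) Q * f j =
      algebraMap _ _ (R j) := by
    intro j
    have hne := amap_ne (hq0 j)
    simp only [Q, R]
    rw [← Finset.mul_prod_erase Finset.univ q (Finset.mem_univ j), map_mul, map_mul, hf]
    field_simp
  have hW : ∀ m ∈ S, algebraMap _ (FractionRing (MvPolynomial (Fin n) ℝ)) Q ^ N * ∏ j, f j ^ m j =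
      algebraMap _ _ (W m) := by
    intro m hm
    have hle : m.degree ≤ N := Finset.le_sup (f := Finsupp.degree) hm
    simp only [W]
    rw [map_mul, map_pow, map_prod _ (fun j => R j ^ m j)]
    have hj : ∀ j, algebraMap _ (FractionRing (MvPolynomial (Fin n) ℝ)) (R j ^ m j) =
        algebraMap _ (FractionRing (MvPolynomial (Fin n) ℝ)) Q ^ m j * f j ^ m j := by
      intro j
      rw [map_pow, ← hR, mul_pow]
    rw [Finset.prod_congr rfl (fun j _ => hj j), Finset.prod_mul_distrib, Finset.prod_pow_eq_pow_sum, ← Finsupp.degree_eq_sum, ← mul_assoc,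
      ← pow_add, Nat.sub_add_cancel hle]
  have hT : ∀ h : MvPolynomial (Fin n) ℝ, h.support ⊆ S →
      algebraMap _ (FractionRing (MvPolynomial (Fin n) ℝ)) Q ^ N * aeval f h =
      algebraMap _ _ (∑ m ∈ S, C (coeff m h) * W m) := by
    intro h hS
    rw [aeval_sum f S h hS, Finset.mul_sum, map_sum]
    apply Finset.sum_congr rfl
    intro m hm
    rw [map_mul, ← hW m hm]
    ring
  have hlT : ∀ h : MvPolynomial (Fin n) ℝ, lamP l (∑ m ∈ S, C (coeff m h) * W m) =
      ∑ m ∈ S, C (coeff m (lamP l h)) * W m := by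
    intro h
    rw [lamP_sum]
    apply Finset.sum_congr rfl
    intro m _
    rw [lamP_mul _ _ _ (hWK m), lamP_C, coeff_lamP]
  have hsupp : ∀ h : MvPolynomial (Fin n) ℝ, (lamP l h).support ⊆ h.support := by
    intro h m hm
    rw [mem_support_iff] at hm ⊢
    intro h0
    apply hm
    rw [coeff_lamP, h0, map_zero]
    rfl
  have ha : a.support ⊆ S := Finset.subset_union_left
  have hb : b.support ⊆ S := Finset.subset_union_right
  have hQN : algebraMap _ (FractionRing (MvPolynomial (Fin n) ℝ)) Q ^ N ≠ 0 :=
    pow_ne_zero _ (amap_ne hQ0)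
  have h1 : (∑ m ∈ S, C (coeff m a) * W m) = (∑ m ∈ S, C (coeff m b) * W m) * X i := by
    apply IsFractionRing.injective (MvPolynomial (Fin n) ℝ) (FractionRing (MvPolynomial (Fin n) ℝ))
    rw [map_mul, ← hT a ha, ← hT b hb, h]
    ring
  have h2 := congrArg (lamP l) h1
  rw [lamP_mul _ _ _ (KP_X k i), hlT, hlT] at h2
  apply mul_left_cancel₀ hQN
  rw [hT _ ((hsupp a).trans ha), h2, map_mul, ← hT _ ((hsupp b).trans hb)]
  ring

theorem final {n : ℕ} (F : (Fin n → ℝ) → (Fin n → ℝ))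
    (f : Fin n → FractionRing (MvPolynomial (Fin n) ℝ))
    (hF : IsEverywhereDefRatMap n F f)
    (hjac : ∀ x : Fin n → ℝ, (fderiv ℝ F x).det ≠ 0)
    (hbir : IntermediateField.adjoin ℝ (Set.range f) = ⊤) :
    Function.Bijective F ∧
    ∃ (G : (Fin n → ℝ) → (Fin n → ℝ)) (g : Fin n → FractionRing (MvPolynomial (Fin n) ℝ)),
      IsEverywhereDefRatMap n G g ∧
      (∀ x, G (F x) = x) ∧ (∀ y, F (G y) = y) ∧
      ∀ k : Subfield ℝ, (∀ i, MemSubfieldFuncField n k (f i)) →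
        (∀ i, MemSubfieldFuncField n k (g i)) ∧
        Set.BijOn F {x | ∀ i, x i ∈ k} {x | ∀ i, x i ∈ k} ∧
        Set.BijOn G {x | ∀ i, x i ∈ k} {x | ∀ i, x i ∈ k} := by
  have hF' : ∀ i, Reg (f i) (fun x => F x i) := hF
  obtain ⟨hFa, hinj, a, b, hxa, hev, hbF⟩ := core1 F f hF' hjac hbir
  obtain ⟨hb, hFG⟩ := core2 F f hF' hFa hjac a b hev hbF
  have hGF : ∀ x, (fun i => eval (F x) (a i) / eval (F x) (b i)) = x := by
    intro x
    funext i
    rw [hev, mul_div_cancel_right₀ _ (hbF i x)]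
  have hGr : IsEverywhereDefRatMap n (fun y i => eval y (a i) / eval y (b i))
      (fun i => algebraMap (MvPolynomial (Fin n) ℝ) (FractionRing (MvPolynomial (Fin n) ℝ)) (a i) /
      algebraMap (MvPolynomial (Fin n) ℝ) (FractionRing (MvPolynomial (Fin n) ℝ)) (b i)) :=
    fun i => ⟨a i, b i, hb i, rfl, fun _ => rfl⟩
  refine ⟨⟨fun x y hxy => ?_, fun y => ⟨_, hFG y⟩⟩, _, _, hGr, hGF, hFG, ?_⟩
  · rw [← hGF x, ← hGF y, hxy]
  intro k hk
  have hgk : ∀ i, MemSubfieldFuncField n k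
      (algebraMap (MvPolynomial (Fin n) ℝ) (FractionRing (MvPolynomial (Fin n) ℝ)) (a i) /
      algebraMap (MvPolynomial (Fin n) ℝ) (FractionRing (MvPolynomial (Fin n) ℝ)) (b i)) := by
    intro i
    have hb0 := ne_of_eval (hb i)
    obtain ⟨m, hm⟩ := MvPolynomial.ne_zero_iff.1 hb0
    obtain ⟨l, hl⟩ := exists_l (k := k) hm
    have hlb : lamP l (b i) ≠ 0 := by
      intro h0
      apply hl
      rw [← coeff_lamP, h0, coeff_zero]
    refine ⟨lamP l (a i), lamP l (b i), lamP_mem l _, lamP_mem l _, hlb, ?_⟩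
    rw [div_eq_div_iff (amap_ne hb0) (amap_ne hlb), ← map_mul, ← map_mul]
    congr 1
    rw [← sub_eq_zero]
    apply hinj
    rw [map_sub, map_mul, map_mul, descend f hk _ _ i (hxa i) l, hxa i]
    ring
  have hFk : Set.MapsTo F {x | ∀ i, x i ∈ k} {x | ∀ i, x i ∈ k} := fun x hx i =>
    value_mem (hF' i) (hk i) x hx
  have hGk : Set.MapsTo (fun y i => eval y (a i) / eval y (b i)) {x | ∀ i, x i ∈ k}
      {x | ∀ i, x i ∈ k} := fun x hx i =>
    value_mem (hGr i) (hgk i) x hx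
  refine ⟨hgk, ?_, ?_⟩
  · exact Set.InvOn.bijOn (f' := fun y i => eval y (a i) / eval y (b i))
      ⟨fun x _ => hGF x, fun y _ => hFG y⟩ hFk hGk
  · exact Set.InvOn.bijOn (f' := F) ⟨fun y _ => hFG y, fun x _ => hGF x⟩ hGk hFk

end RRJC

/-- birational case of the rational real Jacobian conjecture: an everywhere
defined real rational map with nowhere vanishing Jacobian determinant which is birational
is a bijection of `ℝⁿ` onto itself whose inverse is again an everywhere defined real
rational map; moreover if all components of `F` lie in `k(x₁, …, xₙ)` for a subfield
`k ⊆ ℝ`, then so do the components of the inverse, and both `F` and its inverse restrict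
to bijections of `kⁿ` onto `kⁿ`. -/
theorem birational_case_RRJC
    (n : ℕ) (F : (Fin n → ℝ) → (Fin n → ℝ))
    (f : Fin n → FractionRing (MvPolynomial (Fin n) ℝ))
    (hF : IsEverywhereDefRatMap n F f)
    (hjac : ∀ x : Fin n → ℝ, (fderiv ℝ F x).det ≠ 0)
    (hbir : IntermediateField.adjoin ℝ (Set.range f) = ⊤) :
    Function.Bijective F ∧
    ∃ (G : (Fin n → ℝ) → (Fin n → ℝ)) (g : Fin n → FractionRing (MvPolynomial (Fin n) ℝ)),
      IsEverywhereDefRatMap n G g ∧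
      (∀ x, G (F x) = x) ∧ (∀ y, F (G y) = y) ∧
      ∀ k : Subfield ℝ, (∀ i, MemSubfieldFuncField n k (f i)) →
        (∀ i, MemSubfieldFuncField n k (g i)) ∧
        Set.BijOn F {x | ∀ i, x i ∈ k} {x | ∀ i, x i ∈ k} ∧
        Set.BijOn G {x | ∀ i, x i ∈ k} {x | ∀ i, x i ∈ k} := by
  exact RRJC.final F f hF hjac hbir
end
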